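/- arXiv:2308.14290 — 3 statements merged into one kernel-verified Lean document; each statement's English description precedes it below -/
import Mathlib

section
/- Let h be the function on (0,π)² given by the series h(x,y) = (4/π)·Σ_{k=0}^∞ (sin((2k+1)x)/(2k+1))·(F_{2k+1}(y) − coth((2k+1)π)·G_{2k+1}(y)). Then for all 0 < x < π/2 and 0 < y < π/2, cot(x) > h_x(x,y)/h(x,y), where h_x denotes the partial derivative of h in its first variable. -/
open Real Filter Set Topology

/-- Hyperbolic cotangent. -/
noncomputable def coth (t : ℝ) : ℝ := Real.cosh t / Real.sinh t

/-- `F n y = cosh (n y) + cosh (n (π − y))`. -/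
noncomputable def F (n y : ℝ) : ℝ := Real.cosh (n * y) + Real.cosh (n * (π - y))

/-- `G n y = sinh (n y) + sinh (n (π − y))`. -/
noncomputable def G (n y : ℝ) : ℝ := Real.sinh (n * y) + Real.sinh (n * (π - y))

/-- The harmonic function `h` on `(0,π)²` given by its Fourier series. -/
noncomputable def h (x y : ℝ) : ℝ :=
  (4 / π) * ∑' k : ℕ, (Real.sin ((2 * k + 1) * x) / (2 * k + 1)) *
    (F (2 * k + 1) y - coth ((2 * k + 1) * π) * G (2 * k + 1) y)

/-- Partial derivative of `h` in its first variable. -/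
noncomputable def hx (x y : ℝ) : ℝ := deriv (fun x' => h x' y) x


lemma exp_lt_one_aux {t : ℝ} (ht : t < 0) : Real.exp t < 1 := by
  rw [← Real.exp_zero]; exact Real.exp_lt_exp.2 ht

lemma hasSum_congr_aux {f g : ℕ → ℝ} {a b : ℝ} (hf : HasSum f a) (hg : ∀ k, g k = f k)
    (hb : b = a) : HasSum g b := by
  rw [hb, funext hg]; exact hf

/-- The closed form of the `y`-dependent coefficient. -/
noncomputable def cc (k : ℕ) (y : ℝ) : ℝ :=
  (Real.exp (-((2 * k + 1) * y)) + Real.exp (-((2 * k + 1) * (π - y)))) /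
    (1 + Real.exp (-((2 * k + 1) * π)))

lemma coeff_eq (k : ℕ) (y : ℝ) :
    F (2 * k + 1) y - coth ((2 * k + 1) * π) * G (2 * k + 1) y = cc k y := by
  unfold F G coth cc
  have hn : (0 : ℝ) < 2 * k + 1 := by positivity
  set n : ℝ := 2 * k + 1
  have hs : 0 < Real.sinh (n * π) := Real.sinh_pos_iff.2 (by positivity)
  rw [div_mul_eq_mul_div, sub_eq_iff_eq_add, div_add_div _ _ (by positivity) hs.ne',
    eq_div_iff (by positivity)]
  have e1 : Real.exp (-(n * (π - y))) = Real.exp (n * y) * (Real.exp (n * π))⁻¹ := by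
    rw [← Real.exp_neg, ← Real.exp_add]; ring_nf
  have e2 : Real.exp (n * (π - y)) = Real.exp (n * π) * (Real.exp (n * y))⁻¹ := by
    rw [← Real.exp_neg, ← Real.exp_add]; ring_nf
  simp only [Real.cosh_eq, Real.sinh_eq, e1, e2]
  simp only [Real.exp_neg]
  have h1 := (Real.exp_pos (n * π)).ne'
  have h2 := (Real.exp_pos (n * y)).ne'
  generalize Real.exp (n * π) = a at *
  generalize Real.exp (n * y) = b at *
  field_simp
  ring

lemma summable_exp_odd {y : ℝ} (hy : 0 < y) :
    Summable (fun k : ℕ => Real.exp (-((2 * k + 1) * y))) := by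
  have h1 : Summable (fun k : ℕ => Real.exp (-y) * (Real.exp (-(2 * y))) ^ k) :=
    (summable_geometric_of_lt_one (Real.exp_pos _).le
      (exp_lt_one_aux (by linarith))).mul_left _
  refine h1.congr fun k => ?_
  rw [← Real.exp_nat_mul, ← Real.exp_add]; ring_nf

lemma cc_nonneg (k : ℕ) (y : ℝ) : 0 ≤ cc k y := by unfold cc; positivity

lemma cc_le (k : ℕ) {y : ℝ} (hy2 : y < π / 2) :
    cc k y ≤ 2 * Real.exp (-((2 * k + 1) * y)) := by
  unfold cc
  have hn : (0 : ℝ) < 2 * k + 1 := by positivity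
  have h2 : Real.exp (-((2 * k + 1) * (π - y))) ≤ Real.exp (-((2 * k + 1) * y)) := by
    apply Real.exp_le_exp.2
    nlinarith
  have h3 := Real.exp_pos (-((2 * (k : ℝ) + 1) * π))
  have h4 := Real.exp_pos (-((2 * (k : ℝ) + 1) * y))
  rw [div_le_iff₀ (by positivity)]
  nlinarith

lemma pos_lemma (d : ℕ → ℝ) (M : ℝ) (hd : ∀ k, |d k| ≤ M) (Θ : ℝ → ℝ)
    (hΘ : ∀ s, 0 < s → HasSum (fun k : ℕ => d k * Real.exp (-((2 * k + 1) * s))) (Θ s))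
    (hanti : ∀ s t, 0 < s → s < t → Θ t < Θ s) {y : ℝ} (hy : 0 < y) (hy2 : y < π / 2) :
    0 < ∑' k : ℕ, d k * cc k y := by
  have hpi := Real.pi_pos
  let E : ℕ → ℝ → ℝ := fun k s => Real.exp (-((2 * k + 1) * s))
  let T : ℕ → ℕ → ℝ := fun i k => d k * E k (y + 2 * π * i) - d k * E k (y + 2 * π * i + π) +
    d k * E k (2 * π * i + (π - y)) - d k * E k (2 * π * i + (π - y) + π)
  have hrow : ∀ i, HasSum (T i) (Θ (y + 2 * π * i) - Θ (y + 2 * π * i + π) +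
      Θ (2 * π * i + (π - y)) - Θ (2 * π * i + (π - y) + π)) := by
    intro i
    have hi : 0 ≤ 2 * π * (i : ℝ) := by positivity
    exact (((hΘ _ (by linarith)).sub (hΘ _ (by linarith))).add (hΘ _ (by linarith))).sub
      (hΘ _ (by linarith))
  have hcol : ∀ k, HasSum (fun i => T i k) (d k * cc k y) := by
    intro k
    have hn : (0 : ℝ) < 2 * k + 1 := by positivity
    have hw1 : Real.exp (-((2 * (k : ℝ) + 1) * π)) < 1 := by
      apply exp_lt_one_aux
      have : 0 < (2 * (k : ℝ) + 1) * π := by positivity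
      linarith
    have hw0 := Real.exp_pos (-((2 * (k : ℝ) + 1) * π))
    have hg := hasSum_geometric_of_lt_one (r := Real.exp (-((2 * (k : ℝ) + 1) * π)) ^ 2)
      (by positivity) (by nlinarith)
    have hg2 := hg.mul_left (d k * (Real.exp (-((2 * k + 1) * y)) +
      Real.exp (-((2 * k + 1) * (π - y)))) * (1 - Real.exp (-((2 * (k : ℝ) + 1) * π))))
    refine hasSum_congr_aux hg2 ?_ ?_
    · intro i
      have a1 : E k (y + 2 * π * i) = Real.exp (-((2 * k + 1) * y)) *
          (Real.exp (-((2 * (k : ℝ) + 1) * π)) ^ 2) ^ i := by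
        simp only [E]
        rw [← pow_mul, ← Real.exp_nat_mul, ← Real.exp_add]; push_cast; ring_nf
      have a2 : E k (2 * π * i + (π - y)) = Real.exp (-((2 * k + 1) * (π - y))) *
          (Real.exp (-((2 * (k : ℝ) + 1) * π)) ^ 2) ^ i := by
        simp only [E]
        rw [← pow_mul, ← Real.exp_nat_mul, ← Real.exp_add]; push_cast; ring_nf
      have a3 : ∀ s, E k (s + π) = E k s * Real.exp (-((2 * (k : ℝ) + 1) * π)) := by
        intro s
        simp only [E]
        rw [← Real.exp_add]; ring_nf
      simp only [T, a3, a1, a2]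
      ring
    · unfold cc
      generalize Real.exp (-((2 * (k : ℝ) + 1) * π)) = w at *
      have : 1 - w ^ 2 ≠ 0 := by nlinarith
      have : 1 + w ≠ 0 := by positivity
      field_simp
      ring
  have hM : 0 ≤ M := (abs_nonneg _).trans (hd 0)
  have hsum : Summable (Function.uncurry T) := by
    have hs1 : Summable (fun i : ℕ => Real.exp (-(2 * π)) ^ i) :=
      summable_geometric_of_lt_one (Real.exp_pos _).le (exp_lt_one_aux (by linarith))
    have hs := ((hs1.mul_of_nonneg (summable_exp_odd hy) (fun i => by positivity)
      (fun i => by positivity)).mul_left (4 * M))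
    refine Summable.of_norm_bounded hs ?_
    rintro ⟨i, k⟩
    simp only [Function.uncurry, Real.norm_eq_abs]
    set B := Real.exp (-(2 * π)) ^ i * Real.exp (-((2 * (k : ℝ) + 1) * y)) with hB
    have key : ∀ s, y + 2 * π * i ≤ s → |d k * E k s| ≤ M * B := by
      intro s hs
      rw [abs_mul]
      refine mul_le_mul (hd k) ?_ (abs_nonneg _) hM
      rw [abs_of_pos (Real.exp_pos _), hB, ← Real.exp_nat_mul, ← Real.exp_add]
      apply Real.exp_le_exp.2
      have h1 : (2 * (k : ℝ) + 1) * (y + 2 * π * i) ≤ (2 * k + 1) * s :=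
        mul_le_mul_of_nonneg_left hs (by positivity)
      have h2 : 0 ≤ 2 * (k : ℝ) * (2 * π * i) := by positivity
      nlinarith
    have k1 := key (y + 2 * π * i) le_rfl
    have k2 := key (y + 2 * π * i + π) (by linarith)
    have k3 := key (2 * π * i + (π - y)) (by linarith)
    have k4 := key (2 * π * i + (π - y) + π) (by linarith)
    rw [abs_le] at *
    simp only [T]
    constructor <;> linarith [k1.1, k1.2, k2.1, k2.2, k3.1, k3.2, k4.1, k4.2]
  have hcomm := hsum.tsum_comm
  have e1 : (fun k => ∑' i, T i k) = fun k => d k * cc k y := funext fun k => (hcol k).tsum_eq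
  rw [e1] at hcomm
  rw [hcomm]
  have hpos : ∀ i, 0 < ∑' k, T i k := by
    intro i
    rw [(hrow i).tsum_eq]
    have hi : 0 ≤ 2 * π * (i : ℝ) := by positivity
    have h1 := hanti (y + 2 * π * i) (y + 2 * π * i + π) (by linarith) (by linarith)
    have h2 := hanti (2 * π * i + (π - y)) (2 * π * i + (π - y) + π) (by linarith) (by linarith)
    linarith
  exact Summable.tsum_pos hsum.prod (fun i => (hpos i).le) 0 (hpos 0)

lemma cexp_norm_lt {s : ℝ} (hs : 0 < s) (x : ℝ) :
    ‖Complex.exp (-(s : ℂ) + x * Complex.I)‖ < 1 := by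
  rw [Complex.norm_exp]
  simpa using hs

lemma cexp_pow (s x : ℝ) (k : ℕ) :
    Complex.exp (-(s : ℂ) + x * Complex.I) ^ (2 * k + 1) =
      Complex.exp ((-((2 * k + 1) * s) : ℝ) + ((2 * k + 1) * x : ℝ) * Complex.I) := by
  rw [← Complex.exp_nat_mul]; push_cast; ring_nf

lemma cexp_re_im (s x : ℝ) : Complex.exp (-(s : ℂ) + x * Complex.I) =
    ⟨Real.exp (-s) * Real.cos x, Real.exp (-s) * Real.sin x⟩ := by
  apply Complex.ext <;> simp [Complex.exp_re, Complex.exp_im]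

lemma closed_re {s : ℝ} (hs : 0 < s) (x : ℝ) :
    Real.sinh s * Real.cos x / (2 * (Real.sinh s ^ 2 + Real.sin x ^ 2)) =
    (Complex.exp (-(s : ℂ) + x * Complex.I) *
      (1 - Complex.exp (-(s : ℂ) + x * Complex.I) ^ 2)⁻¹).re := by
  rw [cexp_re_im]
  have hr1 := exp_lt_one_aux (neg_lt_zero.2 hs)
  have hr0 := Real.exp_pos (-s)
  have hes : Real.exp s = (Real.exp (-s))⁻¹ := by rw [Real.exp_neg, inv_inv]
  have hcs := Real.sin_sq_add_cos_sq x
  rw [Real.sinh_eq, hes]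
  simp only [Complex.mul_re, Complex.inv_re, Complex.inv_im, Complex.normSq_apply, pow_two,
    Complex.sub_re, Complex.sub_im, Complex.one_re, Complex.one_im, Complex.mul_im]
  generalize Real.exp (-s) = r at *
  generalize Real.cos x = c at *
  generalize Real.sin x = σ at *
  have hc : c * c = 1 - σ * σ := by linarith
  have hD : (1 - (r * c * (r * c) - r * σ * (r * σ))) * (1 - (r * c * (r * c) - r * σ * (r * σ))) +
      (0 - (r * c * (r * σ) + r * σ * (r * c))) * (0 - (r * c * (r * σ) + r * σ * (r * c))) =
      (1 - r ^ 2) ^ 2 + 4 * r ^ 2 * σ ^ 2 := by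
    linear_combination (-2 * r ^ 2 + r ^ 4 * (c * c + 1 - σ * σ + 2 * σ * σ)) * hc
  rw [hD]
  have hE : 2 * ((r⁻¹ - r) / 2 * ((r⁻¹ - r) / 2) + σ * σ) =
      ((1 - r ^ 2) ^ 2 + 4 * r ^ 2 * σ ^ 2) / (2 * r ^ 2) := by
    field_simp
    ring
  rw [hE]
  have : 0 < 1 - r ^ 2 := by nlinarith
  have hDpos : (1 - r ^ 2) ^ 2 + 4 * r ^ 2 * σ ^ 2 ≠ 0 := by positivity
  field_simp
  linear_combination (c * r ^ 2) * hc

lemma closed_im {s : ℝ} (hs : 0 < s) (x : ℝ) :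
    Real.arctan (Real.sin x / Real.sinh s) / 2 =
    (Complex.I * Complex.arctan (-Complex.I * Complex.exp (-(s : ℂ) + x * Complex.I))).im := by
  have hz := cexp_norm_lt hs x
  have hzz := cexp_re_im s x
  set z := Complex.exp (-(s : ℂ) + x * Complex.I) with hzdef
  have h1 : Complex.I * Complex.arctan (-Complex.I * z) =
      ((1 / 2 : ℝ) : ℂ) * Complex.log ((1 + z) / (1 - z)) := by
    unfold Complex.arctan
    have : -Complex.I * z * Complex.I = z := by
      linear_combination (-z) * Complex.I_mul_I
    rw [this]
    push_cast
    linear_combination (-Complex.log ((1 + z) / (1 - z)) / 2) * Complex.I_mul_I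
  have hr1 := exp_lt_one_aux (neg_lt_zero.2 hs)
  have hr0 := Real.exp_pos (-s)
  have hes : Real.exp s = (Real.exp (-s))⁻¹ := by rw [Real.exp_neg, inv_inv]
  have hcs := Real.sin_sq_add_cos_sq x
  have hz1 : 1 - z ≠ 0 := by
    intro hh
    rw [← sub_eq_zero.1 hh] at hz
    simp at hz
  have hN : 0 < Complex.normSq (1 - z) := Complex.normSq_pos.2 hz1
  have hre : ((1 + z) / (1 - z)).re = (1 - Real.exp (-s) ^ 2) / Complex.normSq (1 - z) := by
    rw [Complex.div_re, ← add_div]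
    congr 1
    rw [hzz]
    simp only [Complex.add_re, Complex.sub_re, Complex.add_im, Complex.sub_im, Complex.one_re,
      Complex.one_im]
    linear_combination (-Real.exp (-s) ^ 2) * hcs
  have him : ((1 + z) / (1 - z)).im = (2 * Real.exp (-s) * Real.sin x) /
      Complex.normSq (1 - z) := by
    rw [Complex.div_im, ← sub_div]
    congr 1
    rw [hzz]
    simp only [Complex.add_re, Complex.sub_re, Complex.add_im, Complex.sub_im, Complex.one_re,
      Complex.one_im]
    ring
  have hr2 : 0 < 1 - Real.exp (-s) ^ 2 := by nlinarith
  have hpos : 0 < ((1 + z) / (1 - z)).re := by rw [hre]; positivity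
  have harg := Complex.abs_arg_lt_pi_div_two_iff.2 (Or.inl hpos)
  rw [abs_lt] at harg
  have h3 := Real.arctan_tan harg.1 harg.2
  rw [Complex.tan_arg, hre, him] at h3
  rw [h1, Complex.im_ofReal_mul, Complex.log_im, ← h3, Real.sinh_eq, hes]
  have : Real.sin x / (((Real.exp (-s))⁻¹ - Real.exp (-s)) / 2) =
      2 * Real.exp (-s) * Real.sin x / Complex.normSq (1 - z) /
        ((1 - Real.exp (-s) ^ 2) / Complex.normSq (1 - z)) := by
    have : (Real.exp (-s))⁻¹ - Real.exp (-s) = (1 - Real.exp (-s) ^ 2) / Real.exp (-s) := by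
      field_simp
    rw [this]
    field_simp
  rw [this]
  ring

lemma hasSum_cos {s : ℝ} (hs : 0 < s) (x : ℝ) :
    HasSum (fun k : ℕ => Real.cos ((2 * k + 1) * x) * Real.exp (-((2 * k + 1) * s)))
      (Real.sinh s * Real.cos x / (2 * (Real.sinh s ^ 2 + Real.sin x ^ 2))) := by
  have hz := cexp_norm_lt hs x
  set z := Complex.exp (-(s : ℂ) + x * Complex.I) with hzdef
  have hz2 : ‖z ^ 2‖ < 1 := by
    rw [norm_pow]; nlinarith [norm_nonneg z]
  have hg := (hasSum_geometric_of_norm_lt_one hz2).mul_left z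
  have hre := ((Complex.hasSum_iff _ _).1 hg).1
  convert hre using 1
  · funext k
    have : z * (z ^ 2) ^ k = z ^ (2 * k + 1) := by ring
    rw [this, cexp_pow, Complex.exp_re]
    simp [mul_comm]
  · rw [closed_re hs x]

lemma hasSum_sin {s : ℝ} (hs : 0 < s) (x : ℝ) :
    HasSum (fun k : ℕ => Real.sin ((2 * k + 1) * x) / (2 * k + 1) *
        Real.exp (-((2 * k + 1) * s)))
      (Real.arctan (Real.sin x / Real.sinh s) / 2) := by
  have hz := cexp_norm_lt hs x
  set z := Complex.exp (-(s : ℂ) + x * Complex.I) with hzdef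
  have hz' : ‖-Complex.I * z‖ < 1 := by simpa using hz
  have hg := (Complex.hasSum_arctan hz').mul_left Complex.I
  have him := ((Complex.hasSum_iff _ _).1 hg).2
  convert him using 1
  · funext k
    have h1 : Complex.I * ((-1) ^ k * (-Complex.I * z) ^ (2 * k + 1) / ((2 * k + 1 : ℕ) : ℂ)) =
        z ^ (2 * k + 1) / ((2 * k + 1 : ℝ) : ℂ) := by
      have : (-Complex.I * z) ^ (2 * k + 1) = (-1) ^ k * (-Complex.I) * z ^ (2 * k + 1) := by
        rw [mul_pow, pow_succ (-Complex.I), pow_mul]; simp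
      rw [this]
      have h3 : ((-1 : ℂ) ^ k) * (-1) ^ k = 1 := by rw [← mul_pow]; simp
      push_cast
      linear_combination (z ^ (2 * k + 1) / (2 * k + 1)) * (-Complex.I * Complex.I) * h3 -
        (z ^ (2 * k + 1) / (2 * k + 1)) * Complex.I_mul_I
    rw [h1, cexp_pow, Complex.div_ofReal_im, Complex.exp_im]
    simp
    ring
  · rw [closed_im hs x]

lemma B_lt {r t : ℝ} (hr : 0 < r) (hrt : r < t) :
    Real.arctan r - r / (1 + r ^ 2) < Real.arctan t - t / (1 + t ^ 2) := by
  have : StrictMonoOn (fun r : ℝ => Real.arctan r - r / (1 + r ^ 2)) (Set.Ici 0) := by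
    have hd : ∀ r : ℝ, HasDerivAt (fun r : ℝ => Real.arctan r - r / (1 + r ^ 2))
        (1 / (1 + r ^ 2) - (1 * (1 + r ^ 2) - r * (2 * r)) / (1 + r ^ 2) ^ 2) r := by
      intro r
      refine (Real.hasDerivAt_arctan r).sub ?_
      refine (hasDerivAt_id r).div ?_ (by positivity)
      simpa using (hasDerivAt_pow 2 r).const_add 1
    refine strictMonoOn_of_deriv_pos (convex_Ici 0)
      (fun r _ => (hd r).continuousAt.continuousWithinAt) ?_
    intro r hr
    rw [interior_Ici, Set.mem_Ioi] at hr
    rw [(hd r).deriv]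
    have : 1 / (1 + r ^ 2) - (1 * (1 + r ^ 2) - r * (2 * r)) / (1 + r ^ 2) ^ 2 =
      2 * r ^ 2 / (1 + r ^ 2) ^ 2 := by field_simp; ring
    rw [this]; positivity
  exact this (Set.mem_Ici.2 hr.le) (Set.mem_Ici.2 (hr.trans hrt).le) hrt

lemma summable_cc {y : ℝ} (hy : 0 < y) (hy2 : y < π / 2) (d : ℕ → ℝ) (M : ℝ)
    (hd : ∀ k, |d k| ≤ M) : Summable (fun k => d k * cc k y) := by
  refine Summable.of_norm_bounded (((summable_exp_odd hy).mul_left 2).mul_left M) fun k => ?_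
  rw [Real.norm_eq_abs, abs_mul, abs_of_nonneg (cc_nonneg k y)]
  exact mul_le_mul (hd k) (cc_le k hy2) (cc_nonneg k y) ((abs_nonneg _).trans (hd k))

lemma abs_sin_div (k : ℕ) (x : ℝ) : |Real.sin ((2 * k + 1) * x) / (2 * k + 1)| ≤ 1 := by
  have hn : (0 : ℝ) < 2 * k + 1 := by positivity
  rw [abs_div, abs_of_pos hn, div_le_one hn]
  refine (Real.abs_sin_le_one _).trans ?_
  have : (0 : ℝ) ≤ k := by positivity
  linarith

lemma h_eq (x y : ℝ) : h x y =
    (4 / π) * ∑' k : ℕ, (Real.sin ((2 * k + 1) * x) / (2 * k + 1)) * cc k y := by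
  unfold h
  simp only [coeff_eq]

lemma hx_eq {y : ℝ} (x : ℝ) (hy : 0 < y) (hy2 : y < π / 2) : hx x y =
    (4 / π) * ∑' k : ℕ, Real.cos ((2 * k + 1) * x) * cc k y := by
  unfold hx
  simp only [h_eq]
  refine HasDerivAt.deriv ?_
  refine HasDerivAt.const_mul _ ?_
  refine hasDerivAt_tsum (u := fun k : ℕ => 2 * Real.exp (-((2 * k + 1) * y)))
    (g := fun (k : ℕ) x => (Real.sin ((2 * k + 1) * x) / (2 * k + 1)) * cc k y)
    (g' := fun (k : ℕ) x => Real.cos ((2 * k + 1) * x) * cc k y) (y₀ := x)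
    ((summable_exp_odd hy).mul_left 2) ?_ ?_ ?_ x
  · intro k x
    have hn : (2 * (k : ℝ) + 1) ≠ 0 := by positivity
    refine HasDerivAt.mul_const ?_ _
    have := (((hasDerivAt_id x).const_mul (2 * (k : ℝ) + 1)).sin).div_const (2 * (k : ℝ) + 1)
    refine HasDerivAt.congr_deriv (f := fun x => Real.sin ((2 * (k : ℝ) + 1) * x) / (2 * (k : ℝ) + 1)) this ?_
    change Real.cos ((2 * (k : ℝ) + 1) * x) * ((2 * (k : ℝ) + 1) * 1) / (2 * (k : ℝ) + 1) = _
    field_simp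
  · intro k x
    rw [Real.norm_eq_abs, abs_mul, abs_of_nonneg (cc_nonneg k y)]
    exact (mul_le_of_le_one_left (cc_nonneg k y) (Real.abs_cos_le_one _)).trans (cc_le k hy2)
  · exact summable_cc hy hy2 _ 1 fun k => abs_sin_div k x

theorem stmt2 :
    ∀ x y : ℝ, 0 < x → x < π / 2 → 0 < y → y < π / 2 →
      Real.cot x > hx x y / h x y := by
  intro x y hx0 hx1 hy hy2
  have hsin : 0 < Real.sin x := Real.sin_pos_of_pos_of_lt_pi hx0 (by linarith)
  have hcos : 0 < Real.cos x := Real.cos_pos_of_mem_Ioo ⟨by linarith, hx1⟩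
  have hr : ∀ s t : ℝ, 0 < s → s < t → Real.sin x / Real.sinh t < Real.sin x / Real.sinh s := by
    intro s t hs hst
    exact div_lt_div_of_pos_left hsin (Real.sinh_pos_iff.2 hs) (Real.sinh_lt_sinh.2 hst)
  have hpi : 0 < 4 / π := by positivity
  have hhpos : 0 < h x y := by
    rw [h_eq]
    refine mul_pos hpi (pos_lemma _ 1 (fun k => abs_sin_div k x) _
      (fun s hs => hasSum_sin hs x) ?_ hy hy2)
    intro s t hs hst
    have := Real.arctan_strictMono (hr s t hs hst)
    linarith
  have hd : ∀ k : ℕ, |Real.cos x * (Real.sin ((2 * k + 1) * x) / (2 * k + 1)) -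
      Real.sin x * Real.cos ((2 * k + 1) * x)| ≤ 2 := by
    intro k
    refine (abs_sub _ _).trans ?_
    rw [abs_mul, abs_mul]
    have h1 := mul_le_one₀ (Real.abs_cos_le_one x) (abs_nonneg _) (abs_sin_div k x)
    have h2 := mul_le_one₀ (Real.abs_sin_le_one x) (abs_nonneg _)
      (Real.abs_cos_le_one ((2 * k + 1) * x))
    linarith
  have hW := pos_lemma _ 2 hd (fun s => Real.cos x / 2 *
      (Real.arctan (Real.sin x / Real.sinh s) -
        (Real.sin x / Real.sinh s) / (1 + (Real.sin x / Real.sinh s) ^ 2))) ?_ ?_ hy hy2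
  · have key : 0 < Real.cos x * h x y - Real.sin x * hx x y := by
      have hs1 := (summable_cc hy hy2 _ 1 (fun k => abs_sin_div k x)).hasSum.mul_left (Real.cos x)
      have hs2 := (summable_cc hy hy2 (fun k : ℕ => Real.cos ((2 * k + 1) * x)) 1
        (fun k => Real.abs_cos_le_one _)).hasSum.mul_left (Real.sin x)
      have hs3 := (hs1.sub hs2).tsum_eq
      have : ∀ k : ℕ, (Real.cos x * (Real.sin ((2 * k + 1) * x) / (2 * k + 1)) -
          Real.sin x * Real.cos ((2 * k + 1) * x)) * cc k y =
          Real.cos x * (Real.sin ((2 * k + 1) * x) / (2 * k + 1) * cc k y) -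
          Real.sin x * (Real.cos ((2 * k + 1) * x) * cc k y) := fun k => by ring
      simp only [this] at hW
      rw [hs3] at hW
      rw [h_eq, hx_eq x hy hy2]
      have := mul_pos hpi hW
      linarith
    rw [gt_iff_lt, Real.cot_eq_cos_div_sin, div_lt_div_iff₀ hhpos hsin]
    linarith
  · intro s hs
    have hS : 0 < Real.sinh s := Real.sinh_pos_iff.2 hs
    have := ((hasSum_sin hs x).mul_left (Real.cos x)).sub
      ((hasSum_cos hs x).mul_left (Real.sin x))
    refine hasSum_congr_aux this (fun k => by ring) ?_
    have h2 : Real.sin x / Real.sinh s / (1 + (Real.sin x / Real.sinh s) ^ 2) =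
        Real.sin x * Real.sinh s / (Real.sinh s ^ 2 + Real.sin x ^ 2) := by
      field_simp
    rw [h2]
    have h3 : Real.sinh s ^ 2 + Real.sin x ^ 2 ≠ 0 := by positivity
    field_simp
  · intro s t hs hst
    have hT : 0 < Real.sinh t := Real.sinh_pos_iff.2 (hs.trans hst)
    exact mul_lt_mul_of_pos_left (B_lt (by positivity) (hr s t hs hst)) (by positivity)
end

section
/- Let h be the function on (0,π)² given by the series h(x,y) = (4/π)·Σ_{k=0}^∞ (sin((2k+1)x)/(2k+1))·(F_{2k+1}(y) − coth((2k+1)π)·G_{2k+1}(y)). Then for each fixed x with 0 < x < π/2, the function y ↦ h_x(x,y)/h(x,y) is monotone increasing on the interval (0, π/2), where h_x denotes the partial derivative of h in its first variable. -/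
open Real Filter Set Topology

namespace T3
theorem summ_int (δ : ℝ) (hδ : 0 < δ) (p : ℕ) :
    Summable (fun n : ℤ => |(n:ℝ)|^p * Real.exp (-δ * |(n:ℝ)|)) := by
  have hn : Summable (fun n : ℕ => (n:ℝ)^p * Real.exp (-δ * (n:ℝ))) := by
    have := Real.summable_pow_mul_exp_neg_nat_mul p hδ
    simpa using this
  apply Summable.of_nat_of_neg
  · simpa using hn
  · simpa using hn

theorem summ_odd (δ : ℝ) (hδ : 0 < δ) (p : ℕ) :
    Summable (fun k : ℤ => |(2*(k:ℝ)+1)|^p * Real.exp (-δ * |(2*(k:ℝ)+1)|)) := by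
  have := (summ_int δ hδ p).comp_injective (i := fun k : ℤ => 2*k+1) (by intro a b; simp)
  simpa [Function.comp_def] using this

theorem summ_even (δ : ℝ) (hδ : 0 < δ) (p : ℕ) :
    Summable (fun k : ℤ => |(2*(k:ℝ))|^p * Real.exp (-δ * |(2*(k:ℝ))|)) := by
  have := (summ_int δ hδ p).comp_injective (i := fun k : ℤ => 2*k) (by intro a b; simp)
  simpa [Function.comp_def] using this

noncomputable def al (k : ℤ) : ℝ := 1 / Real.cosh ((2*(k:ℝ)+1) * (π/2))
noncomputable def be (k : ℤ) : ℝ := 1 / Real.sinh ((2*(k:ℝ)+1) * (π/2))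
noncomputable def ga (k : ℤ) : ℝ := 1 / Real.cosh ((2*(k:ℝ)) * (π/2))

theorem inv_cosh_le (t : ℝ) : |1 / Real.cosh t| ≤ 4 * Real.exp (-|t|) := by
  have h1 : Real.exp |t| ≤ 2 * Real.cosh t := by
    rw [← Real.cosh_abs t, Real.cosh_eq]
    have := Real.exp_pos (-|t|); linarith
  have h2 := Real.cosh_pos t
  rw [abs_of_pos (by positivity), Real.exp_neg, div_le_iff₀ h2]
  have := Real.exp_pos |t|
  field_simp
  linarith

theorem inv_sinh_le (t : ℝ) (ht : 1 ≤ |t|) : |1 / Real.sinh t| ≤ 4 * Real.exp (-|t|) := by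
  have h0 : |Real.sinh t| = Real.sinh |t| := Real.abs_sinh t
  have h1 : Real.exp |t| ≤ 4 * Real.sinh |t| := by
    rw [Real.sinh_eq]
    have h3 : 2 ≤ Real.exp |t| := by
      have := Real.add_one_le_exp |t|; linarith
    have h4 : Real.exp (-|t|) ≤ 1 := by
      apply Real.exp_le_one_iff.2; linarith
    linarith
  have h5 := Real.exp_pos |t|
  have h2 : 0 < Real.sinh |t| := by linarith
  rw [abs_div, h0, abs_one, Real.exp_neg, div_le_iff₀ h2]
  field_simp
  linarith

theorem odd_abs (k : ℤ) : 1 ≤ |(2*(k:ℝ)+1)| := by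
  have h : (1:ℤ) ≤ |2*k+1| := by
    apply Int.one_le_abs; omega
  exact_mod_cast h

theorem odd_ne (k : ℤ) : (2*(k:ℝ)+1) ≠ 0 := by
  intro h; have := odd_abs k; rw [h] at this; norm_num at this

theorem abs_half (t : ℝ) : |t * (π/2)| = (π/2) * |t| := by
  rw [abs_mul, abs_of_pos (by positivity : (0:ℝ) < π/2)]; ring

theorem al_le (k : ℤ) : |al k| ≤ 4 * Real.exp (-(π/2) * |(2*(k:ℝ)+1)|) := by
  have := inv_cosh_le ((2*(k:ℝ)+1) * (π/2))
  rw [abs_half] at this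
  simpa [al, neg_mul] using this
theorem ga_le (k : ℤ) : |ga k| ≤ 4 * Real.exp (-(π/2) * |(2*(k:ℝ))|) := by
  have := inv_cosh_le ((2*(k:ℝ)) * (π/2))
  rw [abs_half] at this
  simpa [ga, neg_mul] using this
theorem be_le (k : ℤ) : |be k| ≤ 4 * Real.exp (-(π/2) * |(2*(k:ℝ)+1)|) := by
  have := inv_sinh_le ((2*(k:ℝ)+1) * (π/2)) (by
    rw [abs_half]; have := odd_abs k; have := Real.pi_gt_three; nlinarith)
  rw [abs_half] at this
  simpa [be, neg_mul] using this

theorem al_pos (k : ℤ) : 0 < al k := by unfold al; have := Real.cosh_pos ((2*(k:ℝ)+1) * (π/2)); positivity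
theorem ga_pos (k : ℤ) : 0 < ga k := by unfold ga; have := Real.cosh_pos ((2*(k:ℝ)) * (π/2)); positivity
theorem al_neg (k : ℤ) : al (-1-k) = al k := by
  unfold al; push_cast
  rw [show (2*(-1-(k:ℝ))+1) * (π/2) = -((2*(k:ℝ)+1)*(π/2)) by ring, Real.cosh_neg]
theorem be_neg (k : ℤ) : be (-1-k) = - be k := by
  unfold be; push_cast
  rw [show (2*(-1-(k:ℝ))+1) * (π/2) = -((2*(k:ℝ)+1)*(π/2)) by ring, Real.sinh_neg]; ring
theorem ga_neg (k : ℤ) : ga (-k) = ga k := by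
  unfold ga; push_cast
  rw [show (2*(-(k:ℝ))) * (π/2) = -((2*(k:ℝ))*(π/2)) by ring, Real.cosh_neg]

/-- reflection `k ↦ -1-k` -/
def refl1 : ℤ ≃ ℤ := ⟨fun k => -1-k, fun k => -1-k, fun k => by ring, fun k => by ring⟩
theorem tsum_refl (f : ℤ → ℝ) : ∑' k, f (-1-k) = ∑' k, f k := refl1.tsum_eq f
theorem tsum_reflC (f : ℤ → ℂ) : ∑' k, f (-1-k) = ∑' k, f k := refl1.tsum_eq f

/-- generic summability -/
theorem summ_gen_odd (A w : ℤ → ℝ) (v C : ℝ) (p : ℕ) (hv : |v| < π/2)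
    (hA : ∀ k, |A k| ≤ 4 * Real.exp (-(π/2) * |(2*(k:ℝ)+1)|))
    (hw : ∀ k, |w k| ≤ C * |(2*(k:ℝ)+1)|^p * Real.exp (|v| * |(2*(k:ℝ)+1)|)) :
    Summable (fun k => A k * w k) := by
  refine Summable.of_norm_bounded ((summ_odd (π/2-|v|) (by linarith) p).mul_left (4*C)) ?_
  intro k
  rw [Real.norm_eq_abs, abs_mul]
  calc _ ≤ (4 * Real.exp (-(π/2) * |(2*(k:ℝ)+1)|)) * (C * |(2*(k:ℝ)+1)|^p * Real.exp (|v| * |(2*(k:ℝ)+1)|)) := by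
        gcongr
        · exact hA k
        · exact hw k
    _ = _ := by
        rw [show -(π/2-|v|) * |(2*(k:ℝ)+1)| = -(π/2) * |(2*(k:ℝ)+1)| + |v| * |(2*(k:ℝ)+1)| by ring, Real.exp_add]
        ring
theorem summ_gen_even (A w : ℤ → ℝ) (v C : ℝ) (p : ℕ) (hv : |v| < π/2)
    (hA : ∀ k, |A k| ≤ 4 * Real.exp (-(π/2) * |(2*(k:ℝ))|))
    (hw : ∀ k, |w k| ≤ C * |(2*(k:ℝ))|^p * Real.exp (|v| * |(2*(k:ℝ))|)) :
    Summable (fun k => A k * w k) := by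
  refine Summable.of_norm_bounded ((summ_even (π/2-|v|) (by linarith) p).mul_left (4*C)) ?_
  intro k
  rw [Real.norm_eq_abs, abs_mul]
  calc _ ≤ (4 * Real.exp (-(π/2) * |(2*(k:ℝ))|)) * (C * |(2*(k:ℝ))|^p * Real.exp (|v| * |(2*(k:ℝ))|)) := by
        gcongr
        · exact hA k
        · exact hw k
    _ = _ := by
        rw [show -(π/2-|v|) * |(2*(k:ℝ))| = -(π/2) * |(2*(k:ℝ))| + |v| * |(2*(k:ℝ))| by ring, Real.exp_add]
        ring

theorem exp_mul_le (n v : ℝ) : Real.exp (n * v) ≤ Real.exp (|v| * |n|) := by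
  apply Real.exp_le_exp.2
  calc n * v ≤ |n * v| := le_abs_self _
    _ = _ := by rw [abs_mul]; ring
theorem cosh_mul_le (n v : ℝ) : |Real.cosh (n * v)| ≤ Real.exp (|v| * |n|) := by
  rw [abs_of_pos (Real.cosh_pos _), Real.cosh_eq]
  have h1 := exp_mul_le n v
  have h2 := exp_mul_le (-n) v
  rw [abs_neg, neg_mul] at h2
  linarith
theorem sinh_mul_le (n v : ℝ) : |Real.sinh (n * v)| ≤ Real.exp (|v| * |n|) := by
  refine le_trans ?_ (cosh_mul_le n v)
  rw [abs_of_pos (Real.cosh_pos _), abs_le, Real.cosh_eq, Real.sinh_eq]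
  have h1 := Real.exp_pos (n*v)
  have h2 := Real.exp_pos (-(n*v))
  constructor <;> linarith

theorem bdd_of_summable (A : ℤ → ℝ) (hA : Summable A) (k : ℤ) : |A k| ≤ ∑' j, |A j| :=
  hA.abs.le_tsum k (fun _ _ => abs_nonneg _)

theorem prod_summ (A B : ℤ → ℝ) (σ : ℤ → ℤ) (hA : Summable A) (hB : Summable B) :
    Summable (fun j => A (σ j) * B j) := by
  refine Summable.of_norm_bounded (hB.abs.mul_left (∑' j, |A j|)) ?_
  intro j
  rw [Real.norm_eq_abs, abs_mul]
  gcongr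
  exact bdd_of_summable A hA _

/-- coefficients -/
noncomputable def ac (v : ℝ) (k : ℤ) : ℝ := al k * Real.exp ((2*(k:ℝ)+1) * v)
noncomputable def bc (v : ℝ) (k : ℤ) : ℝ := be k * Real.exp ((2*(k:ℝ)+1) * v)
noncomputable def gc (v : ℝ) (k : ℤ) : ℝ := ga k * Real.exp ((2*(k:ℝ)) * v)

theorem ac_summ (v : ℝ) (hv : |v| < π/2) : Summable (ac v) := by
  apply summ_gen_odd al _ v 1 0 hv al_le
  intro k; simpa using exp_mul_le (2*(k:ℝ)+1) v
theorem bc_summ (v : ℝ) (hv : |v| < π/2) : Summable (bc v) := by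
  apply summ_gen_odd be _ v 1 0 hv be_le
  intro k; simpa using exp_mul_le (2*(k:ℝ)+1) v
theorem gc_summ (v : ℝ) (hv : |v| < π/2) : Summable (gc v) := by
  apply summ_gen_even ga _ v 1 0 hv ga_le
  intro k; simpa using exp_mul_le (2*(k:ℝ)) v
theorem bc_summ1 (v : ℝ) (hv : |v| < π/2) : Summable (fun k : ℤ => (2*(k:ℝ)+1) * bc v k) := by
  have := summ_gen_odd be (fun k => (2*(k:ℝ)+1) * Real.exp ((2*(k:ℝ)+1) * v)) v 1 1 hv be_le (by
    intro k
    rw [abs_mul, Real.abs_exp, one_mul, pow_one]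
    exact mul_le_mul_of_nonneg_left (exp_mul_le (2*(k:ℝ)+1) v) (abs_nonneg _))
  refine this.congr (fun k => ?_)
  unfold bc; ring
theorem gc_summ1 (v : ℝ) (hv : |v| < π/2) : Summable (fun k : ℤ => (2*(k:ℝ)) * gc v k) := by
  have := summ_gen_even ga (fun k => (2*(k:ℝ)) * Real.exp ((2*(k:ℝ)) * v)) v 1 1 hv ga_le (by
    intro k
    rw [abs_mul, Real.abs_exp, one_mul, pow_one]
    exact mul_le_mul_of_nonneg_left (exp_mul_le (2*(k:ℝ)) v) (abs_nonneg _))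
  refine this.congr (fun k => ?_)
  unfold gc; ring
theorem pi2pos : |(0:ℝ)| < π/2 := by rw [abs_zero]; positivity
theorem al_summ : Summable al := by
  have := ac_summ 0 pi2pos
  refine this.congr (fun k => ?_); simp [ac]
theorem be_summ : Summable be := by
  have := bc_summ 0 pi2pos
  refine this.congr (fun k => ?_); simp [bc]
theorem ga_summ : Summable ga := by
  have := gc_summ 0 pi2pos
  refine this.congr (fun k => ?_); simp [gc]

noncomputable def tn (z : ℝ) : ℝ := Real.tanh (z * (π/2))
noncomputable def ct (z : ℝ) : ℝ := Real.cosh (z * (π/2)) / Real.sinh (z * (π/2))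

theorem sinh_odd_ne (k : ℤ) : Real.sinh ((2*(k:ℝ)+1) * (π/2)) ≠ 0 := by
  rw [Ne, Real.sinh_eq_zero]
  have := odd_ne k
  positivity

theorem id1 (N j : ℤ) : al (N-j) * ga j * Real.sinh ((2*(N:ℝ)+1)*(π/2)) = tn (2*((N:ℝ)-j)+1) + tn (2*(j:ℝ)) := by
  unfold al ga tn
  push_cast
  rw [show (2*(N:ℝ)+1)*(π/2) = (2*((N:ℝ)-j)+1)*(π/2) + 2*(j:ℝ)*(π/2) by ring, Real.sinh_add,
    Real.tanh_eq_sinh_div_cosh, Real.tanh_eq_sinh_div_cosh]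
  have h1 := (Real.cosh_pos ((2*((N:ℝ)-j)+1)*(π/2))).ne'
  have h2 := (Real.cosh_pos (2*(j:ℝ)*(π/2))).ne'
  field_simp
theorem id2 (N j : ℤ) : al (N-j) * be j * Real.cosh ((2*(N:ℝ)+2)*(π/2)) = tn (2*((N:ℝ)-j)+1) + ct (2*(j:ℝ)+1) := by
  unfold al be tn ct
  push_cast
  rw [show (2*(N:ℝ)+2)*(π/2) = (2*((N:ℝ)-j)+1)*(π/2) + (2*(j:ℝ)+1)*(π/2) by ring, Real.cosh_add,
    Real.tanh_eq_sinh_div_cosh]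
  have h1 := (Real.cosh_pos ((2*((N:ℝ)-j)+1)*(π/2))).ne'
  have h2 := sinh_odd_ne j
  generalize (2*((N:ℝ)-j)+1)*(π/2) = a at *
  generalize (2*(j:ℝ)+1)*(π/2) = b at *
  field_simp
  ring
theorem id3 (N j : ℤ) : be (N-j) * ga j * Real.cosh ((2*(N:ℝ)+1)*(π/2)) = ct (2*((N:ℝ)-j)+1) + tn (2*(j:ℝ)) := by
  unfold be ga tn ct
  have h2 := sinh_odd_ne (N-j)
  push_cast at h2 ⊢
  rw [show (2*(N:ℝ)+1)*(π/2) = (2*((N:ℝ)-j)+1)*(π/2) + 2*(j:ℝ)*(π/2) by ring, Real.cosh_add,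
    Real.tanh_eq_sinh_div_cosh]
  have h1 := (Real.cosh_pos (2*(j:ℝ)*(π/2))).ne'
  generalize (2*((N:ℝ)-j)+1)*(π/2) = a at *
  generalize 2*(j:ℝ)*(π/2) = b at *
  field_simp
  try ring
theorem id4 (j : ℤ) : ga j * ga (j+1) * Real.sinh π = tn (2*(j:ℝ)+2) - tn (2*(j:ℝ)) := by
  unfold ga tn
  push_cast
  rw [show π = (2*((j:ℝ)+1)) * (π/2) - 2*(j:ℝ)*(π/2) by ring, Real.sinh_sub, Real.tanh_eq_sinh_div_cosh, Real.tanh_eq_sinh_div_cosh]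
  rw [← show π = (2*((j:ℝ)+1)) * (π/2) - 2*(j:ℝ)*(π/2) by ring, show (2*((j:ℝ)+1)) = 2*j+2 by ring]
  have h1 := (Real.cosh_pos (2*(j:ℝ)*(π/2))).ne'
  have h2 := (Real.cosh_pos ((2*(j:ℝ)+2)*(π/2))).ne'
  field_simp
theorem id5 (j : ℤ) : al j * al (j+1) * Real.sinh π = tn (2*(j:ℝ)+3) - tn (2*(j:ℝ)+1) := by
  unfold al tn
  push_cast
  rw [show π = (2*(j:ℝ)+3) * (π/2) - (2*(j:ℝ)+1)*(π/2) by ring, Real.sinh_sub, Real.tanh_eq_sinh_div_cosh, Real.tanh_eq_sinh_div_cosh]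
  rw [← show π = (2*(j:ℝ)+3) * (π/2) - (2*(j:ℝ)+1)*(π/2) by ring, show (2*((j:ℝ)+1)+1) = 2*j+3 by ring]
  have h1 := (Real.cosh_pos ((2*(j:ℝ)+1)*(π/2))).ne'
  have h2 := (Real.cosh_pos ((2*(j:ℝ)+3)*(π/2))).ne'
  field_simp

theorem tn_tendsto : Tendsto (fun n : ℕ => tn (2*(n:ℝ)+1)) atTop (𝓝 1) := by
  have h0 : Tendsto (fun n : ℕ => (2*(n:ℝ)+1)*(π/2)) atTop atTop := by
    apply Tendsto.atTop_mul_const (by positivity)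
    apply tendsto_atTop_add_const_right
    exact (tendsto_natCast_atTop_atTop).const_mul_atTop (by norm_num)
  have h2 : Tendsto (fun n : ℕ => 1 - 2 / (Real.exp (2*((2*(n:ℝ)+1)*(π/2))) + 1)) atTop (𝓝 (1 - 0)) := by
    apply Tendsto.const_sub
    apply Tendsto.const_div_atTop
    apply tendsto_atTop_add_const_right
    exact Real.tendsto_exp_atTop.comp (h0.const_mul_atTop (by norm_num))
  rw [sub_zero] at h2
  refine h2.congr (fun n => ?_)
  unfold tn
  generalize (2*(n:ℝ)+1)*(π/2) = t
  rw [Real.tanh_eq_sinh_div_cosh, Real.sinh_eq, Real.cosh_eq, two_mul, Real.exp_add, Real.exp_neg]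
  have := Real.exp_pos t
  field_simp
  ring

noncomputable def Dd (j : ℤ) : ℝ := tn (2*(j:ℝ)+3) - tn (2*(j:ℝ)+1)

theorem D_summ : Summable Dd := by
  have := (prod_summ al al (fun j => j+1) al_summ al_summ).mul_right (Real.sinh π)
  refine this.congr (fun j => ?_)
  unfold Dd
  rw [← id5]; ring

theorem D_hasSum : HasSum Dd 2 := by
  have hs := D_summ
  have h1 : HasSum (fun n : ℕ => Dd (n:ℤ)) (1 - tn 1) := by
    have hs1 : Summable (fun n : ℕ => Dd (n:ℤ)) :=
      hs.comp_injective (i := fun n : ℕ => (n:ℤ)) Nat.cast_injective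
    rw [hs1.hasSum_iff_tendsto_nat]
    have : ∀ n : ℕ, ∑ i ∈ Finset.range n, Dd (i:ℤ) = tn (2*(n:ℝ)+1) - tn 1 := by
      intro n
      have := Finset.sum_range_sub (fun i : ℕ => tn (2*(i:ℝ)+1)) n
      simp only [Nat.cast_zero, mul_zero, zero_add] at this
      rw [← this]
      apply Finset.sum_congr rfl
      intro i _
      unfold Dd
      push_cast
      ring_nf
    simp_rw [this]
    exact tn_tendsto.sub_const _
  have h2 : HasSum (fun n : ℕ => Dd (-((n:ℤ)+1))) (1 + tn 1) := by
    have hs1 : Summable (fun n : ℕ => Dd (-((n:ℤ)+1))) :=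
      hs.comp_injective (i := fun n : ℕ => (-((n:ℤ)+1))) (by intro a b; simp)
    rw [hs1.hasSum_iff_tendsto_nat]
    have o : ∀ z, tn (-z) = - tn z := by
      intro z; unfold tn; rw [← Real.tanh_neg]; congr 1; ring
    have : ∀ n : ℕ, ∑ i ∈ Finset.range n, Dd (-((i:ℤ)+1)) = tn (2*(n:ℝ)-1) + tn 1 := by
      intro n
      have := Finset.sum_range_sub (fun i : ℕ => tn (2*(i:ℝ)-1)) n
      have e : tn (2*((0:ℕ):ℝ)-1) = - tn 1 := by
        rw [← o]; congr 1; push_cast; ring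
      rw [e, sub_neg_eq_add] at this
      rw [← this]
      apply Finset.sum_congr rfl
      intro i _
      unfold Dd
      push_cast
      rw [show 2 * (-((i:ℝ)+1)) + 3 = -(2*(i:ℝ)-1) by ring, show 2 * (-((i:ℝ)+1)) + 1 = -(2*(i:ℝ)+1) by ring, o, o,
        show 2 * ((i:ℝ)+1) - 1 = 2*(i:ℝ)+1 by ring]
      ring
    simp_rw [this]
    apply Tendsto.add_const
    rw [← tendsto_add_atTop_iff_nat 1]
    refine tn_tendsto.congr (fun n => ?_)
    push_cast
    congr 1
    ring
  have := HasSum.of_nat_of_neg_add_one h1 h2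
  rwa [show (1 - tn 1) + (1 + tn 1) = 2 by ring] at this

theorem conv1 (N : ℤ) : ∑' j, al (N-j) * ga j = (2*(N:ℝ)+1) * be N := by
  have hs : ∀ N : ℤ, Summable (fun j => al (N-j) * ga j * Real.sinh ((2*(N:ℝ)+1)*(π/2))) :=
    fun N => (prod_summ al ga (fun j => N-j) al_summ ga_summ).mul_right _
  set R : ℤ → ℝ := fun N => ∑' j, al (N-j) * ga j * Real.sinh ((2*(N:ℝ)+1)*(π/2)) with hR
  have hstep : ∀ N, R (N+1) = R N + 2 := by
    intro N
    have hD := (Equiv.subLeft N).hasSum_iff.2 D_hasSum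
    have := (hs N).hasSum.add hD
    refine this.tsum_eq ▸ ?_
    simp only [hR]
    apply tsum_congr
    intro j
    simp only [Function.comp, Equiv.subLeft_apply, Dd]
    rw [id1, id1]; push_cast; ring_nf
  have hodd : R (-1) = - R 0 := by
    simp only [hR]
    rw [← (Equiv.neg ℤ).tsum_eq, ← tsum_neg]
    apply tsum_congr
    intro j
    simp only [Equiv.neg_apply]
    rw [ga_neg, show (-1 : ℤ) - -j = -1 - (0 - j) by ring, al_neg]
    push_cast
    rw [show (2*(-1:ℝ)+1)*(π/2) = -((2*0+1)*(π/2)) by ring, Real.sinh_neg]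
    ring
  have h0 : R 0 = 1 := by have := hstep (-1); norm_num at this; linarith
  have hall : ∀ N : ℤ, R N = 2*(N:ℝ)+1 := by
    intro N
    induction N using Int.induction_on with
    | zero => simp [h0]
    | succ n ih => rw [hstep, ih]; push_cast; ring
    | pred n ih =>
      have := hstep (-(n:ℤ)-1)
      rw [sub_add_cancel, ih] at this
      push_cast at this ⊢; linarith
  have h1 := hall N
  simp only [hR] at h1
  rw [tsum_mul_right] at h1
  unfold be
  rw [mul_one_div, eq_div_iff (sinh_odd_ne N)]
  exact h1

theorem conv2 (N : ℤ) : ∑' j, al (N-j) * be j = (2*(N:ℝ)+2) * ga (N+1) := by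
  have hs : ∀ N : ℤ, Summable (fun j => al (N-j) * be j * Real.cosh ((2*(N:ℝ)+2)*(π/2))) :=
    fun N => (prod_summ al be (fun j => N-j) al_summ be_summ).mul_right _
  set R : ℤ → ℝ := fun N => ∑' j, al (N-j) * be j * Real.cosh ((2*(N:ℝ)+2)*(π/2)) with hR
  have hstep : ∀ N, R (N+1) = R N + 2 := by
    intro N
    have hD := (Equiv.subLeft N).hasSum_iff.2 D_hasSum
    have := (hs N).hasSum.add hD
    refine this.tsum_eq ▸ ?_
    simp only [hR]
    apply tsum_congr
    intro j
    simp only [Function.comp, Equiv.subLeft_apply, Dd]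
    rw [id2, id2]; push_cast; ring_nf
  have hodd : R (-1) = - R (-1) := by
    simp only [hR]
    conv_lhs => rw [← tsum_refl]
    rw [← tsum_neg]
    apply tsum_congr
    intro j
    rw [be_neg, show al (-1 - (-1-j)) = al (-1 - j) by rw [al_neg]]
    ring
  have h0 : R (-1) = 0 := by linarith
  have hall : ∀ N : ℤ, R N = 2*(N:ℝ)+2 := by
    intro N
    have h00 : R 0 = 2 := by have := hstep (-1); norm_num at this; linarith
    induction N using Int.induction_on with
    | zero => simp [h00]
    | succ n ih => rw [hstep, ih]; push_cast; ring
    | pred n ih =>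
      have := hstep (-(n:ℤ)-1)
      rw [sub_add_cancel, ih] at this
      push_cast at this ⊢; linarith
  have h1 := hall N
  simp only [hR] at h1
  rw [tsum_mul_right] at h1
  have := (Real.cosh_pos ((2*(N:ℝ)+2)*(π/2))).ne'
  unfold ga
  rw [← h1]
  push_cast
  rw [show (2*((N:ℝ)+1)) = 2*N+2 by ring]
  field_simp

theorem cosh3_summ (v : ℝ) (hv : |v| < π/2) (N : ℤ) :
    Summable (fun j : ℤ => be (N-j) * ga j * Real.cosh ((4*(j:ℝ)-2*N-1)*v)) := by
  have hv' : |(-v)| < π/2 := by rwa [abs_neg]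
  have h1 := prod_summ _ _ (fun j => N-j) (bc_summ (-v) hv') (gc_summ v hv)
  have h2 := prod_summ _ _ (fun j => N-j) (bc_summ v hv) (gc_summ (-v) hv')
  refine ((h1.add h2).div_const 2).congr (fun j => ?_)
  unfold bc gc
  rw [Real.cosh_eq]
  push_cast
  rw [show (4*(j:ℝ)-2*N-1)*v = (2*((N:ℝ)-j)+1)*(-v) + 2*j*v by ring,
    show -((2*((N:ℝ)-j)+1)*(-v) + 2*j*v) = (2*((N:ℝ)-j)+1)*v + 2*j*(-v) by ring, Real.exp_add, Real.exp_add]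
  ring

theorem X_summ (v : ℝ) (hv : |v| < π/2) (N : ℤ) :
    Summable (fun j : ℤ => ga j * ga (j+1) * Real.cosh ((4*(j:ℝ)-2*N+1)*v)) := by
  have hv' : |(-v)| < π/2 := by rwa [abs_neg]
  have h1 := (prod_summ _ _ (fun j => j+1) (gc_summ (-v) hv') (gc_summ (-v) hv')).mul_right (Real.exp ((2*N+1)*v))
  have h2 := (prod_summ _ _ (fun j => j+1) (gc_summ v hv) (gc_summ v hv)).mul_right (Real.exp (-((2*N+1)*v)))
  refine ((h1.add h2).div_const 2).congr (fun j => ?_)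
  unfold gc
  rw [Real.cosh_eq]
  push_cast
  rw [show (4*(j:ℝ)-2*N+1)*v = 2*(j+1)*v + 2*j*v + (-((2*N+1)*v)) by ring,
    show -(2*((j:ℝ)+1)*v + 2*j*v + (-((2*N+1)*v))) = 2*(j+1)*(-v) + 2*j*(-v) + (2*N+1)*v by ring, Real.exp_add, Real.exp_add, Real.exp_add, Real.exp_add]
  ring

theorem conv3 (v : ℝ) (hv : |v| < π/2) : ∃ κ : ℝ, ∀ N : ℤ,
    (∑' j : ℤ, be (N-j) * ga j * Real.cosh ((4*(j:ℝ)-2*N-1)*v)) * Real.sinh v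
      = κ * Real.sinh ((2*(N:ℝ)+1)*v) * al N := by
  set T : ℤ → ℝ := fun N => ∑' j : ℤ, be (N-j) * ga j * Real.cosh ((4*(j:ℝ)-2*N-1)*v) * Real.cosh ((2*(N:ℝ)+1)*(π/2)) with hT
  have hs : ∀ N : ℤ, Summable (fun j : ℤ => be (N-j) * ga j * Real.cosh ((4*(j:ℝ)-2*N-1)*v) * Real.cosh ((2*(N:ℝ)+1)*(π/2))) :=
    fun N => (cosh3_summ v hv N).mul_right _
  have hrec : ∀ N, T (N+1) + T (N-1) = 2 * Real.cosh (2*v) * T N := by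
    intro N
    have e1 := (Equiv.addRight (1:ℤ)).hasSum_iff.2 (hs (N+1)).hasSum
    have e2 := (Equiv.subRight (1:ℤ)).hasSum_iff.2 (hs (N-1)).hasSum
    have e3 := (hs N).hasSum.mul_left (2 * Real.cosh (2*v))
    have x1 := ((X_summ v hv N).mul_right (Real.sinh π)).hasSum
    have x2 := (Equiv.subRight (1:ℤ)).hasSum_iff.2 x1
    have l := (e1.add e2).sub e3
    have r := x1.sub x2
    rw [sub_self] at r
    have := l.unique (r.congr_fun ?_)
    · simp only [hT]; linarith
    · intro j
      simp only [Function.comp, Equiv.subRight_apply, Equiv.coe_addRight]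
      have i1 := id3 (N+1) (j+1)
      have i2 := id3 (N-1) (j-1)
      have i3 := id3 N j
      have i4 := id4 j
      have i5 := id4 (j-1)
      push_cast at i1 i2 i3 i4 i5 ⊢
      rw [mul_right_comm, mul_right_comm (be (N - 1 - (j - 1)) * _), mul_right_comm (be (N - j) * _), mul_right_comm (ga j * _), mul_right_comm (ga (j-1) * _),
        i1, i2, i3, i4, i5]
      have c := Real.cosh_add ((4*(j:ℝ)-2*N-1)*v) (2*v)
      have c' := Real.cosh_sub ((4*(j:ℝ)-2*N-1)*v) (2*v)
      rw [show ((4*((j:ℝ)+1)-2*(N+1)-1)*v) = (4*(j:ℝ)-2*N-1)*v + 2*v by ring,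
        show ((4*((j:ℝ)-1)-2*(N-1)-1)*v) = (4*(j:ℝ)-2*N-1)*v - 2*v by ring,
        show ((4*((j:ℝ))-2*N+1)*v) = (4*(j:ℝ)-2*N-1)*v + 2*v by ring,
        show ((4*((j:ℝ)-1)-2*N+1)*v) = (4*(j:ℝ)-2*N-1)*v - 2*v by ring,
        show 2*((N:ℝ)+1-(j+1))+1 = 2*(N-j)+1 by ring,
        show 2*((N:ℝ)-1-(j-1))+1 = 2*(N-j)+1 by ring,
        show 2*((j:ℝ)-1)+2 = 2*j by ring,
        show 2*((j:ℝ)+1) = 2*j+2 by ring, c, c']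
      ring
  have hodd : T (-1) = - T 0 := by
    simp only [hT]
    rw [← (Equiv.neg ℤ).tsum_eq, ← tsum_neg]
    apply tsum_congr
    intro j
    simp only [Equiv.neg_apply]
    rw [ga_neg, show (-1 : ℤ) - -j = -1 - (0 - j) by ring, be_neg]
    push_cast
    rw [show (2*(-1:ℝ)+1)*(π/2) = -((2*0+1)*(π/2)) by ring, Real.cosh_neg,
      show ((4*(-(j:ℝ))-2*(-1)-1)*v) = -((4*j-2*0-1)*v) by ring, Real.cosh_neg]
    ring
  have key : ∀ N : ℤ, T N * Real.sinh v = T 0 * Real.sinh ((2*(N:ℝ)+1)*v) ∧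
      T (N-1) * Real.sinh v = T 0 * Real.sinh ((2*(N:ℝ)-1)*v) := by
    intro N
    have rec2 : ∀ N : ℝ, Real.sinh ((2*N+3)*v) + Real.sinh ((2*N-1)*v) = 2 * Real.cosh (2*v) * Real.sinh ((2*N+1)*v) := by
      intro N
      rw [show (2*N+3)*v = (2*N+1)*v + 2*v by ring, show (2*N-1)*v = (2*N+1)*v - 2*v by ring, Real.sinh_add, Real.sinh_sub]
      ring
    induction N using Int.induction_on with
    | zero =>
      constructor
      · simp
      · rw [zero_sub, hodd]
        push_cast
        rw [show (2*(0:ℝ)-1)*v = -v by ring, Real.sinh_neg]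
        ring
    | succ n ih =>
      obtain ⟨ih1, ih2⟩ := ih
      have a := hrec (n:ℤ)
      have b := rec2 (n:ℝ)
      push_cast at ih1 ih2 ⊢
      constructor
      · rw [show 2*((n:ℝ)+1)+1 = 2*n+3 by ring]
        linear_combination (Real.sinh v) * a - (T 0) * b + 2 * Real.cosh (2*v) * ih1 - ih2
      · rw [add_sub_cancel_right, show 2*((n:ℝ)+1)-1 = 2*n+1 by ring]
        exact ih1
    | pred n ih =>
      obtain ⟨ih1, ih2⟩ := ih
      have a := hrec (-(n:ℤ)-1)
      rw [sub_add_cancel] at a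
      have b := rec2 (-(n:ℝ)-1)
      rw [show 2*(-(n:ℝ)-1)+3 = 2*(-n)+1 by ring] at b
      push_cast at ih1 ih2 ⊢
      have ih2' : T (-(n:ℤ)-1) * Real.sinh v = T 0 * Real.sinh ((2*(-(n:ℝ)-1)+1)*v) := by
        rw [ih2]; ring_nf
      refine ⟨ih2', ?_⟩
      linear_combination (Real.sinh v) * a - (T 0) * b + 2 * Real.cosh (2*v) * ih2' - ih1
  refine ⟨T 0, fun N => ?_⟩
  rw [← (key N).1]
  simp only [hT]
  rw [tsum_mul_right]
  unfold al
  have := (Real.cosh_pos ((2*(N:ℝ)+1)*(π/2))).ne'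
  generalize (∑' j : ℤ, be (N-j) * ga j * Real.cosh ((4*(j:ℝ)-2*N-1)*v)) = S
  field_simp

noncomputable def od (k : ℤ) : ℝ := 2*(k:ℝ)+1
noncomputable def ev (k : ℤ) : ℝ := 2*(k:ℝ)
noncomputable def FS (A ν : ℤ → ℝ) (x : ℝ) : ℂ := ∑' k, (A k : ℂ) * Complex.exp (((ν k * x : ℝ) : ℂ) * Complex.I)

theorem FS_norm (A ν : ℤ → ℝ) (x : ℝ) (k : ℤ) : ‖(A k : ℂ) * Complex.exp (((ν k * x : ℝ) : ℂ) * Complex.I)‖ = |A k| := by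
  rw [norm_mul, Complex.norm_exp_ofReal_mul_I, mul_one, Complex.norm_real, Real.norm_eq_abs]

theorem FS_summ_norm (A ν : ℤ → ℝ) (x : ℝ) (hA : Summable A) :
    Summable (fun k => ‖(A k : ℂ) * Complex.exp (((ν k * x : ℝ) : ℂ) * Complex.I)‖) := by
  simp_rw [FS_norm]; exact hA.abs

theorem FS_summ (A ν : ℤ → ℝ) (x : ℝ) (hA : Summable A) :
    Summable (fun k => (A k : ℂ) * Complex.exp (((ν k * x : ℝ) : ℂ) * Complex.I)) :=
  (FS_summ_norm A ν x hA).of_norm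

theorem FS_add (A B ν : ℤ → ℝ) (x : ℝ) (hA : Summable A) (hB : Summable B) :
    FS A ν x + FS B ν x = FS (fun k => A k + B k) ν x := by
  unfold FS
  rw [← (FS_summ A ν x hA).tsum_add (FS_summ B ν x hB)]
  apply tsum_congr; intro k; push_cast; ring

theorem FS_smul (A ν : ℤ → ℝ) (x c : ℝ) : (c:ℂ) * FS A ν x = FS (fun k => c * A k) ν x := by
  unfold FS
  rw [← tsum_mul_left]
  apply tsum_congr; intro k; push_cast; ring

theorem FS_deriv (A ν : ℤ → ℝ) (x : ℝ) (hA : Summable A) (hA1 : Summable (fun k => ν k * A k)) :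
    HasDerivAt (FS A ν) (Complex.I * FS (fun k => ν k * A k) ν x) x := by
  have := hasDerivAt_tsum (𝕜 := ℝ) (F := ℂ) (g := fun (k : ℤ) (x : ℝ) => (A k : ℂ) * Complex.exp (((ν k * x : ℝ) : ℂ) * Complex.I))
    (g' := fun k x => Complex.I * (((ν k * A k : ℝ) : ℂ) * Complex.exp (((ν k * x : ℝ) : ℂ) * Complex.I)))
    (u := fun k => |ν k * A k|) hA1.abs ?_ ?_ (y₀ := 0) (FS_summ A ν 0 hA) x
  · rw [tsum_mul_left] at this
    exact this
  · intro k y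
    have h1 : HasDerivAt (fun y : ℝ => ((ν k * y : ℝ) : ℂ)) ((ν k * 1 : ℝ) : ℂ) y :=
      ((hasDerivAt_id y).const_mul (ν k)).ofReal_comp
    have h2 := ((h1.mul_const Complex.I).cexp).const_mul (A k : ℂ)
    refine h2.congr_deriv ?_
    push_cast; ring
  · intro k y
    rw [norm_mul, Complex.norm_I, one_mul, FS_norm (fun k => ν k * A k) ν y k]

theorem FS_mul (A B ν μ ξ C : ℤ → ℝ) (x : ℝ) (hA : Summable A) (hB : Summable B)
    (hξ : ∀ N j, ν (N-j) + μ j = ξ N) (hC : ∀ N, ∑' j, A (N-j) * B j = C N) :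
    FS A ν x * FS B μ x = FS C ξ x := by
  unfold FS
  have hsA := FS_summ_norm A ν x hA
  have hsB := FS_summ_norm B μ x hB
  rw [tsum_mul_tsum_of_summable_norm hsA hsB]
  have hs := summable_mul_of_summable_norm hsA hsB
  let e : ℤ × ℤ ≃ ℤ × ℤ := ⟨fun p => (p.1 - p.2, p.2), fun p => (p.1 + p.2, p.2),
    fun p => by simp, fun p => by simp⟩
  rw [← e.tsum_eq]
  have hs' := e.summable_iff.2 hs
  refine hs'.tsum_prod.trans ?_
  apply tsum_congr
  intro N
  rw [← hC N, Complex.ofReal_tsum, ← tsum_mul_right]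
  apply tsum_congr
  intro j
  simp only [e, Function.comp, Equiv.coe_fn_mk]
  rw [← hξ N j, add_mul]
  push_cast
  rw [add_mul, Complex.exp_add]
  ring

theorem FS_even (A : ℤ → ℝ) (x : ℝ) (hA : Summable A) (he : ∀ k, A (-1-k) = A k) :
    FS A od x = ((∑' k : ℤ, A k * Real.cos ((2*(k:ℝ)+1)*x) : ℝ) : ℂ) := by
  have h1 : FS A od x = ∑' k : ℤ, (A k : ℂ) * Complex.exp (((-(od k * x) : ℝ) : ℂ) * Complex.I) := by
    unfold FS
    rw [← tsum_reflC]
    apply tsum_congr; intro k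
    rw [he]; unfold od; push_cast; ring_nf
  have hs2 : Summable (fun k : ℤ => (A k : ℂ) * Complex.exp (((-(od k * x) : ℝ) : ℂ) * Complex.I)) := by
    have := FS_summ A (fun k => -od k) x hA
    simpa only [neg_mul] using this
  have h2 : 2 * FS A od x = 2 * ((∑' k : ℤ, A k * Real.cos ((2*(k:ℝ)+1)*x) : ℝ) : ℂ) := by
    rw [two_mul]
    nth_rewrite 2 [h1]
    unfold FS
    rw [← (FS_summ A od x hA).tsum_add hs2, Complex.ofReal_tsum, ← tsum_mul_left]
    apply tsum_congr; intro k
    unfold od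
    push_cast
    rw [Complex.cos]
    ring_nf
  exact mul_left_cancel₀ two_ne_zero h2

theorem FS_odd (A : ℤ → ℝ) (x : ℝ) (hA : Summable A) (he : ∀ k, A (-1-k) = - A k) :
    FS A od x = Complex.I * ((∑' k : ℤ, A k * Real.sin ((2*(k:ℝ)+1)*x) : ℝ) : ℂ) := by
  have h1 : FS A od x = ∑' k : ℤ, -((A k : ℂ) * Complex.exp (((-(od k * x) : ℝ) : ℂ) * Complex.I)) := by
    unfold FS
    rw [← tsum_reflC]
    apply tsum_congr; intro k
    rw [he]; unfold od; push_cast; ring_nf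
  have hs2 : Summable (fun k : ℤ => -((A k : ℂ) * Complex.exp (((-(od k * x) : ℝ) : ℂ) * Complex.I))) := by
    have := (FS_summ A (fun k => -od k) x hA).neg
    simpa only [neg_mul] using this
  have h2 : 2 * FS A od x = 2 * (Complex.I * ((∑' k : ℤ, A k * Real.sin ((2*(k:ℝ)+1)*x) : ℝ) : ℂ)) := by
    rw [two_mul]
    nth_rewrite 2 [h1]
    unfold FS
    rw [← (FS_summ A od x hA).tsum_add hs2, Complex.ofReal_tsum, ← tsum_mul_left, ← tsum_mul_left]
    apply tsum_congr; intro k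
    unfold od
    push_cast
    rw [Complex.sin]
    linear_combination (A k : ℂ) * (Complex.exp (-((2*(k:ℂ)+1)*x) * Complex.I) - Complex.exp (((2*(k:ℂ)+1)*x) * Complex.I)) * (-Complex.I_sq)
  exact mul_left_cancel₀ two_ne_zero h2

/-- real series, `x` direction -/
theorem dx_sin (B : ℤ → ℝ) (x : ℝ) (h1 : Summable (fun k : ℤ => B k * (2*(k:ℝ)+1))) :
    HasDerivAt (fun x => ∑' k : ℤ, B k * Real.sin ((2*(k:ℝ)+1)*x)) (∑' k : ℤ, B k * (2*(k:ℝ)+1) * Real.cos ((2*(k:ℝ)+1)*x)) x := by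
  refine hasDerivAt_tsum (g := fun (k : ℤ) x => B k * Real.sin ((2*(k:ℝ)+1)*x)) (g' := fun (k : ℤ) x => B k * (2*(k:ℝ)+1) * Real.cos ((2*(k:ℝ)+1)*x)) (u := fun k => |B k * (2*(k:ℝ)+1)|) h1.abs ?_ ?_ (y₀ := 0) (by simp) x
  · intro k y
    have := (((hasDerivAt_id y).const_mul (2*(k:ℝ)+1)).sin).const_mul (B k)
    refine this.congr_deriv ?_
    simp only [id]; ring
  · intro k y
    rw [Real.norm_eq_abs, abs_mul]
    exact mul_le_of_le_one_right (abs_nonneg _) (Real.abs_cos_le_one _)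

theorem dv_gen (A : ℤ → ℝ) (C : ℝ) (p : ℕ) (v : ℝ) (hv : |v| < π/2)
    (hA : ∀ k : ℤ, |A k| ≤ C * |(2*(k:ℝ)+1)|^p * (4 * Real.exp (-(π/2) * |(2*(k:ℝ)+1)|))) :
    HasDerivAt (fun v => ∑' k : ℤ, A k * Real.cosh ((2*(k:ℝ)+1)*v)) (∑' k : ℤ, A k * (2*(k:ℝ)+1) * Real.sinh ((2*(k:ℝ)+1)*v)) v
    ∧ HasDerivAt (fun v => ∑' k : ℤ, A k * Real.sinh ((2*(k:ℝ)+1)*v)) (∑' k : ℤ, A k * (2*(k:ℝ)+1) * Real.cosh ((2*(k:ℝ)+1)*v)) v := by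
  obtain ⟨r, hr1, hr2⟩ := exists_between hv
  have hr0 : 0 < r := lt_of_le_of_lt (abs_nonneg _) hr1
  have hsum : Summable (fun k : ℤ => 4*C*(|(2*(k:ℝ)+1)|^(p+1) * Real.exp (-(π/2-r) * |(2*(k:ℝ)+1)|))) :=
    (summ_odd (π/2-r) (by linarith) (p+1)).mul_left _
  have hbound : ∀ (k : ℤ) (w H : ℝ), w ∈ Ioo (-r) r → |H| ≤ Real.exp (|w| * |(2*(k:ℝ)+1)|) →
      ‖A k * (2*(k:ℝ)+1) * H‖ ≤ 4*C*(|(2*(k:ℝ)+1)|^(p+1) * Real.exp (-(π/2-r) * |(2*(k:ℝ)+1)|)) := by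
    intro k w H hw hH
    have hw' : |w| ≤ r := abs_le.2 ⟨hw.1.le, hw.2.le⟩
    have hH' : |H| ≤ Real.exp (r * |(2*(k:ℝ)+1)|) := by
      refine hH.trans (Real.exp_le_exp.2 ?_); gcongr
    rw [Real.norm_eq_abs, abs_mul, abs_mul]
    calc _ ≤ (C * |(2*(k:ℝ)+1)|^p * (4 * Real.exp (-(π/2) * |(2*(k:ℝ)+1)|))) * |(2*(k:ℝ)+1)| * Real.exp (r * |(2*(k:ℝ)+1)|) := by
          have h1 := hA k
          have h2 : 0 ≤ C * |(2*(k:ℝ)+1)|^p * (4 * Real.exp (-(π/2) * |(2*(k:ℝ)+1)|)) := (abs_nonneg _).trans h1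
          gcongr
      _ = _ := by
          rw [show -(π/2-r) * |(2*(k:ℝ)+1)| = -(π/2) * |(2*(k:ℝ)+1)| + r * |(2*(k:ℝ)+1)| by ring, Real.exp_add, pow_succ]
          ring
  have hmem : v ∈ Ioo (-r) r := abs_lt.1 hr1
  have h0mem : (0:ℝ) ∈ Ioo (-r) r := ⟨by linarith, hr0⟩
  have hs0 : Summable A := by
    have hC := (summ_odd (π/2) (by positivity) p).mul_left (4*C)
    refine Summable.of_norm_bounded hC (fun k => ?_)
    rw [Real.norm_eq_abs]
    refine (hA k).trans (le_of_eq (by ring))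
  constructor
  · refine hasDerivAt_tsum_of_isPreconnected (g := fun (k : ℤ) v => A k * Real.cosh ((2*(k:ℝ)+1)*v))
      (g' := fun (k : ℤ) v => A k * (2*(k:ℝ)+1) * Real.sinh ((2*(k:ℝ)+1)*v)) hsum isOpen_Ioo isPreconnected_Ioo ?_ ?_ h0mem (by simpa using hs0) hmem
    · intro k y _
      have := (((hasDerivAt_id y).const_mul (2*(k:ℝ)+1)).cosh).const_mul (A k)
      refine this.congr_deriv ?_
      simp only [id]; ring
    · intro k y hy
      exact hbound k y _ hy (sinh_mul_le _ _)
  · refine hasDerivAt_tsum_of_isPreconnected (g := fun (k : ℤ) v => A k * Real.sinh ((2*(k:ℝ)+1)*v))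
      (g' := fun (k : ℤ) v => A k * (2*(k:ℝ)+1) * Real.cosh ((2*(k:ℝ)+1)*v)) hsum isOpen_Ioo isPreconnected_Ioo ?_ ?_ h0mem (by simp) hmem
    · intro k y _
      have := (((hasDerivAt_id y).const_mul (2*(k:ℝ)+1)).sinh).const_mul (A k)
      refine this.congr_deriv ?_
      simp only [id]; ring
    · intro k y hy
      exact hbound k y _ hy (cosh_mul_le _ _)

noncomputable def th (x v : ℝ) : ℝ := ∑' k : ℤ, al k / (2*(k:ℝ)+1) * Real.sin ((2*(k:ℝ)+1)*x) * Real.cosh ((2*(k:ℝ)+1)*v)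
noncomputable def thx (x v : ℝ) : ℝ := ∑' k : ℤ, al k * Real.cos ((2*(k:ℝ)+1)*x) * Real.cosh ((2*(k:ℝ)+1)*v)
noncomputable def thv (x v : ℝ) : ℝ := ∑' k : ℤ, al k * Real.sin ((2*(k:ℝ)+1)*x) * Real.sinh ((2*(k:ℝ)+1)*v)
noncomputable def thxv (x v : ℝ) : ℝ := ∑' k : ℤ, al k * (2*(k:ℝ)+1) * Real.cos ((2*(k:ℝ)+1)*x) * Real.sinh ((2*(k:ℝ)+1)*v)

theorem al_cosh_summ (v : ℝ) (hv : |v| < π/2) : Summable (fun k : ℤ => al k * Real.cosh ((2*(k:ℝ)+1)*v)) := by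
  apply summ_gen_odd al _ v 1 0 hv al_le
  intro k; simpa using cosh_mul_le (2*(k:ℝ)+1) v
theorem al_sinh_summ (v : ℝ) (hv : |v| < π/2) : Summable (fun k : ℤ => al k * Real.sinh ((2*(k:ℝ)+1)*v)) := by
  apply summ_gen_odd al _ v 1 0 hv al_le
  intro k; simpa using sinh_mul_le (2*(k:ℝ)+1) v
theorem al_sinh_summ1 (v : ℝ) (hv : |v| < π/2) : Summable (fun k : ℤ => al k * Real.sinh ((2*(k:ℝ)+1)*v) * (2*(k:ℝ)+1)) := by
  have := summ_gen_odd al (fun k : ℤ => Real.sinh ((2*(k:ℝ)+1)*v) * (2*(k:ℝ)+1)) v 1 1 hv al_le (by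
    intro k
    rw [abs_mul, one_mul, pow_one, mul_comm]
    exact mul_le_mul_of_nonneg_left (sinh_mul_le (2*(k:ℝ)+1) v) (abs_nonneg _))
  refine this.congr (fun k => ?_)
  ring

theorem th_dx (x v : ℝ) (hv : |v| < π/2) : HasDerivAt (fun x => th x v) (thx x v) x := by
  have hs : Summable (fun k : ℤ => al k / (2*(k:ℝ)+1) * Real.cosh ((2*(k:ℝ)+1)*v) * (2*(k:ℝ)+1)) := by
    refine (al_cosh_summ v hv).congr (fun k => ?_)
    have := odd_ne k; field_simp
  have := dx_sin _ x hs
  unfold th thx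
  convert this using 1
  · funext x; apply tsum_congr; intro k; ring
  · apply tsum_congr; intro k; have := odd_ne k; field_simp

theorem thv_dx (x v : ℝ) (hv : |v| < π/2) : HasDerivAt (fun x => thv x v) (thxv x v) x := by
  have := dx_sin _ x (al_sinh_summ1 v hv)
  unfold thv thxv
  convert this using 1
  · funext x; apply tsum_congr; intro k; ring
  · apply tsum_congr; intro k; ring

theorem th_dv (x v : ℝ) (hv : |v| < π/2) : HasDerivAt (fun v => th x v) (thv x v) v := by
  have := (dv_gen (fun k : ℤ => al k / (2*(k:ℝ)+1) * Real.sin ((2*(k:ℝ)+1)*x)) 1 0 v hv ?_).1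
  · unfold th thv
    convert this using 1
    apply tsum_congr; intro k; have := odd_ne k; field_simp
  · intro k
    rw [abs_mul, abs_div, one_mul, pow_zero, one_mul]
    refine le_trans ?_ (al_le k)
    refine (mul_le_of_le_one_right (by positivity) (Real.abs_sin_le_one _)).trans ?_
    exact div_le_self (abs_nonneg _) (odd_abs k)

theorem thx_dv (x v : ℝ) (hv : |v| < π/2) : HasDerivAt (fun v => thx x v) (thxv x v) v := by
  have := (dv_gen (fun k : ℤ => al k * Real.cos ((2*(k:ℝ)+1)*x)) 1 0 v hv ?_).1
  · unfold thx thxv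
    convert this using 1
    apply tsum_congr; intro k; ring
  · intro k
    rw [abs_mul, one_mul, pow_zero, one_mul]
    refine le_trans ?_ (al_le k)
    exact (mul_le_of_le_one_right (by positivity) (Real.abs_cos_le_one _))

theorem thxv_cont (x v : ℝ) (hv : |v| < π/2) : ContinuousAt (fun v => thxv x v) v := by
  have := (dv_gen (fun k : ℤ => al k * (2*(k:ℝ)+1) * Real.cos ((2*(k:ℝ)+1)*x)) 1 1 v hv ?_).2
  · unfold thxv
    exact this.continuousAt
  · intro k
    rw [abs_mul, abs_mul, one_mul, pow_one]
    refine (mul_le_of_le_one_right (by positivity) (Real.abs_cos_le_one _)).trans ?_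
    rw [mul_comm]
    exact mul_le_mul_of_nonneg_left (al_le k) (abs_nonneg _)

noncomputable def cc (v : ℝ) : ℝ → ℂ := FS (ac v) od
noncomputable def ss (v : ℝ) : ℝ → ℂ := FS (bc v) od
noncomputable def dd (v : ℝ) : ℝ → ℂ := FS (gc v) ev

theorem cd (v x : ℝ) (hv : |v| < π/2) : cc v x * dd v x = FS (fun k => od k * bc v k) od x := by
  apply FS_mul _ _ _ _ _ _ _ (ac_summ v hv) (gc_summ v hv)
  · intro N j; unfold od ev; push_cast; ring
  · intro N
    have : ∀ j : ℤ, ac v (N-j) * gc v j = al (N-j) * ga j * Real.exp ((2*(N:ℝ)+1)*v) := by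
      intro j
      unfold ac gc
      rw [show (2*(N:ℝ)+1)*v = (2*((N-j : ℤ):ℝ)+1)*v + 2*(j:ℝ)*v by push_cast; ring, Real.exp_add]
      ring
    simp_rw [this]
    rw [tsum_mul_right, conv1]
    unfold od bc; ring

theorem cs (v x : ℝ) (hv : |v| < π/2) : cc v x * ss v x = FS (fun k => ev k * gc v k) ev x := by
  have h1 : cc v x * ss v x = FS (fun N => (2*(N:ℝ)+2) * gc v (N+1)) (fun N => 2*(N:ℝ)+2) x := by
    apply FS_mul _ _ _ _ _ _ _ (ac_summ v hv) (bc_summ v hv)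
    · intro N j; unfold od; push_cast; ring
    · intro N
      have : ∀ j : ℤ, ac v (N-j) * bc v j = al (N-j) * be j * Real.exp ((2*((N+1:ℤ):ℝ))*v) := by
        intro j
        unfold ac bc
        rw [show (2*((N+1:ℤ):ℝ))*v = (2*((N-j : ℤ):ℝ)+1)*v + (2*(j:ℝ)+1)*v by push_cast; ring, Real.exp_add]
        ring
      simp_rw [this]
      rw [tsum_mul_right, conv2]
      unfold gc; ring
  rw [h1]
  unfold FS
  rw [← (Equiv.addRight (1:ℤ)).tsum_eq (fun k => ((ev k * gc v k : ℝ) : ℂ) * Complex.exp (((ev k * x : ℝ) : ℂ) * Complex.I))]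
  apply tsum_congr
  intro N
  simp only [Equiv.coe_addRight, ev]
  push_cast
  ring_nf

theorem ss_deriv (v x : ℝ) (hv : |v| < π/2) : HasDerivAt (ss v) (Complex.I * (cc v x * dd v x)) x := by
  rw [cd v x hv]; exact FS_deriv _ _ x (bc_summ v hv) (bc_summ1 v hv)
theorem dd_deriv (v x : ℝ) (hv : |v| < π/2) : HasDerivAt (dd v) (Complex.I * (cc v x * ss v x)) x := by
  rw [cs v x hv]; exact FS_deriv _ _ x (gc_summ v hv) (gc_summ1 v hv)

theorem cc_sum (v x : ℝ) (hv : |v| < π/2) : cc v x + cc (-v) x = 2 * (thx x v : ℂ) := by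
  have hv' : |(-v)| < π/2 := by rwa [abs_neg]
  unfold cc
  rw [FS_add _ _ _ _ (ac_summ v hv) (ac_summ (-v) hv')]
  have : (fun k => ac v k + ac (-v) k) = fun k : ℤ => 2 * (al k * Real.cosh ((2*(k:ℝ)+1)*v)) := by
    funext k; unfold ac; rw [Real.cosh_eq]; ring_nf
  rw [this, ← FS_smul]
  rw [FS_even _ _ (al_cosh_summ v hv)]
  · unfold thx; push_cast; congr 2
    funext k; ring
  · intro k; rw [al_neg]; push_cast
    rw [show (2*(-1-(k:ℝ))+1)*v = -((2*k+1)*v) by ring, Real.cosh_neg]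

theorem lin_ode (f φ φ' : ℝ → ℂ) (hf : ∀ x, HasDerivAt f (φ' x * f x) x) (hφ : ∀ x, HasDerivAt φ (φ' x) x) (x : ℝ) :
    f x = f 0 * Complex.exp (φ x - φ 0) := by
  have hd : ∀ x, HasDerivAt (fun x => f x * Complex.exp (-φ x)) 0 x := by
    intro x
    refine ((hf x).mul ((hφ x).neg.cexp)).congr_deriv ?_
    ring
  have := is_const_of_deriv_eq_zero (fun x => (hd x).differentiableAt) (fun x => (hd x).deriv) x 0
  rw [sub_eq_add_neg, Complex.exp_add, mul_comm (Complex.exp (φ x)), ← mul_assoc, ← this, mul_assoc, ← Complex.exp_add]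
  simp

theorem FS_zero (A ν : ℤ → ℝ) : FS A ν 0 = ((∑' k, A k : ℝ) : ℂ) := by
  unfold FS; rw [Complex.ofReal_tsum]; simp

theorem dd_neg0 (v : ℝ) : dd (-v) 0 = dd v 0 := by
  unfold dd; rw [FS_zero, FS_zero]; congr 1
  rw [← (Equiv.neg ℤ).tsum_eq]
  apply tsum_congr; intro k; unfold gc
  simp only [Equiv.neg_apply]
  rw [ga_neg]; push_cast; ring_nf
theorem ss_neg0 (v : ℝ) : ss (-v) 0 = - ss v 0 := by
  unfold ss; rw [FS_zero, FS_zero, ← Complex.ofReal_neg]; congr 1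
  rw [← tsum_refl, ← tsum_neg]
  apply tsum_congr; intro k; unfold bc
  rw [be_neg]; push_cast; ring_nf

theorem M_ne_pos (v : ℝ) (hv : |v| < π/2) (h0 : 0 ≤ v) : (dd v 0 + ss v 0) * (dd v 0 - ss v 0) ≠ 0 := by
  have hP : dd v 0 + ss v 0 ≠ 0 := by
    unfold dd ss
    rw [FS_zero, FS_zero, ← Complex.ofReal_add]
    have h1 : 0 < ∑' k, gc v k := by
      refine (gc_summ v hv).tsum_pos (fun k => ?_) 0 ?_
      · unfold gc; have := ga_pos k; positivity
      · unfold gc; have := ga_pos 0; positivity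
    have h2 : 0 ≤ ∑' k, bc v k := by
      have e : ∑' k, bc v k = ∑' k, bc v (-1-k) := (tsum_refl _).symm
      have hs' : Summable (fun k => bc v (-1-k)) := refl1.summable_iff.2 (bc_summ v hv)
      have : 0 ≤ ∑' k, bc v k + ∑' k, bc v (-1-k) := by
        rw [← (bc_summ v hv).tsum_add hs']
        apply tsum_nonneg
        intro k
        have : bc v k + bc v (-1-k) = 2 * (be k * Real.sinh ((2*(k:ℝ)+1)*v)) := by
          unfold bc; rw [be_neg, Real.sinh_eq]; push_cast; ring_nf
        rw [this]
        unfold be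
        rcases le_total 0 (2*(k:ℝ)+1) with hk | hk
        · have a : 0 ≤ Real.sinh ((2*(k:ℝ)+1)*v) := Real.sinh_nonneg_iff.2 (by positivity)
          have b : 0 ≤ Real.sinh ((2*(k:ℝ)+1)*(π/2)) := Real.sinh_nonneg_iff.2 (by positivity)
          positivity
        · have a : Real.sinh ((2*(k:ℝ)+1)*v) ≤ 0 := Real.sinh_nonpos_iff.2 (mul_nonpos_of_nonpos_of_nonneg hk h0)
          have b : Real.sinh ((2*(k:ℝ)+1)*(π/2)) ≤ 0 := Real.sinh_nonpos_iff.2 (mul_nonpos_of_nonpos_of_nonneg hk (by positivity))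
          have c : 1 / Real.sinh ((2*(k:ℝ)+1)*(π/2)) ≤ 0 := one_div_nonpos.2 b
          nlinarith [mul_nonneg_of_nonpos_of_nonpos c a]
      rw [← e] at this
      linarith
    exact_mod_cast (by linarith : (0:ℝ) < ∑' k, gc v k + ∑' k, bc v k).ne'
  refine mul_ne_zero hP ?_
  have hd : dd v π = dd v 0 := by
    unfold dd FS; apply tsum_congr; intro k
    congr 1
    unfold ev; push_cast
    rw [show 2 * (k:ℂ) * π * Complex.I = k * (2 * π * Complex.I) by ring, Complex.exp_int_mul_two_pi_mul_I]
    simp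
  have hs : ss v π = - ss v 0 := by
    unfold ss FS; rw [← tsum_neg]; apply tsum_congr; intro k
    unfold od; push_cast
    rw [show (2 * (k:ℂ) + 1) * π * Complex.I = k * (2 * π * Complex.I) + π * Complex.I by ring, Complex.exp_add, Complex.exp_int_mul_two_pi_mul_I, Complex.exp_pi_mul_I]
    simp
  have ode := lin_ode (fun x => dd v x - ss v x) (fun x => - FS (fun k => ac v k / od k) od x) (fun x => -(Complex.I * cc v x)) ?_ ?_ π
  · rw [hd, hs, sub_neg_eq_add] at ode
    intro h
    rw [h, zero_mul] at ode
    exact hP ode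
  · intro x
    refine ((dd_deriv v x hv).sub (ss_deriv v x hv)).congr_deriv ?_
    ring
  · intro x
    have hne : ∀ k, od k ≠ 0 := odd_ne
    have e : (fun k => od k * (ac v k / od k)) = ac v := by
      funext k; have := hne k; field_simp
    have := FS_deriv (fun k => ac v k / od k) od x ?_ (by rw [e]; exact ac_summ v hv)
    · rw [e] at this
      exact this.neg
    · refine Summable.of_norm_bounded (ac_summ v hv).abs (fun k => ?_)
      rw [Real.norm_eq_abs, abs_div]
      exact div_le_self (abs_nonneg _) (odd_abs k)

theorem M_ne (v : ℝ) (hv : |v| < π/2) : (dd v 0 + ss v 0) * (dd v 0 - ss v 0) ≠ 0 := by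
  rcases le_total 0 v with h0 | h0
  · exact M_ne_pos v hv h0
  · have := M_ne_pos (-v) (by rwa [abs_neg]) (by linarith)
    rw [dd_neg0, ss_neg0] at this
    intro h; apply this; rw [← h]; ring

theorem sd_sum (v : ℝ) (hv : |v| < π/2) : ∃ κ : ℝ, ∀ x,
    (ss v x * dd (-v) x + ss (-v) x * dd v x) * (Real.sinh v : ℂ) = 2 * κ * (Complex.I * (thv x v : ℂ)) := by
  have hv' : |(-v)| < π/2 := by rwa [abs_neg]
  obtain ⟨κ, hκ⟩ := conv3 v hv
  refine ⟨κ, fun x => ?_⟩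
  have hξ : ∀ N j, od (N-j) + ev j = od N := by intro N j; unfold od ev; push_cast; ring
  have e1 : ss v x * dd (-v) x = FS _ od x := FS_mul (bc v) (gc (-v)) od ev od _ x (bc_summ v hv) (gc_summ (-v) hv') hξ (fun N => rfl)
  have e2 : ss (-v) x * dd v x = FS _ od x := FS_mul (bc (-v)) (gc v) od ev od _ x (bc_summ (-v) hv') (gc_summ v hv) hξ (fun N => rfl)
  have hsin : FS (fun N => al N * Real.sinh ((2*(N:ℝ)+1)*v)) od x = Complex.I * (thv x v : ℂ) := by
    rw [FS_odd _ _ (al_sinh_summ v hv)]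
    · unfold thv; congr 3; funext k; ring
    · intro k; rw [al_neg]; push_cast
      rw [show (2*(-1-(k:ℝ))+1)*v = -((2*k+1)*v) by ring, Real.sinh_neg]; ring
  rw [e1, e2, ← hsin]
  have hcomb : ∀ N : ℤ, ((∑' j, bc v (N-j) * gc (-v) j) + (∑' j, bc (-v) (N-j) * gc v j)) * Real.sinh v
      = 2 * κ * (al N * Real.sinh ((2*(N:ℝ)+1)*v)) := by
    intro N
    have s1 := prod_summ _ _ (fun j => N-j) (bc_summ v hv) (gc_summ (-v) hv')
    have s2 := prod_summ _ _ (fun j => N-j) (bc_summ (-v) hv') (gc_summ v hv)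
    rw [← s1.tsum_add s2]
    have : ∀ j : ℤ, bc v (N-j) * gc (-v) j + bc (-v) (N-j) * gc v j = 2 * (be (N-j) * ga j * Real.cosh ((4*(j:ℝ)-2*N-1)*v)) := by
      intro j
      unfold bc gc
      rw [Real.cosh_eq]
      push_cast
      rw [show (4*(j:ℝ)-2*N-1)*v = (2*((N:ℝ)-j)+1)*(-v) + 2*j*v by ring,
        show -((2*((N:ℝ)-j)+1)*(-v) + 2*j*v) = (2*((N:ℝ)-j)+1)*v + 2*j*(-v) by ring, Real.exp_add, Real.exp_add]
      ring
    simp_rw [this]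
    rw [tsum_mul_left, mul_assoc, hκ N]
    ring
  unfold FS
  have q1 : ∀ u w : ℝ, |u| < π/2 → |w| < π/2 → Summable (fun N : ℤ => ((∑' j, bc u (N-j) * gc w j : ℝ) : ℂ) * Complex.exp (((od N * x : ℝ) : ℂ) * Complex.I)) := by
    intro u w hu hw
    apply FS_summ (fun N : ℤ => ∑' j, bc u (N-j) * gc w j)
    have hs : Summable (fun p : ℤ × ℤ => bc u p.1 * gc w p.2) :=
      summable_mul_of_summable_norm (bc_summ u hu).norm (gc_summ w hw).norm
    let e : ℤ × ℤ ≃ ℤ × ℤ := ⟨fun p => (p.1 - p.2, p.2), fun p => (p.1 + p.2, p.2),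
      fun p => by simp, fun p => by simp⟩
    exact (e.summable_iff.2 hs).prod
  rw [← (q1 v (-v) hv hv').tsum_add (q1 (-v) v hv' hv), ← tsum_mul_right, ← tsum_mul_left]
  apply tsum_congr
  intro N
  have := hcomb N
  rw [← add_mul, ← Complex.ofReal_add, mul_right_comm, ← Complex.ofReal_mul, this]
  push_cast; ring

theorem key0 (v : ℝ) (hv : |v| < π/2) : ∃ (M : ℂ) (κ : ℝ), M ≠ 0 ∧ ∀ x,
    M * (Real.sinh v : ℂ) * (Real.sin (2 * th x v) : ℂ) = 2 * κ * (thv x v : ℂ) := by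
  have hv' : |(-v)| < π/2 := by rwa [abs_neg]
  obtain ⟨κ, hκ⟩ := sd_sum v hv
  refine ⟨_, κ, M_ne v hv, fun x => ?_⟩
  set M := (dd v 0 + ss v 0) * (dd v 0 - ss v 0) with hM
  have hφ : ∀ x, HasDerivAt (fun x => Complex.I * (2 * (th x v : ℂ))) (Complex.I * (2 * (thx x v : ℂ))) x := by
    intro x
    exact (((th_dx x v hv).ofReal_comp).const_mul 2).const_mul Complex.I
  have th0 : th 0 v = 0 := by unfold th; simp
  have hZ := lin_ode (fun x => (dd v x + ss v x) * (dd (-v) x + ss (-v) x)) _ _ ?_ hφ x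
  have hY := lin_ode (fun x => (dd v x - ss v x) * (dd (-v) x - ss (-v) x)) _ _ ?_ (fun x => (hφ x).neg) x
  · simp only [th0, dd_neg0, ss_neg0, Pi.neg_apply] at hZ hY
    have h3 := hκ x
    have h4 : 2 * (ss v x * dd (-v) x + ss (-v) x * dd v x) = M * (Complex.exp (Complex.I * (2 * (th x v : ℂ))) - Complex.exp (-(Complex.I * (2 * (th x v : ℂ))))) := by
      have z : (dd v 0 + ss v 0) * (dd v 0 + - ss v 0) = M := by rw [hM]; ring
      have y : (dd v 0 - ss v 0) * (dd v 0 - - ss v 0) = M := by rw [hM]; ring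
      rw [z] at hZ; rw [y] at hY
      simp only [Complex.ofReal_zero, mul_zero, sub_zero, neg_zero] at hZ hY
      linear_combination hZ - hY
    have h5 : (Real.sin (2 * th x v) : ℂ) = (Complex.exp (-(Complex.I * (2 * (th x v : ℂ)))) - Complex.exp (Complex.I * (2 * (th x v : ℂ)))) * Complex.I / 2 := by
      push_cast
      rw [Complex.sin]
      ring_nf
    rw [h5]
    have : Complex.I ≠ 0 := Complex.I_ne_zero
    apply mul_left_cancel₀ this
    rw [show Complex.I * (2 * ↑κ * ↑(thv x v)) = 2 * κ * (Complex.I * (thv x v : ℂ)) by ring, ← h3]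
    linear_combination (-(Real.sinh v : ℂ) / 2) * h4 + M * (Real.sinh v : ℂ) * (Complex.exp (-(Complex.I * (2 * (th x v : ℂ)))) - Complex.exp (Complex.I * (2 * (th x v : ℂ)))) / 2 * Complex.I_sq
  · intro x
    refine (((dd_deriv v x hv).sub (ss_deriv v x hv)).mul ((dd_deriv (-v) x hv').sub (ss_deriv (-v) x hv'))).congr_deriv ?_
    rw [← cc_sum v x hv]
    simp only [Pi.sub_apply]
    ring
  · intro x
    refine (((dd_deriv v x hv).add (ss_deriv v x hv)).mul ((dd_deriv (-v) x hv').add (ss_deriv (-v) x hv'))).congr_deriv ?_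
    rw [← cc_sum v x hv]
    simp only [Pi.add_apply]
    ring

theorem thx0_pos (v : ℝ) (hv : |v| < π/2) : 0 < thx 0 v := by
  unfold thx
  have : (fun k : ℤ => al k * Real.cos ((2*(k:ℝ)+1)*0) * Real.cosh ((2*(k:ℝ)+1)*v)) = fun k : ℤ => al k * Real.cosh ((2*(k:ℝ)+1)*v) := by
    funext k; simp
  rw [this]
  refine (al_cosh_summ v hv).tsum_pos (fun k => ?_) 0 ?_
  · have := al_pos k; have := Real.cosh_pos ((2*(k:ℝ)+1)*v); positivity
  · have := al_pos 0; have := Real.cosh_pos ((2*((0:ℤ):ℝ)+1)*v); positivity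

noncomputable def KK (v : ℝ) : ℝ := thxv 0 v / (2 * thx 0 v)

theorem KK_nonpos (v : ℝ) (hv : |v| < π/2) (h0 : v ≤ 0) : KK v ≤ 0 := by
  unfold KK
  apply div_nonpos_of_nonpos_of_nonneg _ (by have := thx0_pos v hv; positivity)
  unfold thxv
  apply tsum_nonpos
  intro k
  simp only [mul_zero, Real.cos_zero, mul_one]
  rw [mul_assoc]
  apply mul_nonpos_of_nonneg_of_nonpos (al_pos k).le
  rcases le_total 0 (2*(k:ℝ)+1) with hk | hk
  · exact mul_nonpos_of_nonneg_of_nonpos hk (Real.sinh_nonpos_iff.2 (mul_nonpos_of_nonneg_of_nonpos hk h0))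
  · exact mul_nonpos_of_nonpos_of_nonneg hk (Real.sinh_nonneg_iff.2 (mul_nonneg_of_nonpos_of_nonpos hk h0))

theorem key (x v : ℝ) (hv : |v| < π/2) : thv x v = KK v * Real.sin (2 * th x v) := by
  rcases eq_or_ne v 0 with rfl | hv0
  · unfold KK thv thxv; simp
  obtain ⟨M, κ, hM, hk⟩ := key0 v hv
  have hsv : (Real.sinh v : ℂ) ≠ 0 := by
    rw [Complex.ofReal_ne_zero, Ne, Real.sinh_eq_zero]; exact hv0
  have hp := thx0_pos v hv
  have hd : M * (Real.sinh v : ℂ) * ((2 * thx 0 v : ℝ) : ℂ) = 2 * κ * (thxv 0 v : ℂ) := by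
    have th0 : th 0 v = 0 := by unfold th; simp
    have d1 : HasDerivAt (fun x => M * (Real.sinh v : ℂ) * (Real.sin (2 * th x v) : ℂ)) (M * (Real.sinh v : ℂ) * ((2 * thx 0 v : ℝ) : ℂ)) 0 := by
      have := ((th_dx 0 v hv).const_mul 2).sin.ofReal_comp.const_mul (M * (Real.sinh v : ℂ))
      refine this.congr_deriv ?_
      rw [th0]; simp
    have d2 : HasDerivAt (fun x => 2 * (κ : ℂ) * (thv x v : ℂ)) (2 * κ * (thxv 0 v : ℂ)) 0 :=
      (thv_dx 0 v hv).ofReal_comp.const_mul _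
    have : (fun x => M * (Real.sinh v : ℂ) * (Real.sin (2 * th x v) : ℂ)) = fun x => 2 * (κ : ℂ) * (thv x v : ℂ) := funext hk
    rw [this] at d1
    exact d1.unique d2
  have hp2 : ((2 * thx 0 v : ℝ) : ℂ) ≠ 0 := by
    rw [Complex.ofReal_ne_zero]; positivity
  have hκ : (2 * (κ:ℂ)) ≠ 0 := by
    intro h0
    rw [h0, zero_mul] at hd
    exact (mul_ne_zero (mul_ne_zero hM hsv) hp2) hd
  have : ((thv x v * (2 * thx 0 v) : ℝ) : ℂ) = ((thxv 0 v * Real.sin (2 * th x v) : ℝ) : ℂ) := by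
    apply mul_left_cancel₀ hκ
    rw [Complex.ofReal_mul (thv x v), Complex.ofReal_mul (thxv 0 v)]
    linear_combination (-((2 * thx 0 v : ℝ) : ℂ)) * hk x + (Real.sin (2 * th x v) : ℂ) * hd
  have := Complex.ofReal_injective this
  unfold KK
  field_simp
  linarith

theorem Zsum (f : ℤ → ℝ) (hf : Summable f) (he : ∀ k, f (-1-k) = f k) : ∑' k : ℤ, f k = 2 * ∑' k : ℕ, f k := by
  have h1 : Summable (fun n : ℕ => f n) := hf.comp_injective Nat.cast_injective
  have e : ∀ n : ℕ, f (-((n:ℤ)+1)) = f n := by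
    intro n; rw [← he n]; congr 1; ring
  have h2 : Summable (fun n : ℕ => f (-((n:ℤ)+1))) := h1.congr (fun n => (e n).symm)
  rw [tsum_of_nat_of_neg_add_one h1 h2, two_mul]
  congr 1
  exact tsum_congr e

theorem th_bound (x v : ℝ) (hv : |v| < π/2) : Summable (fun k : ℤ => al k / (2*(k:ℝ)+1) * Real.sin ((2*(k:ℝ)+1)*x) * Real.cosh ((2*(k:ℝ)+1)*v)) := by
  refine Summable.of_norm_bounded (al_cosh_summ v hv).abs (fun k => ?_)
  rw [Real.norm_eq_abs, abs_mul, abs_mul, abs_div, abs_mul]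
  refine mul_le_mul_of_nonneg_right ?_ (abs_nonneg _)
  refine (mul_le_of_le_one_right (by positivity) (Real.abs_sin_le_one _)).trans ?_
  exact div_le_self (abs_nonneg _) (odd_abs k)

theorem thx_bound (x v : ℝ) (hv : |v| < π/2) : Summable (fun k : ℤ => al k * Real.cos ((2*(k:ℝ)+1)*x) * Real.cosh ((2*(k:ℝ)+1)*v)) := by
  refine Summable.of_norm_bounded (al_cosh_summ v hv).abs (fun k => ?_)
  rw [Real.norm_eq_abs, abs_mul, abs_mul, abs_mul]
  refine mul_le_mul_of_nonneg_right ?_ (abs_nonneg _)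
  exact (mul_le_of_le_one_right (by positivity) (Real.abs_cos_le_one _))

theorem th_nat (x v : ℝ) (hv : |v| < π/2) : th x v = 2 * ∑' k : ℕ, al k / (2*(k:ℝ)+1) * Real.sin ((2*(k:ℝ)+1)*x) * Real.cosh ((2*(k:ℝ)+1)*v) := by
  unfold th
  rw [Zsum _ (th_bound x v hv)]
  · simp only [Int.cast_natCast]
  · intro k
    rw [al_neg]
    push_cast
    rw [show (2*(-1-(k:ℝ))+1) = -(2*k+1) by ring, neg_mul, neg_mul, Real.sin_neg, Real.cosh_neg, div_neg]
    ring

theorem thx_nat (x v : ℝ) (hv : |v| < π/2) : thx x v = 2 * ∑' k : ℕ, al k * Real.cos ((2*(k:ℝ)+1)*x) * Real.cosh ((2*(k:ℝ)+1)*v) := by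
  unfold thx
  rw [Zsum _ (thx_bound x v hv)]
  · simp only [Int.cast_natCast]
  · intro k
    rw [al_neg]
    push_cast
    rw [show (2*(-1-(k:ℝ))+1) = -(2*k+1) by ring, neg_mul, neg_mul, Real.cos_neg, Real.cosh_neg]

theorem cosh_pi : 9 ≤ Real.cosh π := by
  have h1 : Real.exp 3 ≤ Real.exp π := Real.exp_le_exp.2 Real.pi_gt_three.le
  have h2 : Real.exp 3 = Real.exp 1 ^ 3 := by rw [← Real.exp_nat_mul]; norm_num
  have h3 := Real.exp_one_gt_d9
  have h4 : (2.7:ℝ)^3 ≤ Real.exp 1 ^ 3 := by gcongr; linarith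
  rw [Real.cosh_eq]
  have := Real.exp_pos (-π)
  norm_num at h4
  linarith

theorem cosh_pi2 : 2 ≤ Real.cosh (π/2) := by
  have h1 := cosh_pi
  have h2 := Real.cosh_sq (π/2)
  have h3 := Real.cosh_two_mul (π/2)
  rw [show 2 * (π/2) = π by ring] at h3
  have := Real.cosh_pos (π/2)
  nlinarith

theorem al_geo (k : ℕ) : (2*(k:ℝ)+1) * al k ≤ al 0 * (1/3)^k := by
  induction k with
  | zero => simp
  | succ k ih =>
    have h1 : al ((k+1:ℕ):ℤ) ≤ al k / 9 := by
      unfold al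
      rw [div_div]
      apply one_div_le_one_div_of_le
      · have := Real.cosh_pos ((2*((k:ℤ):ℝ)+1)*(π/2)); positivity
      · push_cast
        rw [show (2*((k:ℝ)+1)+1)*(π/2) = (2*(k:ℝ)+1)*(π/2) + π by ring, Real.cosh_add]
        have a := Real.sinh_nonneg_iff.2 (by positivity : 0 ≤ (2*(k:ℝ)+1)*(π/2))
        have b := Real.sinh_nonneg_iff.2 Real.pi_pos.le
        have c := Real.cosh_pos ((2*(k:ℝ)+1)*(π/2))
        nlinarith [cosh_pi, mul_nonneg a b]
    have h2 := al_pos k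
    have h3 : (0:ℝ) ≤ k := k.cast_nonneg
    calc (2*((k+1:ℕ):ℝ)+1) * al ((k+1:ℕ):ℤ) ≤ (2*((k+1:ℕ):ℝ)+1) * (al k / 9) := by gcongr
      _ ≤ (2*(k:ℝ)+1) * al k / 3 := by push_cast; nlinarith
      _ ≤ al 0 * (1/3)^k / 3 := by linarith
      _ = _ := by rw [pow_succ]; ring

theorem ser_bd (u : ℕ → ℝ) (c : ℝ) (hc : 0 < c) (hs : Summable (fun k : ℕ => al k * u k)) (h0 : u 0 = c)
    (hu : ∀ k : ℕ, |u k| ≤ (2*(k:ℝ)+1) * c) : 0 < ∑' k : ℕ, al k * u k ∧ ∑' k : ℕ, al k * u k ≤ 3/2 * al 0 * c := by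
  have hg : HasSum (fun k : ℕ => al 0 * c * (1/3:ℝ)^k) (al 0 * c * (3/2)) := by
    have := (hasSum_geometric_of_lt_one (by norm_num : (0:ℝ) ≤ 1/3) (by norm_num)).mul_left (al 0 * c)
    norm_num at this ⊢
    exact this
  have hb : ∀ k : ℕ, |al k * u k| ≤ al 0 * c * (1/3:ℝ)^k := by
    intro k
    rw [abs_mul, abs_of_pos (al_pos k)]
    calc al k * |u k| ≤ al k * ((2*(k:ℝ)+1) * c) := mul_le_mul_of_nonneg_left (hu k) (al_pos k).le
      _ = ((2*(k:ℝ)+1) * al k) * c := by ring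
      _ ≤ (al 0 * (1/3)^k) * c := mul_le_mul_of_nonneg_right (al_geo k) hc.le
      _ = _ := by ring
  have ha := al_pos 0
  constructor
  · have h1 : Summable (fun k : ℕ => al k * u k + al 0 * c * (1/3:ℝ)^k) := hs.add hg.summable
    have h2 := h1.le_tsum 0 (fun j _ => by linarith [(abs_le.1 (hb j)).1])
    rw [hs.tsum_add hg.summable, hg.tsum_eq, h0] at h2
    simp at h2
    have := mul_pos ha hc
    linarith
  · have := hs.tsum_le_tsum (fun k => (abs_le.1 (hb k)).2) hg.summable
    rw [hg.tsum_eq] at this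
    linarith

theorem sin_odd (x : ℝ) (k : ℕ) : |Real.sin ((2*(k:ℝ)+1)*x)| ≤ (2*(k:ℝ)+1) * |Real.sin x| := by
  induction k with
  | zero => simp
  | succ k ih =>
    have : Real.sin ((2*((k+1:ℕ):ℝ)+1)*x) = Real.sin ((2*(k:ℝ)+1)*x) * Real.cos (2*x) + Real.cos ((2*(k:ℝ)+1)*x) * (2 * Real.sin x * Real.cos x) := by
      rw [← Real.sin_two_mul, ← Real.sin_add]; push_cast; ring_nf
    rw [this]
    refine (abs_add_le _ _).trans ?_
    rw [abs_mul, abs_mul, abs_mul, abs_mul, abs_two]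
    have a := mul_le_of_le_one_right (abs_nonneg (Real.sin ((2*(k:ℝ)+1)*x))) (Real.abs_cos_le_one (2*x))
    have b : |Real.cos ((2*(k:ℝ)+1)*x)| * (2 * |Real.sin x| * |Real.cos x|) ≤ 1 * (2 * |Real.sin x| * 1) := by
      gcongr
      · exact Real.abs_cos_le_one _
      · exact Real.abs_cos_le_one _
    push_cast
    linarith

theorem cos_odd (x : ℝ) (k : ℕ) : |Real.cos ((2*(k:ℝ)+1)*x)| ≤ (2*(k:ℝ)+1) * |Real.cos x| := by
  induction k with
  | zero => simp
  | succ k ih =>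
    have : Real.cos ((2*((k+1:ℕ):ℝ)+1)*x) = Real.cos ((2*(k:ℝ)+1)*x) * Real.cos (2*x) - Real.sin ((2*(k:ℝ)+1)*x) * (2 * Real.sin x * Real.cos x) := by
      rw [← Real.sin_two_mul, ← Real.cos_add]; push_cast; ring_nf
    rw [this]
    refine (abs_sub _ _).trans ?_
    rw [abs_mul, abs_mul, abs_mul, abs_mul, abs_two]
    have a := mul_le_of_le_one_right (abs_nonneg (Real.cos ((2*(k:ℝ)+1)*x))) (Real.abs_cos_le_one (2*x))
    have b : |Real.sin ((2*(k:ℝ)+1)*x)| * (2 * |Real.sin x| * |Real.cos x|) ≤ 1 * (2 * 1 * |Real.cos x|) := by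
      gcongr
      · exact Real.abs_sin_le_one _
      · exact Real.abs_sin_le_one _
    push_cast
    linarith

theorem th0_bd (x : ℝ) (h0 : 0 < x) (h1 : x < π/2) : 0 < th x 0 ∧ th x 0 < π/2 := by
  have hs := (th_bound x 0 pi2pos).comp_injective (i := fun n : ℕ => (n:ℤ)) Nat.cast_injective
  have hsin := Real.sin_pos_of_pos_of_lt_pi h0 (by linarith)
  have := ser_bd (fun k => Real.sin ((2*(k:ℝ)+1)*x) / (2*(k:ℝ)+1)) (Real.sin x) hsin ?_ (by simp) ?_
  · rw [th_nat x 0 pi2pos]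
    have e : ∀ k : ℕ, al k / (2*(k:ℝ)+1) * Real.sin ((2*(k:ℝ)+1)*x) * Real.cosh ((2*(k:ℝ)+1)*0) = al k * (Real.sin ((2*(k:ℝ)+1)*x) / (2*(k:ℝ)+1)) := by
      intro k; simp; ring
    simp_rw [e]
    refine ⟨by linarith [this.1], ?_⟩
    have ha : al 0 ≤ 1/2 := by
      unfold al
      apply one_div_le_one_div_of_le (by norm_num)
      simpa using cosh_pi2
    have := mul_le_mul ha (Real.sin_le_one x) hsin.le (by norm_num)
    linarith [Real.pi_gt_three]
  · refine hs.congr (fun k => ?_)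
    simp; ring
  · intro k
    have hk : (1:ℝ) ≤ 2*(k:ℝ)+1 := by linarith [(k.cast_nonneg : (0:ℝ) ≤ k)]
    rw [abs_div, abs_of_pos (by linarith : (0:ℝ) < 2*(k:ℝ)+1)]
    refine (div_le_self (abs_nonneg _) hk).trans ?_
    have := sin_odd x k
    rwa [abs_of_pos hsin] at this

theorem thx0_bd (x : ℝ) (h0 : 0 < x) (h1 : x < π/2) : 0 < thx x 0 := by
  have hs := (thx_bound x 0 pi2pos).comp_injective (i := fun n : ℕ => (n:ℤ)) Nat.cast_injective
  have hcos := Real.cos_pos_of_mem_Ioo ⟨by linarith, h1⟩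
  have := ser_bd (fun k => Real.cos ((2*(k:ℝ)+1)*x)) (Real.cos x) hcos ?_ (by simp) ?_
  · rw [thx_nat x 0 pi2pos]
    have e : ∀ k : ℕ, al k * Real.cos ((2*(k:ℝ)+1)*x) * Real.cosh ((2*(k:ℝ)+1)*0) = al k * Real.cos ((2*(k:ℝ)+1)*x) := by
      intro k; simp
    simp_rw [e]
    linarith [this.1]
  · refine hs.congr (fun k => ?_)
    simp
  · intro k
    have := cos_odd x k
    rwa [abs_of_pos hcos] at this

theorem ode_pos (c : ℝ) (a f : ℝ → ℝ) (ha : ∀ v, |v| < c → ContinuousAt a v)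
    (hf : ∀ v, |v| < c → HasDerivAt f (a v * f v) v) (h0 : 0 < f 0) (v : ℝ) (hv : |v| < c) : 0 < f v := by
  have hc : 0 < c := lt_of_le_of_lt (abs_nonneg _) hv
  have hmem : ∀ w, w ∈ Ioo (-c) c ↔ |w| < c := fun w => abs_lt.symm
  have hco : ContinuousOn a (Ioo (-c) c) := fun w hw => (ha w ((hmem w).1 hw)).continuousWithinAt
  have hφ : ∀ w, |w| < c → HasDerivAt (fun w => ∫ t in (0:ℝ)..w, a t) (a w) w := by
    intro w hw
    apply intervalIntegral.integral_hasDerivAt_right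
    · apply ContinuousOn.intervalIntegrable
      apply hco.mono
      exact ordConnected_Ioo.uIcc_subset ((hmem 0).2 (by simpa using hc)) ((hmem w).2 hw)
    · exact hco.stronglyMeasurableAtFilter isOpen_Ioo w ((hmem w).2 hw)
    · exact ha w hw
  have hg : ∀ w, |w| < c → HasDerivAt (fun w => f w * Real.exp (-∫ t in (0:ℝ)..w, a t)) 0 w := by
    intro w hw
    refine ((hf w hw).mul ((hφ w hw).neg.exp)).congr_deriv ?_
    ring
  have hconst := isOpen_Ioo.is_const_of_deriv_eq_zero (isPreconnected_Ioo (a := -c) (b := c)) (f := fun w => f w * Real.exp (-∫ t in (0:ℝ)..w, a t))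
    (fun w hw => (hg w ((hmem w).1 hw)).differentiableAt.differentiableWithinAt) (fun w hw => (hg w ((hmem w).1 hw)).deriv)
    ((hmem v).2 hv) ((hmem 0).2 (by simpa using hc))
  simp only [intervalIntegral.integral_same, neg_zero, Real.exp_zero, mul_one] at hconst
  rw [← hconst] at h0
  exact pos_of_mul_pos_left h0 (Real.exp_pos _).le

theorem key_x (x v : ℝ) (hv : |v| < π/2) : thxv x v = 2 * KK v * Real.cos (2 * th x v) * thx x v := by
  have d1 := thv_dx x v hv
  have e : (fun x => thv x v) = fun x => KK v * Real.sin (2 * th x v) := funext fun x => key x v hv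
  rw [e] at d1
  have d2 := (((th_dx x v hv).const_mul 2).sin).const_mul (KK v)
  rw [d1.unique d2]; ring

theorem KK_cont (v : ℝ) (hv : |v| < π/2) : ContinuousAt KK v := by
  unfold KK
  refine (thxv_cont 0 v hv).div ((thx_dv 0 v hv).continuousAt.const_mul 2) ?_
  have := thx0_pos v hv; positivity

theorem sin_th_pos (x : ℝ) (h0 : 0 < x) (h1 : x < π/2) (v : ℝ) (hv : |v| < π/2) : 0 < Real.sin (th x v) := by
  refine ode_pos (π/2) (fun v => 2 * KK v * Real.cos (th x v)^2) (fun v => Real.sin (th x v)) ?_ ?_ ?_ v hv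
  · intro v hv
    have := KK_cont v hv
    have := (th_dv x v hv).continuousAt
    fun_prop
  · intro v hv
    refine (th_dv x v hv).sin.congr_deriv ?_
    rw [key x v hv, Real.sin_two_mul]; ring
  · have := th0_bd x h0 h1
    exact Real.sin_pos_of_pos_of_lt_pi this.1 (by linarith [Real.pi_pos])

theorem cos_th_pos (x : ℝ) (h0 : 0 < x) (h1 : x < π/2) (v : ℝ) (hv : |v| < π/2) : 0 < Real.cos (th x v) := by
  refine ode_pos (π/2) (fun v => -2 * KK v * Real.sin (th x v)^2) (fun v => Real.cos (th x v)) ?_ ?_ ?_ v hv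
  · intro v hv
    have := KK_cont v hv
    have := (th_dv x v hv).continuousAt
    fun_prop
  · intro v hv
    refine (th_dv x v hv).cos.congr_deriv ?_
    rw [key x v hv, Real.sin_two_mul]; ring
  · have := th0_bd x h0 h1
    exact Real.cos_pos_of_mem_Ioo ⟨by linarith, this.2⟩

theorem thx_pos (x : ℝ) (h0 : 0 < x) (h1 : x < π/2) (v : ℝ) (hv : |v| < π/2) : 0 < thx x v := by
  refine ode_pos (π/2) (fun v => 2 * KK v * Real.cos (2 * th x v)) (fun v => thx x v) ?_ ?_ ?_ v hv
  · intro v hv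
    have := KK_cont v hv
    have := (th_dv x v hv).continuousAt
    fun_prop
  · intro v hv
    refine (thx_dv x v hv).congr_deriv ?_
    rw [key_x x v hv]
  · exact thx0_bd x h0 h1

theorem th_mem (x : ℝ) (h0 : 0 < x) (h1 : x < π/2) (v : ℝ) (hv : |v| < π/2) : 0 < th x v ∧ th x v < π/2 := by
  have hb := th0_bd x h0 h1
  have hsub : ∀ w ∈ uIcc 0 v, |w| < π/2 := by
    intro w hw
    have : uIcc 0 v ⊆ Ioo (-(π/2)) (π/2) := ordConnected_Ioo.uIcc_subset (abs_lt.1 pi2pos) (abs_lt.1 hv)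
    exact abs_lt.2 (this hw)
  have hc : ContinuousOn (fun v => th x v) (uIcc 0 v) := fun w hw => (th_dv x w (hsub w hw)).continuousAt.continuousWithinAt
  have hivt := intermediate_value_uIcc hc
  constructor
  · by_contra! hn
    have : (0:ℝ) ∈ uIcc (th x 0) (th x v) := mem_uIcc.2 (Or.inr ⟨hn, hb.1.le⟩)
    obtain ⟨w, hw, hw2⟩ := hivt this
    have := sin_th_pos x h0 h1 w (hsub w hw)
    simp only at hw2
    rw [hw2] at this; simp at this
  · by_contra! hn
    have : π/2 ∈ uIcc (th x 0) (th x v) := mem_uIcc.2 (Or.inl ⟨hb.2.le, hn⟩)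
    obtain ⟨w, hw, hw2⟩ := hivt this
    have := cos_th_pos x h0 h1 w (hsub w hw)
    simp only at hw2
    rw [hw2] at this; simp at this

theorem mul_cos_le (t : ℝ) (h0 : 0 < t) (h1 : t < π) : t * Real.cos t ≤ Real.sin t := by
  have hs := Real.sin_pos_of_pos_of_lt_pi h0 h1
  rcases le_or_gt (π/2) t with h | h
  · have := Real.cos_nonpos_of_pi_div_two_le_of_le h (by linarith)
    nlinarith
  · have hc := Real.cos_pos_of_mem_Ioo (⟨by linarith, h⟩ : t ∈ Ioo (-(π/2)) (π/2))
    have := Real.lt_tan h0 h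
    rw [Real.tan_eq_sin_div_cos, lt_div_iff₀ hc] at this
    exact this.le

theorem mono_v (x : ℝ) (h0 : 0 < x) (h1 : x < π/2) : MonotoneOn (fun v => thx x v / th x v) (Ioo (-(π/2)) 0) := by
  have hab : ∀ v ∈ Ioo (-(π/2)) (0:ℝ), |v| < π/2 := fun v hv => abs_lt.2 ⟨hv.1, by linarith [hv.2, Real.pi_pos]⟩
  have hd : ∀ v ∈ Ioo (-(π/2)) (0:ℝ), HasDerivAt (fun v => thx x v / th x v) ((thxv x v * th x v - thx x v * thv x v) / th x v ^ 2) v := by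
    intro v hv
    exact (thx_dv x v (hab v hv)).div (th_dv x v (hab v hv)) (th_mem x h0 h1 v (hab v hv)).1.ne'
  refine monotoneOn_of_deriv_nonneg (convex_Ioo _ _) (fun v hv => (hd v hv).continuousAt.continuousWithinAt) ?_ ?_
  · rw [interior_Ioo]
    exact fun v hv => (hd v hv).differentiableAt.differentiableWithinAt
  · rw [interior_Ioo]
    intro v hv
    rw [(hd v hv).deriv]
    apply div_nonneg _ (sq_nonneg _)
    rw [key_x x v (hab v hv), key x v (hab v hv)]
    have hm := th_mem x h0 h1 v (hab v hv)
    have a := mul_cos_le (2 * th x v) (by linarith [hm.1]) (by linarith [hm.2])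
    have b := KK_nonpos v (hab v hv) hv.2.le
    have c := thx_pos x h0 h1 v (hab v hv)
    have e := mul_nonneg (mul_nonneg (neg_nonneg.2 b) c.le) (sub_nonneg.2 a)
    linarith [e]

theorem FG (n y : ℝ) (hn : 0 < n) : F n y - coth (n * π) * G n y = 1 / Real.cosh (n * (π/2)) * Real.cosh (n * (y - π/2)) := by
  have hS : Real.sinh (n * (π/2)) ≠ 0 := by
    rw [Ne, Real.sinh_eq_zero]; have := Real.pi_pos; positivity
  have hC := (Real.cosh_pos (n * (π/2))).ne'
  unfold F G coth
  rw [show n * π = 2 * (n * (π/2)) by ring, Real.cosh_two_mul, Real.sinh_two_mul,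
    show n * y = n * (π/2) + n * (y - π/2) by ring, show n * (π - y) = n * (π/2) - n * (y - π/2) by ring,
    Real.cosh_add, Real.cosh_sub, Real.sinh_add, Real.sinh_sub]
  have hq := Real.cosh_sq (n * (π/2))
  generalize Real.cosh (n * (π/2)) = C at *
  generalize Real.sinh (n * (π/2)) = S at *
  generalize Real.cosh (n * (y - π/2)) = c at *
  generalize Real.sinh (n * (y - π/2)) = s at *
  field_simp
  linear_combination 2 * c * S * hq

theorem h_eq (x y : ℝ) (hy : y ∈ Ioo 0 π) : h x y = (2/π) * th x (y - π/2) := by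
  have hv : |y - π/2| < π/2 := abs_lt.2 ⟨by linarith [hy.1], by linarith [hy.2]⟩
  rw [th_nat x _ hv]
  unfold h
  rw [← mul_assoc, show 2/π*2 = 4/π by ring]
  congr 1
  apply tsum_congr
  intro k
  rw [FG _ _ (by positivity)]
  unfold al
  push_cast
  ring

theorem hx_eq (x y : ℝ) (hy : y ∈ Ioo 0 π) : hx x y = (2/π) * thx x (y - π/2) := by
  have hv : |y - π/2| < π/2 := abs_lt.2 ⟨by linarith [hy.1], by linarith [hy.2]⟩
  unfold hx
  rw [show (fun x' => h x' y) = fun x' => (2/π) * th x' (y - π/2) from funext fun x' => h_eq x' y hy]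
  exact ((th_dx x _ hv).const_mul _).deriv

theorem final (x : ℝ) (h0 : 0 < x) (h1 : x < π/2) : MonotoneOn (fun y => hx x y / h x y) (Set.Ioo 0 (π / 2)) := by
  have hp := Real.pi_pos
  have e : ∀ y ∈ Set.Ioo 0 (π/2), hx x y / h x y = thx x (y - π/2) / th x (y - π/2) := by
    intro y hy
    have hy' : y ∈ Ioo 0 π := ⟨hy.1, by linarith [hy.2]⟩
    rw [hx_eq x y hy', h_eq x y hy', mul_div_mul_left _ _ (by positivity)]
  intro y hy z hz hyz
  simp only
  rw [e y hy, e z hz]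
  exact mono_v x h0 h1 ⟨by linarith [hy.1], by linarith [hy.2]⟩ ⟨by linarith [hz.1], by linarith [hz.2]⟩ (by linarith)

end T3

theorem stmt3 :
    ∀ x : ℝ, 0 < x → x < π / 2 →
      MonotoneOn (fun y => hx x y / h x y) (Set.Ioo 0 (π / 2)) := by
  intro x h0 h1
  exact T3.final x h0 h1
end

section
/- Let h be the function on (0,π)² given by the series h(x,y) = (4/π)·Σ_{k=0}^∞ (sin((2k+1)x)/(2k+1))·(F_{2k+1}(y) − coth((2k+1)π)·G_{2k+1}(y)). Then for all (x,y) with 0 ≤ x ≤ π/2 and 0 ≤ y ≤ π/2 (interpreting values at the boundary as limits from inside, and the inequality on the open square), h(x,y)·h_xy(x,y) − h_x(x,y)·h_y(x,y) ≥ 0 for (x,y) ∈ (0,π/2)², where h_x, h_y denote the partial derivatives of h in the first and second variables and h_xy the mixed second partial derivative. -/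
open Real Filter Set Topology

/-- Partial derivative of `h` in its second variable. -/
noncomputable def hy (x y : ℝ) : ℝ := deriv (fun y' => h x y') y

/-- Mixed second partial derivative of `h`. -/
noncomputable def hxy (x y : ℝ) : ℝ := deriv (fun y' => hx x y') y

namespace SQ

lemma hasSum_of_eq {ι R : Type*} [AddCommMonoid R] [TopologicalSpace R] {f g : ι → R} {s t : R}
    (hf : HasSum f s) (hfg : ∀ k, g k = f k) (hs : t = s) : HasSum g t := by
  rw [hs, funext hfg]; exact hf

/-- Fourier coefficients: `sech ((2k+1)a)`. -/
noncomputable def A (a : ℝ) (k : ℤ) : ℝ := 1 / Real.cosh ((2 * k + 1) * a)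

/-- `tanh ((2k+1)a)`. -/
noncomputable def T (a : ℝ) (k : ℤ) : ℝ := Real.sinh ((2 * k + 1) * a) / Real.cosh ((2 * k + 1) * a)

lemma A_pos (a : ℝ) (k : ℤ) : 0 < A a k := by
  unfold A; have := Real.cosh_pos ((2 * k + 1) * a); positivity

lemma A_le (a : ℝ) (ha : 0 < a) (k : ℤ) : A a k ≤ 2 * Real.exp (-a * |(2 * k + 1 : ℝ)|) := by
  unfold A
  have h1 : Real.exp (a * |(2 * k + 1 : ℝ)|) / 2 ≤ Real.cosh ((2 * k + 1) * a) := by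
    rw [← Real.cosh_abs, abs_mul, abs_of_pos ha, mul_comm, Real.cosh_eq]
    have := Real.exp_pos (-(|(2 * k + 1 : ℝ)| * a))
    linarith
  have h2 := Real.exp_pos (a * |(2 * k + 1 : ℝ)|)
  rw [neg_mul, Real.exp_neg, div_le_iff₀ (Real.cosh_pos _)]
  have : (2 * (Real.exp (a * |(2 * k + 1 : ℝ)|))⁻¹) * (Real.exp (a * |(2 * k + 1 : ℝ)|) / 2) = 1 := by
    field_simp
  calc (1:ℝ) = _ := this.symm
    _ ≤ _ := by gcongr

lemma summable_base (δ : ℝ) (hδ : 0 < δ) :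
    Summable (fun k : ℤ => (2 * k + 1 : ℝ) ^ 2 * Real.exp (-δ * |(2 * k + 1 : ℝ)|)) := by
  have h1 : Summable (fun n : ℕ => (2 * n + 1 : ℝ) ^ 2 * Real.exp (-δ * (2 * n + 1))) := by
    have := (Real.summable_pow_mul_exp_neg_nat_mul 2 hδ).comp_injective
      (i := fun n : ℕ => 2 * n + 1) (fun x y hxy => by simpa using hxy)
    refine this.congr fun n => ?_
    simp
  apply Summable.of_nat_of_neg_add_one
  · refine h1.congr fun n => ?_
    have : |(2 * n + 1 : ℝ)| = 2 * n + 1 := abs_of_pos (by positivity)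
    simp [this]
  · refine h1.congr fun n => ?_
    have e : (2 * ((-((n:ℤ) + 1) : ℤ) : ℝ) + 1) = -(2 * n + 1) := by push_cast; ring
    have : |(2 * n + 1 : ℝ)| = 2 * n + 1 := abs_of_pos (by positivity)
    rw [e, abs_neg, this, neg_sq]

lemma one_le_odd (k : ℤ) : 1 ≤ |(2 * k + 1 : ℝ)| := by
  have : (1:ℤ) ≤ |2 * k + 1| := Int.one_le_abs (by omega)
  exact_mod_cast this

lemma one_le_odd_sq (k : ℤ) : 1 ≤ (2 * k + 1 : ℝ) ^ 2 := by
  rw [← sq_abs]; have := one_le_odd k; nlinarith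

lemma summable_A2 (a : ℝ) (ha : 0 < a) : Summable (fun k : ℤ => (2 * k + 1 : ℝ) ^ 2 * A a k) := by
  refine Summable.of_nonneg_of_le (fun k => mul_nonneg (sq_nonneg _) (A_pos a k).le) (fun k => ?_)
    ((summable_base a ha).mul_left 2)
  have := A_le a ha k
  nlinarith [sq_nonneg (2 * k + 1 : ℝ)]

lemma summable_A (a : ℝ) (ha : 0 < a) : Summable (A a) := by
  refine Summable.of_nonneg_of_le (fun k => (A_pos a k).le) (fun k => ?_) (summable_A2 a ha)
  have := one_le_odd_sq k
  nlinarith [A_pos a k]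

lemma A_symm (a : ℝ) (k : ℤ) : A a (-k - 1) = A a k := by
  unfold A
  rw [← Real.cosh_neg ((2 * k + 1) * a)]
  congr 2; push_cast; ring

lemma T_symm (a : ℝ) (k : ℤ) : T a (-k - 1) = - T a k := by
  unfold T
  rw [← Real.cosh_neg ((2 * k + 1) * a), ← neg_div, ← Real.sinh_neg]
  congr 2 <;> (push_cast; ring)

lemma A_mul (a : ℝ) (k m : ℤ) :
    A a k * A a (m - 1 - k) * Real.sinh (2 * m * a) = T a k - T a (k - m) := by
  have h1 : T a (k - m) = - T a (m - 1 - k) := by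
    rw [← T_symm]; congr 1; ring
  rw [h1]
  unfold A T
  have c1 := (Real.cosh_pos ((2 * k + 1) * a)).ne'
  have c2 := (Real.cosh_pos ((2 * (m - 1 - k : ℤ) + 1) * a)).ne'
  have : (2 * m * a) = (2 * k + 1) * a + (2 * ((m - 1 - k : ℤ) : ℝ) + 1) * a := by push_cast; ring
  rw [this, Real.sinh_add]
  field_simp
  ring

/-- differences of `T`. -/
noncomputable def d (a : ℝ) (k : ℤ) : ℝ := T a k - T a (k - 1)

lemma d_neg (a : ℝ) (k : ℤ) : d a (-k) = d a k := by
  unfold d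
  have h1 := T_symm a k
  have h2 := T_symm a (k - 1)
  rw [h1, show -k = -(k-1) - 1 by ring, h2]; ring

lemma A_le_two (a : ℝ) (k : ℤ) : A a k ≤ 1 := by
  unfold A
  rw [div_le_one (Real.cosh_pos _)]
  exact Real.one_le_cosh _

lemma d_eq (a : ℝ) (k : ℤ) : d a k = A a k * A a (-k) * Real.sinh (2 * a) := by
  have := A_mul a k 1
  simp at this
  rw [d, ← this]

lemma summable_kd (a : ℝ) (ha : 0 < a) : Summable (fun k : ℤ => (2 * k + 1 : ℝ) ^ 2 * d a k) := by
  have hs : 0 < Real.sinh (2 * a) := Real.sinh_pos_iff.2 (by linarith)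
  refine Summable.of_nonneg_of_le (fun k => ?_) (fun k => ?_)
    ((summable_A2 a ha).mul_left (Real.sinh (2 * a)))
  · rw [d_eq]
    have := A_pos a k; have := A_pos a (-k)
    positivity
  · rw [d_eq]
    have h1 := A_pos a k; have h2 := A_le_two a (-k)
    have : 0 ≤ Real.sinh (2 * a) * ((2 * k + 1 : ℝ) ^ 2 * A a k) := by positivity
    nlinarith

lemma d_nonneg (a : ℝ) (ha : 0 < a) (k : ℤ) : 0 ≤ d a k := by
  have hs : 0 < Real.sinh (2 * a) := Real.sinh_pos_iff.2 (by linarith)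
  rw [d_eq]
  have := A_pos a k; have := A_pos a (-k)
  positivity

lemma summable_d (a : ℝ) (ha : 0 < a) : Summable (d a) := by
  refine Summable.of_nonneg_of_le (d_nonneg a ha) (fun k => ?_) (summable_kd a ha)
  nlinarith [d_nonneg a ha k, one_le_odd_sq k]

lemma summable_kd1 (a : ℝ) (ha : 0 < a) : Summable (fun k : ℤ => (k : ℝ) * d a k) := by
  refine Summable.of_norm_bounded (((summable_kd a ha).add (summable_d a ha))) (fun k => ?_)
  rw [norm_mul, Real.norm_eq_abs, Real.norm_eq_abs, abs_of_nonneg (d_nonneg a ha k)]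
  have h1 := d_nonneg a ha k
  have : |(k:ℝ)| ≤ (2 * k + 1 : ℝ) ^ 2 + 1 := by
    apply abs_le.2; constructor <;> nlinarith [sq_nonneg (2 * k + 1 : ℝ), sq_nonneg (k + 1 : ℝ), sq_nonneg (k : ℝ)]
  nlinarith

lemma T_tendsto (a : ℝ) (ha : 0 < a) : Tendsto (fun n : ℕ => T a n) atTop (𝓝 1) := by
  have h0 : Tendsto (fun n : ℕ => A a n) atTop (𝓝 0) :=
    ((summable_A a ha).comp_injective (i := fun n : ℕ => (n : ℤ)) Nat.cast_injective).tendsto_atTop_zero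
  have h1 : Tendsto (fun n : ℕ => 1 - A a n) atTop (𝓝 1) := by
    simpa using h0.const_sub 1
  refine tendsto_of_tendsto_of_tendsto_of_le_of_le h1 tendsto_const_nhds (fun n => ?_) (fun n => ?_)
  · have c1 := Real.cosh_pos ((2 * (n:ℤ) + 1) * a)
    have e : 1 - A a n - T a n = (Real.exp (-((2 * (n:ℤ) + 1) * a)) - 1) / Real.cosh ((2 * (n:ℤ) + 1) * a) := by
      rw [← Real.cosh_sub_sinh]
      unfold A T
      field_simp
      ring
    have : 1 - A a n - T a n ≤ 0 := by
      rw [e]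
      apply div_nonpos_of_nonpos_of_nonneg _ c1.le
      have : Real.exp (-((2 * (n:ℤ) + 1) * a)) ≤ 1 := Real.exp_le_one_iff.2 (by
        have : 0 ≤ (2 * ((n:ℤ):ℝ) + 1) * a := by push_cast; positivity
        linarith)
      linarith
    show 1 - A a n ≤ T a n
    linarith
  · show T a n ≤ 1
    unfold T
    rw [div_le_one (Real.cosh_pos _)]
    exact (Real.sinh_lt_cosh _).le

lemma hasSum_d (a : ℝ) (ha : 0 < a) : HasSum (d a) 2 := by
  have h1 := (summable_d a ha).hasSum
  have h2 := h1.nat_add_neg_add_one.tendsto_sum_nat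
  have h3 : ∀ N : ℕ, ∑ i ∈ Finset.range N, (d a i + d a (-(i + 1))) = T a N + T a (N - 1) := by
    intro N
    induction N with
    | zero =>
      have := T_symm a 0
      simp at this
      simp [this]
    | succ n ih =>
      rw [Finset.sum_range_succ, ih, d_neg]
      unfold d
      push_cast
      ring_nf
  have h4 : Tendsto (fun N : ℕ => T a N + T a (N - 1)) atTop (𝓝 (1 + 1)) := by
    refine (T_tendsto a ha).add ?_
    rw [← tendsto_add_atTop_iff_nat 1]
    refine (T_tendsto a ha).congr fun n => ?_
    congr 1; push_cast; ring
  simp_rw [h3] at h2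
  have := tendsto_nhds_unique h2 h4
  rw [this] at h1
  norm_num at h1
  exact h1

lemma hasSum_T (a : ℝ) (ha : 0 < a) (m : ℤ) : HasSum (fun k => T a k - T a (k - m)) (2 * m) := by
  have key : ∀ m : ℤ, HasSum (fun k => T a (k - m) - T a (k - m - 1)) 2 := by
    intro m
    exact (Equiv.subRight m).hasSum_iff.2 (hasSum_d a ha)
  induction m using Int.induction_on with
  | zero => simp [hasSum_zero]
  | succ i ih =>
    refine hasSum_of_eq (ih.add (key i)) (fun k => ?_) ?_
    · rw [show k - ((i:ℤ) + 1) = k - i - 1 by ring]; ring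
    · push_cast; ring
  | pred i ih =>
    refine hasSum_of_eq (ih.sub (key (-i - 1))) (fun k => ?_) ?_
    · rw [show k - (-(i:ℤ) - 1) - 1 = k - -i by ring]; ring
    · push_cast; ring

/-- coefficients of the square. -/
noncomputable def b (a : ℝ) (m : ℤ) : ℝ := ∑' k : ℤ, A a k * A a (m - 1 - k)

lemma b_eq (a : ℝ) (ha : 0 < a) (m : ℤ) : b a m * Real.sinh (2 * m * a) = 2 * m := by
  unfold b
  rw [← tsum_mul_right]
  refine Eq.trans ?_ (hasSum_T a ha m).tsum_eq
  exact tsum_congr fun k => A_mul a k m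

lemma bA (a : ℝ) (ha : 0 < a) (m l : ℤ) :
    b a m * A a (l - m) / A a l - b a m * A a (l - 1 - m) / A a (l - 1) = 2 * m * d a (l - m) := by
  have c1 := (Real.cosh_pos ((2 * l + 1) * a)).ne'
  have c2 := (Real.cosh_pos ((2 * ((l - m : ℤ):ℝ) + 1) * a)).ne'
  have c3 := (Real.cosh_pos ((2 * ((l - 1 : ℤ):ℝ) + 1) * a)).ne'
  have c4 := (Real.cosh_pos ((2 * ((l - 1 - m : ℤ):ℝ) + 1) * a)).ne'
  rw [← b_eq a ha m]
  unfold d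
  rw [show l - m - 1 = l - 1 - m by ring]
  have e1 : A a (l - m) / A a l = Real.cosh (2 * m * a) + T a (l - m) * Real.sinh (2 * m * a) := by
    unfold A T
    have : (2 * l + 1) * a = (2 * m * a) + (2 * ((l - m : ℤ):ℝ) + 1) * a := by push_cast; ring
    rw [this, Real.cosh_add] at *
    field_simp
  have e2 : A a (l - 1 - m) / A a (l - 1) = Real.cosh (2 * m * a) + T a (l - 1 - m) * Real.sinh (2 * m * a) := by
    unfold A T
    have : (2 * ((l - 1 : ℤ) : ℝ) + 1) * a = (2 * m * a) + (2 * ((l - 1 - m : ℤ):ℝ) + 1) * a := by push_cast; ring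
    rw [this, Real.cosh_add] at *
    field_simp
  rw [mul_div_assoc, mul_div_assoc, e1, e2]
  ring

lemma hasSum_kd (a : ℝ) (ha : 0 < a) : HasSum (fun k : ℤ => (k : ℝ) * d a k) 0 := by
  have h1 := (summable_kd1 a ha).hasSum
  have h2 := (Equiv.neg ℤ).hasSum_iff.2 h1
  have h3 : HasSum (fun k : ℤ => (k : ℝ) * d a k) (-(∑' k : ℤ, (k : ℝ) * d a k)) := by
    refine hasSum_of_eq h2.neg (fun k => ?_) rfl
    simp [d_neg]
  have := h1.unique h3
  have h0 : ∑' k : ℤ, (k : ℝ) * d a k = 0 := by linarith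
  rwa [h0] at h1

lemma hasSum_md (a : ℝ) (ha : 0 < a) (l : ℤ) :
    HasSum (fun m : ℤ => 2 * (m:ℝ) * d a (l - m)) (4 * l) := by
  have h1 := ((hasSum_d a ha).mul_left (2 * (l:ℝ))).sub ((hasSum_kd a ha).mul_left 2)
  have h2 := (Equiv.subLeft l).hasSum_iff.2 h1
  refine hasSum_of_eq h2 (fun m => ?_) ?_
  · simp; ring
  · ring

/-- coefficients of the cube. -/
noncomputable def C (a : ℝ) (l : ℤ) : ℝ := ∑' m : ℤ, b a m * A a (l - m)

noncomputable def mu (a : ℝ) : ℝ := 2 * (C a 0 / A a 0) - 1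

lemma C_eq (a : ℝ) (ha : 0 < a) (hs : ∀ l, Summable (fun m : ℤ => b a m * A a (l - m))) (l : ℤ) :
    C a l = ((2 * l + 1) ^ 2 + mu a) / 2 * A a l := by
  have step : ∀ l : ℤ, C a l / A a l - C a (l - 1) / A a (l - 1) = 4 * l := by
    intro l
    have h1 := ((hs l).hasSum.div_const (A a l)).sub ((hs (l-1)).hasSum.div_const (A a (l - 1)))
    exact h1.unique ((hasSum_md a ha l).congr_fun fun m => bA a ha m l)
  have h : ∀ l : ℤ, C a l / A a l = ((2 * l + 1) ^ 2 + mu a) / 2 := by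
    intro l
    induction l using Int.induction_on with
    | zero => simp [mu]
    | succ i ih =>
      have := step (i + 1)
      rw [show (i:ℤ) + 1 - 1 = i by ring, ih] at this
      push_cast at this ⊢
      linarith
    | pred i ih =>
      have := step (-i)
      rw [ih] at this
      push_cast at this ⊢
      linarith
  rw [← h l]
  have := (A_pos a l).ne'
  field_simp

end SQ

namespace SQ

/-- general term of the Fourier series of the `p`-th derivative of `cn`. -/
noncomputable def tm (a : ℝ) (p : ℤ) (k : ℤ) (w : ℂ) : ℂ :=
  (Complex.I * (2 * k + 1)) ^ p * (A a k : ℂ) * Complex.exp (Complex.I * (2 * k + 1) * w)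

noncomputable def D (a : ℝ) (p : ℤ) (w : ℂ) : ℂ := ∑' k : ℤ, tm a p k w

lemma odd_ne (k : ℤ) : (Complex.I * (2 * k + 1) : ℂ) ≠ 0 := by
  refine mul_ne_zero Complex.I_ne_zero ?_
  have : (2 * k + 1 : ℤ) ≠ 0 := by omega
  exact_mod_cast this

lemma tm_norm (a : ℝ) (p k : ℤ) (w : ℂ) :
    ‖tm a p k w‖ = |(2 * k + 1 : ℝ)| ^ p * A a k * Real.exp (-(2 * k + 1) * w.im) := by
  unfold tm
  rw [norm_mul, norm_mul, norm_zpow, norm_mul, Complex.norm_I, one_mul, Complex.norm_exp,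
    Complex.norm_real, Real.norm_eq_abs, abs_of_pos (A_pos a k)]
  have h1 : ‖(2 * k + 1 : ℂ)‖ = |(2 * k + 1 : ℝ)| := by
    rw [← Real.norm_eq_abs, ← Complex.norm_real]; push_cast; rfl
  rw [h1]
  congr 2
  have : (Complex.I * (2 * k + 1) * w) = Complex.I * (((2 * k + 1 : ℝ) : ℂ) * w) := by push_cast; ring
  rw [this]
  simp
  ring

lemma tm_bound (a : ℝ) (ha : 0 < a) (p k : ℤ) (hp : p ≤ 2) (r : ℝ) (w : ℂ) (hw : |w.im| ≤ r) :
    ‖tm a p k w‖ ≤ 2 * ((2 * k + 1 : ℝ) ^ 2 * Real.exp (-(a - r) * |(2 * k + 1 : ℝ)|)) := by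
  rw [tm_norm]
  have h1 : |(2 * k + 1 : ℝ)| ^ p ≤ (2 * k + 1 : ℝ) ^ 2 := by
    rw [← sq_abs]
    have := zpow_le_zpow_right₀ (one_le_odd k) hp
    exact_mod_cast this
  have h2 := A_le a ha k
  have h3 : Real.exp (-(2 * k + 1) * w.im) ≤ Real.exp (r * |(2 * k + 1 : ℝ)|) := by
    apply Real.exp_le_exp.2
    calc -(2 * k + 1) * w.im ≤ |-(2 * k + 1) * w.im| := le_abs_self _
      _ = |w.im| * |(2 * k + 1 : ℝ)| := by rw [abs_mul, abs_neg, mul_comm]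
      _ ≤ _ := by gcongr
  have h4 : Real.exp (-(a - r) * |(2 * k + 1 : ℝ)|) =
      Real.exp (-a * |(2 * k + 1 : ℝ)|) * Real.exp (r * |(2 * k + 1 : ℝ)|) := by
    rw [← Real.exp_add]; congr 1; ring
  rw [h4]
  have := A_pos a k
  calc _ ≤ (2 * k + 1 : ℝ) ^ 2 * (2 * Real.exp (-a * |(2 * k + 1 : ℝ)|)) *
        Real.exp (r * |(2 * k + 1 : ℝ)|) := by gcongr
    _ = _ := by ring

lemma exists_r (a : ℝ) (w : ℂ) (hw : |w.im| < a) : ∃ r, |w.im| < r ∧ r < a := exists_between hw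

lemma tm_summable (a : ℝ) (ha : 0 < a) (p : ℤ) (hp : p ≤ 2) (w : ℂ) (hw : |w.im| < a) :
    Summable (fun k => ‖tm a p k w‖) := by
  refine Summable.of_nonneg_of_le (fun k => norm_nonneg _)
    (fun k => tm_bound a ha p k hp |w.im| w le_rfl) ?_
  exact (summable_base _ (by linarith)).mul_left 2

lemma tm_deriv (a : ℝ) (p k : ℤ) (w : ℂ) : HasDerivAt (tm a p k) (tm a (p + 1) k w) w := by
  unfold tm
  have h1 : HasDerivAt (fun w : ℂ => Complex.I * (2 * k + 1) * w) (Complex.I * (2 * k + 1)) w := by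
    simpa using (hasDerivAt_id w).const_mul (Complex.I * (2 * k + 1) : ℂ)
  have := (h1.cexp).const_mul ((Complex.I * (2 * k + 1)) ^ p * (A a k : ℂ))
  refine this.congr_deriv ?_
  rw [zpow_add_one₀ (odd_ne k)]; ring

lemma isOpen_strip (r : ℝ) : IsOpen {w : ℂ | |w.im| < r} :=
  isOpen_lt (by fun_prop) (by fun_prop)

lemma D_deriv (a : ℝ) (ha : 0 < a) (p : ℤ) (hp : p ≤ 2) (w : ℂ) (hw : |w.im| < a) :
    HasDerivAt (D a p) (D a (p + 1) w) w := by
  obtain ⟨r, hr1, hr2⟩ := exists_r a w hw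
  have hu := (summable_base (a - r) (by linarith)).mul_left 2
  have hU := isOpen_strip r
  have hf : ∀ k : ℤ, DifferentiableOn ℂ (tm a p k) {w : ℂ | |w.im| < r} :=
    fun k z _ => (tm_deriv a p k z).differentiableAt.differentiableWithinAt
  have hb : ∀ (k : ℤ) (z : ℂ), z ∈ {w : ℂ | |w.im| < r} → ‖tm a p k z‖ ≤
      2 * ((2 * k + 1 : ℝ) ^ 2 * Real.exp (-(a - r) * |(2 * k + 1 : ℝ)|)) :=
    fun k z hz => tm_bound a ha p k hp r z (le_of_lt hz)
  have h1 := Complex.hasSum_deriv_of_summable_norm hu hf hU hb hr1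
  have h2 := (Complex.differentiableOn_tsum_of_summable_norm hu hf hU hb).differentiableAt
    (hU.mem_nhds hr1)
  have h3 : deriv (fun w => ∑' k, tm a p k w) w = D a (p + 1) w := by
    rw [← h1.tsum_eq]
    unfold D
    exact tsum_congr fun k => (tm_deriv a p k w).deriv
  rw [← h3]
  exact h2.hasDerivAt

lemma conv {f g : ℤ → ℂ} (hf : Summable fun k => ‖f k‖) (hg : Summable fun k => ‖g k‖) :
    (∀ m, Summable fun k => f k * g (m - k)) ∧
    (Summable fun m => ‖∑' k, f k * g (m - k)‖) ∧
    HasSum (fun m => ∑' k, f k * g (m - k)) ((∑' k, f k) * ∑' k, g k) := by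
  let e : ℤ × ℤ ≃ ℤ × ℤ :=
    { toFun := fun x => (x.2, x.1 - x.2)
      invFun := fun x => (x.1 + x.2, x.1)
      left_inv := fun x => by ext <;> simp
      right_inv := fun x => by ext <;> simp }
  have h1 : Summable fun x : ℤ × ℤ => ‖f x.1 * g x.2‖ := hf.mul_norm hg
  have h2 : Summable fun x : ℤ × ℤ => ‖f x.2 * g (x.1 - x.2)‖ := e.summable_iff.2 h1
  have h3 : HasSum (fun x : ℤ × ℤ => f x.1 * g x.2) ((∑' k, f k) * ∑' k, g k) := by
    rw [tsum_mul_tsum_of_summable_norm hf hg]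
    exact h1.of_norm.hasSum
  have h4 : HasSum (fun x : ℤ × ℤ => f x.2 * g (x.1 - x.2)) ((∑' k, f k) * ∑' k, g k) :=
    e.hasSum_iff.2 h3
  have h5 : ∀ m, Summable fun k => ‖f k * g (m - k)‖ := fun m => h2.prod_factor m
  refine ⟨fun m => (h5 m).of_norm, ?_, h4.prod_fiberwise fun m => (h5 m).of_norm.hasSum⟩
  refine Summable.of_nonneg_of_le (fun m => norm_nonneg _)
    (fun m => norm_tsum_le_tsum_norm (h5 m)) ?_
  exact h2.prod

/-- Fourier terms of the square. -/
noncomputable def sqt (a : ℝ) (w : ℂ) (m : ℤ) : ℂ := (b a m : ℂ) * Complex.exp (Complex.I * (2 * m) * w)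

lemma sq_conv (a : ℝ) (w : ℂ) (m : ℤ) :
    ∑' k, tm a 0 k w * tm a 0 (m - k) w = sqt a w (m + 1) := by
  unfold sqt b
  rw [Complex.ofReal_tsum, ← tsum_mul_right]
  refine tsum_congr fun k => ?_
  unfold tm
  have : Complex.exp (Complex.I * (2 * ((m + 1 : ℤ) : ℂ)) * w) =
    Complex.exp (Complex.I * (2 * k + 1) * w) * Complex.exp (Complex.I * (2 * ((m - k : ℤ):ℂ) + 1) * w) := by
    rw [← Complex.exp_add]; congr 1; push_cast; ring
  rw [this, show m + 1 - 1 - k = m - k by ring]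
  push_cast
  simp only [zpow_zero]
  ring

lemma sq_sum (a : ℝ) (ha : 0 < a) (w : ℂ) (hw : |w.im| < a) :
    (Summable fun m => ‖sqt a w m‖) ∧ ∑' m, sqt a w m = D a 0 w ^ 2 := by
  have hs := tm_summable a ha 0 (by norm_num) w hw
  obtain ⟨-, h2, h3⟩ := conv hs hs
  simp only [sq_conv] at h2 h3
  constructor
  · exact (Equiv.summable_iff (f := fun m => ‖sqt a w m‖) (Equiv.addRight (1:ℤ))).1 h2
  · rw [sq]
    exact ((Equiv.hasSum_iff (f := sqt a w) (Equiv.addRight (1:ℤ))).1 h3).tsum_eq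

lemma bA_term (a : ℝ) (w : ℂ) (l m : ℤ) : sqt a w m * tm a 0 (l - m) w =
    ((b a m * A a (l - m) : ℝ) : ℂ) * Complex.exp (Complex.I * (2 * l + 1) * w) := by
  unfold sqt tm
  have : Complex.exp (Complex.I * (2 * l + 1) * w) =
    Complex.exp (Complex.I * (2 * m) * w) * Complex.exp (Complex.I * (2 * ((l - m : ℤ):ℂ) + 1) * w) := by
    rw [← Complex.exp_add]; congr 1; push_cast; ring
  rw [this]
  push_cast
  simp only [zpow_zero]
  ring

lemma bA_summable (a : ℝ) (ha : 0 < a) (l : ℤ) : Summable (fun m : ℤ => b a m * A a (l - m)) := by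
  have hw : |(0:ℂ).im| < a := by simpa using ha
  have hs := tm_summable a ha 0 (by norm_num) 0 hw
  have h1 := (conv (sq_sum a ha 0 hw).1 hs).1 l
  simp only [bA_term] at h1
  simp only [mul_zero, Complex.exp_zero, mul_one] at h1
  exact_mod_cast h1

lemma ode (a : ℝ) (ha : 0 < a) (w : ℂ) (hw : |w.im| < a) :
    D a 2 w = -2 * D a 0 w ^ 3 + mu a * D a 0 w := by
  have hs := tm_summable a ha 0 (by norm_num) w hw
  have hs2 := tm_summable a ha 2 (by norm_num) w hw
  obtain ⟨h1, h2⟩ := sq_sum a ha w hw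
  have h3 := (conv h1 hs).2.2
  have h4 : ∀ l : ℤ, ∑' m, sqt a w m * tm a 0 (l - m) w =
      (-1/2 : ℂ) * tm a 2 l w + (mu a / 2 : ℂ) * tm a 0 l w := by
    intro l
    simp only [bA_term]
    rw [tsum_mul_right, ← Complex.ofReal_tsum]
    change ((C a l : ℝ) : ℂ) * _ = _
    rw [C_eq a ha (bA_summable a ha) l]
    unfold tm
    have : (Complex.I * (2 * (l:ℂ) + 1)) ^ (2:ℤ) = - (2 * l + 1) ^ 2 := by
      rw [show (2:ℤ) = ((2:ℕ):ℤ) by rfl, zpow_natCast, mul_pow, Complex.I_sq]; ring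
    rw [this]
    push_cast
    simp only [zpow_zero]
    ring
  simp only [h4] at h3
  have h5 := (hs2.of_norm.hasSum.mul_left (-1/2 : ℂ)).add (hs.of_norm.hasSum.mul_left (mu a / 2 : ℂ))
  have h6 := h3.unique h5
  rw [h2] at h6
  change D a 0 w ^ 2 * D a 0 w = (-1/2) * D a 2 w + (mu a / 2) * D a 0 w at h6
  linear_combination 2 * h6

lemma convex_strip (r : ℝ) : Convex ℝ {w : ℂ | |w.im| < r} := by
  have : {w : ℂ | |w.im| < r} = Complex.imLm ⁻¹' (Ioo (-r) r) := by
    ext w; simp [abs_lt]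
  rw [this]
  exact (convex_Ioo _ _).linear_preimage _

lemma tm_neg (a : ℝ) (p k : ℤ) : tm a p (-k - 1) 0 = (-1) ^ p * tm a p k 0 := by
  unfold tm
  rw [A_symm, ← mul_assoc, ← mul_assoc, ← mul_zpow]
  simp only [mul_zero]
  congr 3
  push_cast; ring

lemma D_odd_zero (a : ℝ) (p : ℤ) (hp : Odd p) : D a p 0 = 0 := by
  let e : ℤ ≃ ℤ := ⟨fun k => -k - 1, fun k => -k - 1, fun k => by simp, fun k => by simp⟩
  have h1 : D a p 0 = - D a p 0 := by
    unfold D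
    rw [← tsum_neg, ← e.tsum_eq]
    refine tsum_congr fun k => ?_
    change tm a p (-k - 1) 0 = _
    rw [tm_neg, hp.neg_one_zpow]; ring
  have : 2 * D a p 0 = 0 := by linear_combination h1
  simpa using this

/-- The energy constant. -/
noncomputable def lam (a : ℝ) : ℝ := (∑' k, A a k) ^ 2 - mu a / 2

lemma D0_zero (a : ℝ) : D a 0 0 = ((∑' k, A a k : ℝ) : ℂ) := by
  unfold D
  rw [Complex.ofReal_tsum]
  exact tsum_congr fun k => by simp [tm]

lemma D2_zero (a : ℝ) : D a 2 0 = ((-∑' k : ℤ, (2 * k + 1 : ℝ) ^ 2 * A a k : ℝ) : ℂ) := by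
  unfold D
  rw [← tsum_neg, Complex.ofReal_tsum]
  refine tsum_congr fun k => ?_
  unfold tm
  have : (Complex.I * (2 * (k:ℂ) + 1)) ^ (2:ℤ) = - (2 * k + 1) ^ 2 := by
    rw [show (2:ℤ) = ((2:ℕ):ℤ) by rfl, zpow_natCast, mul_pow, Complex.I_sq]; ring
  rw [this]
  simp

lemma lam_nonneg (a : ℝ) (ha : 0 < a) : 0 ≤ lam a := by
  have h1 := ode a ha 0 (by simpa using ha)
  rw [D0_zero, D2_zero] at h1
  have h2 : (-∑' k : ℤ, (2 * k + 1 : ℝ) ^ 2 * A a k) =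
    -2 * (∑' k, A a k) ^ 3 + mu a * (∑' k, A a k) := by exact_mod_cast h1
  have h3 : 0 ≤ ∑' k : ℤ, (2 * k + 1 : ℝ) ^ 2 * A a k :=
    tsum_nonneg fun k => mul_nonneg (sq_nonneg _) (A_pos a k).le
  have h4 : 0 < ∑' k, A a k := (summable_A a ha).tsum_pos (fun k => (A_pos a k).le) 0 (A_pos a 0)
  have h5 : 0 ≤ (∑' k, A a k) * lam a := by unfold lam; nlinarith
  exact nonneg_of_mul_nonneg_right h5 h4

lemma energy (a : ℝ) (ha : 0 < a) (s : ℂ) (hs : s ^ 2 = -1) (w : ℂ) (hw : |w.im| < a) :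
    D a 0 w ^ 2 - mu a / 2 - s * D a 1 w = lam a * Complex.exp (2 * s * D a (-1) w) := by
  let E : ℂ → ℂ := fun w => (D a 0 w ^ 2 - mu a / 2 - s * D a 1 w) * Complex.exp (-(2 * s) * D a (-1) w)
  have hE : ∀ z : ℂ, |z.im| < a → HasDerivAt E 0 z := by
    intro z hz
    have d0 := D_deriv a ha (-1) (by norm_num) z hz
    have d1 := D_deriv a ha 0 (by norm_num) z hz
    have d2 := D_deriv a ha 1 (by norm_num) z hz
    norm_num at d0 d1 d2
    have := (((d1.pow 2).sub_const (mu a / 2 : ℂ)).sub (d2.const_mul s)).mul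
      ((d0.const_mul (-(2 * s))).cexp)
    refine this.congr_deriv ?_
    rw [ode a ha z hz]
    simp only [Pi.pow_apply, Pi.sub_apply]
    push_cast
    linear_combination (2 * D a 0 z * D a 1 z * Complex.exp (-(2 * s) * D a (-1) z)) * hs
  have h0 : |(0:ℂ).im| < a := by simpa using ha
  have hc := (isOpen_strip a).is_const_of_deriv_eq_zero (convex_strip a).isPreconnected
    (f := E) (fun z hz => (hE z hz).differentiableAt.differentiableWithinAt)
    (fun z hz => (hE z hz).deriv) hw h0
  have hz : E 0 = lam a := by
    simp only [E]
    rw [D_odd_zero a 1 (by decide), D_odd_zero a (-1) (by decide), D0_zero]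
    simp [lam]
  rw [hz] at hc
  rw [← hc]
  simp only [E]
  rw [mul_assoc, ← Complex.exp_add]
  simp

/-- The key identity. -/
lemma key_identity (a : ℝ) (ha : 0 < a) (w : ℂ) (hw : |w.im| < a) :
    (D a (-1) w).re * (D a 1 w).im - (D a 0 w).re * (D a 0 w).im =
      lam a * Real.sinh (2 * (D a (-1) w).im) / 2 *
        (Real.sin (2 * (D a (-1) w).re) - 2 * (D a (-1) w).re * Real.cos (2 * (D a (-1) w).re)) := by
  have h1 := energy a ha Complex.I Complex.I_sq w hw
  have h2 := energy a ha (-Complex.I) (by simp) w hw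
  generalize D a (-1) w = om at *
  obtain ⟨al, be⟩ := om
  set y := D a 0 w
  set y1 := D a 1 w
  have e1 : Complex.exp (2 * Complex.I * ⟨al, be⟩) = Real.exp (-2 * be) * (Real.cos (2 * al) + Real.sin (2 * al) * Complex.I) := by
    have : (2 * Complex.I * (⟨al, be⟩ : ℂ)) = ((-2 * be : ℝ) : ℂ) + ((2 * al : ℝ) : ℂ) * Complex.I := by
      apply Complex.ext <;> simp
    rw [this, Complex.exp_add, Complex.exp_mul_I]
    push_cast; ring
  have e2 : Complex.exp (2 * -Complex.I * ⟨al, be⟩) = Real.exp (2 * be) * (Real.cos (2 * al) - Real.sin (2 * al) * Complex.I) := by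
    have : (2 * -Complex.I * (⟨al, be⟩ : ℂ)) = ((2 * be : ℝ) : ℂ) + ((-(2 * al) : ℝ) : ℂ) * Complex.I := by
      apply Complex.ext <;> simp
    rw [this, Complex.exp_add, Complex.exp_mul_I]
    push_cast
    rw [Complex.cos_neg, Complex.sin_neg]; ring
  rw [e1] at h1
  rw [e2] at h2
  have r1 := congrArg Complex.re h1
  have i1 := congrArg Complex.im h1
  have r2 := congrArg Complex.re h2
  have i2 := congrArg Complex.im h2
  simp [sq, -Complex.ofReal_exp, -Complex.ofReal_cos, -Complex.ofReal_sin] at r1 i1 r2 i2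
  have hsh : Real.sinh (2 * be) = (Real.exp (2 * be) - Real.exp (-(2 * be))) / 2 := Real.sinh_eq _
  rw [hsh]
  simp only
  linear_combination (al / 2) * r1 - (al / 2) * r2 - (1 / 4) * i1 - (1 / 4) * i2

end SQ

namespace SQ

lemma tm_re_neg (a x t : ℝ) (k : ℤ) : (tm a (-1) k (x + Complex.I * t)).re =
    Real.exp (-((2 * k + 1) * t)) * Real.sin ((2 * k + 1) * x) / (2 * k + 1) * A a k ∧
    (tm a (-1) k (x + Complex.I * t)).im =
    -(Real.exp (-((2 * k + 1) * t)) * Real.cos ((2 * k + 1) * x) / (2 * k + 1) * A a k) ∧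
    (tm a 0 k (x + Complex.I * t)).re =
    Real.exp (-((2 * k + 1) * t)) * Real.cos ((2 * k + 1) * x) * A a k := by
  have hn : (2 * k + 1 : ℝ) ≠ 0 := by
    have : (2 * k + 1 : ℤ) ≠ 0 := by omega
    exact_mod_cast this
  have e1 : Complex.exp (Complex.I * (2 * k + 1) * (x + Complex.I * t)) =
      ⟨Real.exp (-((2 * k + 1) * t)) * Real.cos ((2 * k + 1) * x),
       Real.exp (-((2 * k + 1) * t)) * Real.sin ((2 * k + 1) * x)⟩ := by
    have : Complex.I * (2 * k + 1) * (x + Complex.I * t) =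
        ((-((2 * k + 1) * t) : ℝ) : ℂ) + (((2 * k + 1) * x : ℝ) : ℂ) * Complex.I := by
      push_cast
      linear_combination (2 * k + 1) * t * Complex.I_sq
    rw [this, Complex.exp_add, Complex.exp_mul_I, ← Complex.ofReal_exp, ← Complex.ofReal_cos,
      ← Complex.ofReal_sin]
    apply Complex.ext <;> simp [-Complex.ofReal_exp, -Complex.ofReal_cos, -Complex.ofReal_sin]
  have e2 : ((Complex.I * (2 * k + 1) : ℂ)) ^ (-1 : ℤ) = ⟨0, -(1 / (2 * k + 1))⟩ := by
    rw [zpow_neg_one]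
    apply inv_eq_of_mul_eq_one_right
    have : (2 * k + 1 : ℂ) = ((2 * k + 1 : ℝ) : ℂ) := by push_cast; rfl
    rw [this]
    apply Complex.ext
    · simp; field_simp
    · simp
  unfold tm
  rw [e1, e2]
  refine ⟨?_, ?_, ?_⟩
  · simp; ring
  · simp; ring
  · simp; ring

lemma W_im (x t : ℝ) : ((x : ℂ) + Complex.I * t).im = t := by simp

lemma A_symm' (a : ℝ) (n : ℕ) : A a (-(n + 1)) = A a n := by
  rw [← A_symm]; congr 1; ring

lemma hasSum_re_neg (a : ℝ) (ha : 0 < a) (x t : ℝ) (ht : |t| < a) :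
    HasSum (fun n : ℕ => 2 * Real.sin ((2 * n + 1) * x) / (2 * n + 1) * (Real.cosh ((2 * n + 1) * t) * A a n))
      (D a (-1) (x + Complex.I * t)).re := by
  have h1 := (tm_summable a ha (-1) (by norm_num) (x + Complex.I * t) (by rwa [W_im])).of_norm.hasSum
  have h2 := (Complex.hasSum_re h1).nat_add_neg_add_one
  refine hasSum_of_eq h2 (fun n => ?_) rfl
  rw [(tm_re_neg a x t _).1, (tm_re_neg a x t _).1, A_symm']
  have e : (2 * ((-((n:ℤ) + 1) : ℤ) : ℝ) + 1) = -(2 * n + 1) := by push_cast; ring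
  rw [e, Real.cosh_eq, neg_mul (2 * (n:ℝ) + 1) x, Real.sin_neg]
  have : (2 * (n:ℝ) + 1) ≠ 0 := by positivity
  push_cast
  rw [show -(-(2 * (n:ℝ) + 1) * t) = (2 * n + 1) * t by ring]
  field_simp
  ring

lemma hasSum_re_zero (a : ℝ) (ha : 0 < a) (x t : ℝ) (ht : |t| < a) :
    HasSum (fun n : ℕ => 2 * Real.cos ((2 * n + 1) * x) * (Real.cosh ((2 * n + 1) * t) * A a n))
      (D a 0 (x + Complex.I * t)).re := by
  have h1 := (tm_summable a ha 0 (by norm_num) (x + Complex.I * t) (by rwa [W_im])).of_norm.hasSum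
  have h2 := (Complex.hasSum_re h1).nat_add_neg_add_one
  refine hasSum_of_eq h2 (fun n => ?_) rfl
  rw [(tm_re_neg a x t _).2.2, (tm_re_neg a x t _).2.2, A_symm']
  have e : (2 * ((-((n:ℤ) + 1) : ℤ) : ℝ) + 1) = -(2 * n + 1) := by push_cast; ring
  rw [e, Real.cosh_eq, neg_mul (2 * (n:ℝ) + 1) x, Real.cos_neg]
  push_cast
  rw [show -(-(2 * (n:ℝ) + 1) * t) = (2 * n + 1) * t by ring]
  ring

lemma im_real (a : ℝ) (ha : 0 < a) (x : ℝ) : (D a (-1) (x + Complex.I * (0:ℝ))).im = 0 := by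
  have h1 := (tm_summable a ha (-1) (by norm_num) (x + Complex.I * (0:ℝ))
    (by rw [W_im]; simpa using ha)).of_norm.hasSum
  have h2 := (Complex.hasSum_im h1).nat_add_neg_add_one
  refine h2.unique (hasSum_of_eq hasSum_zero (fun n => ?_) rfl)
  rw [(tm_re_neg a x 0 _).2.1, (tm_re_neg a x 0 _).2.1, A_symm']
  have e : (2 * ((-((n:ℤ) + 1) : ℤ) : ℝ) + 1) = -(2 * n + 1) := by push_cast; ring
  rw [e, neg_mul (2 * (n:ℝ) + 1) x, Real.cos_neg]
  push_cast
  simp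
  have : (2 * (n:ℝ) + 1) ≠ 0 := by positivity
  rw [show (-1 + -(2 * (n:ℝ))) = -(2 * n + 1) by ring]
  field_simp
  ring

lemma FG (n y : ℝ) (hn : 0 < n) :
    F n y - coth (n * π) * G n y = Real.cosh (n * (π / 2 - y)) / Real.cosh (n * (π / 2)) := by
  unfold F G coth
  have e1 : n * y = n * (π / 2) - n * (π / 2 - y) := by ring
  have e2 : n * (π - y) = n * (π / 2) + n * (π / 2 - y) := by ring
  have e3 : n * π = n * (π / 2) + n * (π / 2) := by ring
  rw [e1, e2, e3]
  set p := n * (π / 2) with hp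
  have pp : 0 < p := by positivity
  generalize n * (π / 2 - y) = q
  have c := Real.cosh_pos p
  have s : 0 < Real.sinh p := Real.sinh_pos_iff.2 pp
  have hcs := Real.cosh_sq p
  rw [Real.cosh_sub, Real.cosh_add, Real.sinh_sub, Real.sinh_add, Real.sinh_add, Real.cosh_add]
  have : Real.sinh p * Real.cosh p + Real.cosh p * Real.sinh p ≠ 0 := by positivity
  rw [show Real.sinh p * Real.cosh p + Real.cosh p * Real.sinh p = 2 * (Real.sinh p * Real.cosh p) by ring]
  field_simp
  ring_nf
  rw [show Real.cosh p ^ 2 = Real.sinh p ^ 2 + 1 from hcs]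
  ring

lemma h_eq (x y : ℝ) (hy : y ∈ Ioo 0 π) :
    h x y = (2 / π) * (D (π / 2) (-1) (x + Complex.I * ((π / 2 - y : ℝ) : ℂ))).re := by
  have ha : 0 < π / 2 := by positivity
  have ht : |π / 2 - y| < π / 2 := by
    rw [abs_lt]; constructor <;> linarith [hy.1, hy.2]
  rw [← (hasSum_re_neg (π / 2) ha x _ ht).tsum_eq]
  unfold h
  rw [← tsum_mul_left, ← tsum_mul_left]
  refine tsum_congr fun n => ?_
  rw [FG _ _ (by positivity)]
  unfold A
  push_cast
  ring

lemma deriv_x (a : ℝ) (ha : 0 < a) (p : ℤ) (hp : p ≤ 2) (x t : ℝ) (ht : |t| < a) :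
    HasDerivAt (fun x' : ℝ => (D a p (x' + Complex.I * t)).re)
      (D a (p + 1) (x + Complex.I * t)).re x := by
  have h1 := D_deriv a ha p hp (x + Complex.I * t) (by rwa [W_im])
  have h2 : HasDerivAt (fun x' : ℝ => (x' : ℂ) + Complex.I * t) 1 x :=
    (Complex.ofRealCLM.hasDerivAt (x := x)).add_const _
  have h3 := h1.scomp x h2
  have h4 := (Complex.reCLM.hasFDerivAt).comp_hasDerivAt x h3
  refine h4.congr_deriv ?_
  simp

lemma deriv_t (a : ℝ) (ha : 0 < a) (p : ℤ) (hp : p ≤ 2) (x t : ℝ) (ht : |t| < a) :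
    HasDerivAt (fun t' : ℝ => D a p (x + Complex.I * t'))
      (Complex.I * D a (p + 1) (x + Complex.I * t)) t := by
  have h1 := D_deriv a ha p hp (x + Complex.I * t) (by rwa [W_im])
  have h2 : HasDerivAt (fun t' : ℝ => (x : ℂ) + Complex.I * t') (Complex.I * 1) t :=
    ((Complex.ofRealCLM.hasDerivAt (x := t)).const_mul Complex.I).const_add _
  have h3 := h1.scomp t h2
  refine h3.congr_deriv ?_
  simp

lemma deriv_y (a : ℝ) (ha : 0 < a) (p : ℤ) (hp : p ≤ 2) (x y c : ℝ) (ht : |c - y| < a) :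
    HasDerivAt (fun y' : ℝ => (D a p (x + Complex.I * ((c - y' : ℝ) : ℂ))).re)
      (D a (p + 1) (x + Complex.I * ((c - y : ℝ) : ℂ))).im y := by
  have h1 := deriv_t a ha p hp x (c - y) ht
  have h2 : HasDerivAt (fun y' : ℝ => c - y') (-1) y := by
    simpa using (hasDerivAt_id y).const_sub c
  have h3 := h1.scomp y h2
  have h4 := (Complex.reCLM.hasFDerivAt).comp_hasDerivAt y h3
  refine h4.congr_deriv ?_
  simp

lemma deriv_im (a : ℝ) (ha : 0 < a) (p : ℤ) (hp : p ≤ 2) (x t : ℝ) (ht : |t| < a) :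
    HasDerivAt (fun t' : ℝ => (D a p (x + Complex.I * t')).im)
      (D a (p + 1) (x + Complex.I * t)).re t := by
  have h1 := deriv_t a ha p hp x t ht
  have h4 := (Complex.imCLM.hasFDerivAt).comp_hasDerivAt t h1
  refine h4.congr_deriv ?_
  simp

lemma abs_lt_of (y : ℝ) (hy : y ∈ Ioo 0 π) : |π / 2 - y| < π / 2 := by
  rw [abs_lt]; constructor <;> linarith [hy.1, hy.2]

lemma hx_eq (x y : ℝ) (hy : y ∈ Ioo 0 π) :
    hx x y = (2 / π) * (D (π / 2) 0 (x + Complex.I * ((π / 2 - y : ℝ) : ℂ))).re := by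
  have ha : 0 < π / 2 := by positivity
  unfold hx
  have : (fun x' => h x' y) = fun x' : ℝ => (2 / π) * (D (π / 2) (-1) (x' + Complex.I * ((π / 2 - y : ℝ) : ℂ))).re :=
    funext fun x' => h_eq x' y hy
  rw [this]
  have := (deriv_x (π / 2) ha (-1) (by norm_num) x _ (abs_lt_of y hy)).const_mul (2 / π)
  exact this.deriv

lemma hy_eq (x y : ℝ) (hy' : y ∈ Ioo 0 π) :
    hy x y = (2 / π) * (D (π / 2) 0 (x + Complex.I * ((π / 2 - y : ℝ) : ℂ))).im := by
  have ha : 0 < π / 2 := by positivity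
  unfold hy
  have e : (fun y' => h x y') =ᶠ[𝓝 y] fun y' => (2 / π) * (D (π / 2) (-1) (x + Complex.I * ((π / 2 - y' : ℝ) : ℂ))).re := by
    filter_upwards [isOpen_Ioo.mem_nhds hy'] with y' h'
    exact h_eq x y' h'
  rw [e.deriv_eq]
  exact ((deriv_y (π / 2) ha (-1) (by norm_num) x y (π / 2) (abs_lt_of y hy')).const_mul (2 / π)).deriv

lemma hxy_eq (x y : ℝ) (hy' : y ∈ Ioo 0 π) :
    hxy x y = (2 / π) * (D (π / 2) 1 (x + Complex.I * ((π / 2 - y : ℝ) : ℂ))).im := by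
  have ha : 0 < π / 2 := by positivity
  unfold hxy
  have e : (fun y' => hx x y') =ᶠ[𝓝 y] fun y' => (2 / π) * (D (π / 2) 0 (x + Complex.I * ((π / 2 - y' : ℝ) : ℂ))).re := by
    filter_upwards [isOpen_Ioo.mem_nhds hy'] with y' h'
    exact hx_eq x y' h'
  rw [e.deriv_eq]
  exact ((deriv_y (π / 2) ha 0 (by norm_num) x y (π / 2) (abs_lt_of y hy')).const_mul (2 / π)).deriv

end SQ

namespace SQ

/-- remainder factor -/
noncomputable def rr (y : ℝ) (k : ℕ) : ℝ :=
  Real.exp (-((2 * k + 1) * (π / 2))) * Real.sinh ((2 * k + 1) * y) / Real.cosh ((2 * k + 1) * (π / 2))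

lemma split (y : ℝ) (k : ℕ) : Real.cosh ((2 * k + 1) * (π / 2 - y)) * A (π / 2) k =
    Real.exp (-((2 * k + 1) * y)) + rr y k := by
  unfold A rr
  push_cast
  rw [mul_sub, Real.cosh_sub, ← Real.cosh_sub_sinh ((2 * (k:ℝ) + 1) * y), ← Real.cosh_sub_sinh ((2 * (k:ℝ) + 1) * (π / 2))]
  have := (Real.cosh_pos ((2 * (k:ℝ) + 1) * (π / 2))).ne'
  field_simp
  ring

lemma cosh_le_exp (u : ℝ) (hu : 0 ≤ u) : Real.cosh u ≤ Real.exp u := by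
  rw [Real.cosh_eq]
  have : Real.exp (-u) ≤ Real.exp u := Real.exp_le_exp.2 (by linarith)
  linarith

lemma sinh_mul_le (y : ℝ) (hy : 0 ≤ y) (n : ℕ) :
    Real.sinh ((n + 1) * y) ≤ (n + 1) * Real.sinh y * Real.exp (n * y) := by
  induction n with
  | zero => simp
  | succ n ih =>
    have e : ((n + 1 : ℕ) + 1 : ℝ) * y = (n + 1) * y + y := by push_cast; ring
    rw [e, Real.sinh_add]
    have h1 := cosh_le_exp y hy
    have h2 := cosh_le_exp ((n + 1) * y) (by positivity)
    have s1 : 0 ≤ Real.sinh y := Real.sinh_nonneg_iff.2 hy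
    have s2 : 0 ≤ Real.sinh ((n + 1) * y) := Real.sinh_nonneg_iff.2 (by positivity)
    have e2 : Real.exp ((n + 1) * y) = Real.exp (n * y) * Real.exp y := by
      rw [← Real.exp_add]; congr 1; ring
    have c1 := Real.cosh_pos y
    calc _ ≤ ((n + 1) * Real.sinh y * Real.exp (n * y)) * Real.exp y + Real.exp ((n + 1) * y) * Real.sinh y := by
          gcongr
      _ = _ := by push_cast; rw [e2]; ring

lemma exp_pi : Real.exp (-π) ≤ 1 / 20 := by
  have h1 : Real.exp (-π) ≤ Real.exp (-3) := Real.exp_le_exp.2 (by linarith [Real.pi_gt_three])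
  have h2 : (20:ℝ) ≤ Real.exp 3 := by
    have : Real.exp 3 = Real.exp 1 ^ 3 := by rw [← Real.exp_nat_mul]; norm_num
    rw [this]
    have := Real.exp_one_gt_d9
    calc (20:ℝ) ≤ 2.7182818283 ^ 3 := by norm_num
      _ ≤ _ := by gcongr
  rw [Real.exp_neg] at h1 ⊢
  calc _ ≤ (Real.exp 3)⁻¹ := by rw [← Real.exp_neg 3, ← Real.exp_neg π]; rw [Real.exp_neg π]; exact h1
    _ ≤ _ := by rw [one_div]; exact inv_anti₀ (by norm_num) h2

lemma sq_le_three (k : ℕ) : (2 * ((k:ℝ) + 1) + 1) ^ 2 ≤ 9 * 3 ^ k := by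
  induction k with
  | zero => norm_num
  | succ n ih =>
    rw [pow_succ (3:ℝ) n]
    push_cast
    have : (0:ℝ) ≤ n := by positivity
    nlinarith

lemma rr_nonneg (y : ℝ) (hy : 0 ≤ y) (k : ℕ) : 0 ≤ rr y k := by
  unfold rr
  have c := Real.cosh_pos ((2 * k + 1) * (π / 2))
  have s : 0 ≤ Real.sinh ((2 * k + 1) * y) := Real.sinh_nonneg_iff.2 (by positivity)
  positivity

lemma rr_tail (y : ℝ) (hy : 0 ≤ y) (hy2 : y ≤ π / 2) (k : ℕ) :
    (2 * ((k + 1 : ℕ) : ℝ) + 1) * rr y (k + 1) ≤ (189 / 400) * (3 / 20) ^ k * rr y 0 := by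
  have s1 : 0 ≤ Real.sinh y := Real.sinh_nonneg_iff.2 hy
  set q := Real.exp (-π) with hq
  have q0 : 0 < q := Real.exp_pos _
  have q1 : q ≤ 1 / 20 := exp_pi
  set E := Real.exp (-(π / 2)) with hE
  have E0 : 0 < E := Real.exp_pos _
  have hEq : E * E = q := by rw [hE, hq, ← Real.exp_add]; congr 1; ring
  -- lower bound
  have h0 : (40 / 21) * q * Real.sinh y ≤ rr y 0 := by
    unfold rr
    simp only [Nat.cast_zero, mul_zero, zero_add, one_mul]
    rw [le_div_iff₀ (Real.cosh_pos _), Real.cosh_eq]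
    have e : Real.exp (π / 2) * E = 1 := by rw [hE, ← Real.exp_add]; simp
    have : (40 / 21) * q * ((Real.exp (π / 2) + E) / 2) ≤ E := by
      have : (40 / 21) * q * ((Real.exp (π / 2) + E) / 2) = (20 / 21) * (E * (1 + q)) := by
        rw [← hEq]; linear_combination (20 / 21) * E * e
      rw [this]; nlinarith
    calc _ = (40 / 21) * q * ((Real.exp (π / 2) + E) / 2) * Real.sinh y := by ring
      _ ≤ E * Real.sinh y := by gcongr
  -- upper bound
  have h1 : rr y (k + 1) ≤ 2 * (2 * ((k:ℝ) + 1) + 1) * Real.sinh y * (q * q ^ (k + 1)) := by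
    unfold rr
    have hs := sinh_mul_le y hy (2 * (k + 1))
    push_cast at hs ⊢
    set n : ℝ := 2 * ((k:ℝ) + 1) + 1 with hn
    have hn0 : 0 < n := by positivity
    have hc : Real.exp (n * (π / 2)) / 2 ≤ Real.cosh (n * (π / 2)) := by
      rw [Real.cosh_eq]; have := Real.exp_pos (-(n * (π / 2))); linarith
    rw [div_le_iff₀ (Real.cosh_pos _)]
    have hx : Real.exp (2 * ((k:ℝ) + 1) * y) ≤ Real.exp (2 * ((k:ℝ) + 1) * (π / 2)) :=
      Real.exp_le_exp.2 (by gcongr)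
    have e1 : Real.exp (-(n * (π / 2))) * Real.exp (2 * ((k:ℝ) + 1) * (π / 2)) = E := by
      rw [← Real.exp_add]; congr 1; rw [hn]; ring
    have e2 : q * q ^ (k + 1) * Real.exp (n * (π / 2)) = E := by
      rw [hq, ← Real.exp_nat_mul, ← Real.exp_add, ← Real.exp_add]; congr 1; rw [hn]; push_cast; ring
    calc _ ≤ Real.exp (-(n * (π / 2))) * (n * Real.sinh y * Real.exp (2 * ((k:ℝ) + 1) * (π / 2))) := by
          gcongr
          exact hs.trans (by gcongr)
      _ = n * Real.sinh y * E := by rw [← e1]; ring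
      _ = 2 * n * Real.sinh y * (q * q ^ (k + 1)) * (Real.exp (n * (π / 2)) / 2) := by rw [← e2]; ring
      _ ≤ _ := by gcongr
  have hqk : q ^ (k + 1) ≤ (1 / 20) ^ (k + 1) := by gcongr
  have h3 := sq_le_three k
  push_cast
  calc _ ≤ (2 * ((k:ℝ) + 1) + 1) * (2 * (2 * ((k:ℝ) + 1) + 1) * Real.sinh y * (q * q ^ (k + 1))) := by
        gcongr
    _ = (2 * ((k:ℝ) + 1) + 1) ^ 2 * (2 * Real.sinh y * q) * q ^ (k + 1) := by ring
    _ ≤ (9 * 3 ^ k) * (2 * Real.sinh y * q) * (1 / 20) ^ (k + 1) := by gcongr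
    _ = (189 / 400) * (3 / 20) ^ k * ((40 / 21) * q * Real.sinh y) := by
        rw [pow_succ, div_pow, div_pow]; field_simp; ring
    _ ≤ _ := by gcongr

lemma rem_nonneg (y : ℝ) (hy : 0 ≤ y) (hy2 : y ≤ π / 2) (u : ℕ → ℝ) (h0 : 0 ≤ u 0)
    (hu : ∀ k : ℕ, |u k| ≤ (2 * k + 1) * u 0) (R : ℝ) (hR : HasSum (fun k => u k * rr y k) R) :
    0 ≤ R := by
  have h1 := (hasSum_nat_add_iff' 1).2 hR
  simp only [Finset.range_one, Finset.sum_singleton] at h1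
  have h2 : HasSum (fun k : ℕ => -(u 0 * rr y 0 * (189 / 400) * (3 / 20 : ℝ) ^ k))
      (-(u 0 * rr y 0 * (189 / 400) * (1 - 3 / 20)⁻¹)) :=
    ((hasSum_geometric_of_lt_one (by norm_num) (by norm_num)).mul_left _).neg
  have h3 := hasSum_le (fun k => ?_) h2 h1
  · have : 0 ≤ u 0 * rr y 0 := mul_nonneg h0 (rr_nonneg y hy 0)
    norm_num at h3
    nlinarith
  · have a1 := rr_tail y hy hy2 k
    have a2 := hu (k + 1)
    have a3 := rr_nonneg y hy (k + 1)
    have a4 := neg_abs_le (u (k + 1))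
    have : -((2 * ((k + 1 : ℕ) : ℝ) + 1) * u 0) * rr y (k + 1) ≤ u (k + 1) * rr y (k + 1) := by
      gcongr; linarith
    have : u 0 * ((2 * ((k + 1 : ℕ) : ℝ) + 1) * rr y (k + 1)) ≤ u 0 * ((189 / 400) * (3 / 20) ^ k * rr y 0) := by
      gcongr
    linarith

lemma abs_trig (x : ℝ) (k : ℕ) : |Real.cos ((2 * k + 1) * x)| ≤ (2 * k + 1) * |Real.cos x| ∧
    |Real.sin ((2 * k + 1) * x)| ≤ (2 * k + 1) * |Real.sin x| := by
  induction k with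
  | zero => simp
  | succ n ih =>
    have e : (2 * ((n + 1 : ℕ):ℝ) + 1) * x = (2 * n + 1) * x + 2 * x := by push_cast; ring
    rw [e, Real.cos_add, Real.sin_add]
    set c := Real.cos ((2 * n + 1) * x)
    set s := Real.sin ((2 * n + 1) * x)
    have h1 : |Real.cos (2 * x)| ≤ 1 := Real.abs_cos_le_one _
    have h2 : |Real.sin (2 * x)| = 2 * |Real.sin x| * |Real.cos x| := by
      rw [Real.sin_two_mul, abs_mul, abs_mul, abs_two]
    have h3 : |Real.sin x| ≤ 1 := Real.abs_sin_le_one _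
    have h4 : |Real.cos x| ≤ 1 := Real.abs_cos_le_one _
    have h5 : |s| ≤ 1 := Real.abs_sin_le_one _
    have h6 : |c| ≤ 1 := Real.abs_cos_le_one _
    push_cast
    constructor
    · calc |c * Real.cos (2 * x) - s * Real.sin (2 * x)| ≤ |c * Real.cos (2 * x)| + |s * Real.sin (2 * x)| := abs_sub _ _
        _ = |c| * |Real.cos (2 * x)| + |s| * (2 * |Real.sin x| * |Real.cos x|) := by rw [abs_mul, abs_mul, h2]
        _ ≤ ((2 * n + 1) * |Real.cos x|) * 1 + 1 * (2 * 1 * |Real.cos x|) := by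
            gcongr; exact ih.1
        _ = _ := by ring
    · calc |s * Real.cos (2 * x) + c * Real.sin (2 * x)| ≤ |s * Real.cos (2 * x)| + |c * Real.sin (2 * x)| := abs_add_le _ _
        _ = |s| * |Real.cos (2 * x)| + |c| * (2 * |Real.sin x| * |Real.cos x|) := by rw [abs_mul, abs_mul, h2]
        _ ≤ ((2 * n + 1) * |Real.sin x|) * 1 + 1 * (2 * |Real.sin x| * 1) := by
            gcongr; exact ih.2
        _ = _ := by ring

lemma rr_le (y : ℝ) (hy2 : y ≤ π / 2) (k : ℕ) : rr y k ≤ Real.exp (-(π / 2)) * Real.exp (-π) ^ k := by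
  unfold rr
  rw [div_le_iff₀ (Real.cosh_pos _)]
  have e : Real.exp (-(π / 2)) * Real.exp (-π) ^ k = Real.exp (-((2 * k + 1) * (π / 2))) := by
    rw [← Real.exp_nat_mul, ← Real.exp_add]; congr 1; ring
  rw [e]
  gcongr
  calc _ ≤ Real.sinh ((2 * k + 1) * (π / 2)) := Real.sinh_le_sinh.2 (by gcongr)
    _ ≤ _ := (Real.sinh_lt_cosh _).le

lemma rem_le (y : ℝ) (hy : 0 ≤ y) (hy2 : y ≤ π / 2) (u : ℕ → ℝ)
    (hu : ∀ k : ℕ, |u k| ≤ 2) (R : ℝ) (hR : HasSum (fun k => u k * rr y k) R) :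
    R ≤ 1 / 2 := by
  set E := Real.exp (-(π / 2)) with hE
  have E0 : 0 < E := Real.exp_pos _
  have q0 : 0 < Real.exp (-π) := Real.exp_pos _
  have hEq : E * E = Real.exp (-π) := by rw [hE, ← Real.exp_add]; congr 1; ring
  have q1 := exp_pi
  have h2 : HasSum (fun k : ℕ => 2 * E * (1 / 20 : ℝ) ^ k) (2 * E * (1 - 1 / 20)⁻¹) :=
    (hasSum_geometric_of_lt_one (by norm_num) (by norm_num)).mul_left _
  have h3 := hasSum_le (fun k => ?_) hR h2
  · norm_num at h3
    nlinarith
  · calc u k * rr y k ≤ 2 * rr y k := by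
          have := rr_nonneg y hy k
          have := le_of_abs_le (hu k)
          gcongr
      _ ≤ 2 * (E * Real.exp (-π) ^ k) := by gcongr; exact rr_le y hy2 k
      _ ≤ 2 * (E * (1 / 20 : ℝ) ^ k) := by gcongr
      _ = _ := by ring

end SQ

namespace SQ

lemma g_nonneg (u : ℝ) (h0 : 0 ≤ u) (h1 : u ≤ π + 1) : 0 ≤ Real.sin u - u * Real.cos u := by
  have hpi := Real.pi_gt_three
  rcases lt_or_ge u (π / 2) with h2 | h2
  · have hc : 0 < Real.cos u := Real.cos_pos_of_mem_Ioo ⟨by linarith, h2⟩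
    have ht := Real.le_tan h0 h2
    rw [Real.tan_eq_sin_div_cos, le_div_iff₀ hc] at ht
    linarith
  · rcases le_or_gt u π with h3 | h3
    · have hc : Real.cos u ≤ 0 := Real.cos_nonpos_of_pi_div_two_le_of_le h2 (by linarith)
      have hs : 0 ≤ Real.sin u := Real.sin_nonneg_of_nonneg_of_le_pi h0 h3
      nlinarith
    · obtain ⟨v, rfl⟩ : ∃ v, u = v + π := ⟨u - π, by ring⟩
      rw [Real.sin_add_pi, Real.cos_add_pi]
      have hv0 : 0 < v := by linarith
      have hv1 : v ≤ 1 := by linarith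
      have hc := Real.one_sub_sq_div_two_le_cos (x := v)
      have hs := Real.sin_le_one v
      have : 1 / 2 ≤ Real.cos v := by nlinarith
      nlinarith

/-- the point `exp (-y + i x)` -/
noncomputable def zz (x y : ℝ) : ℂ := Complex.exp (-y + x * Complex.I)

lemma zz_pow (x y : ℝ) (k : ℕ) : zz x y ^ (2 * k + 1) =
    ⟨Real.exp (-((2 * k + 1) * y)) * Real.cos ((2 * k + 1) * x),
     Real.exp (-((2 * k + 1) * y)) * Real.sin ((2 * k + 1) * x)⟩ := by
  unfold zz
  rw [← Complex.exp_nat_mul]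
  have : ((2 * k + 1 : ℕ) : ℂ) * (-y + x * Complex.I) =
      ((-((2 * k + 1) * y) : ℝ) : ℂ) + (((2 * k + 1) * x : ℝ) : ℂ) * Complex.I := by
    push_cast; ring
  rw [this, Complex.exp_add, Complex.exp_mul_I, ← Complex.ofReal_exp, ← Complex.ofReal_cos,
      ← Complex.ofReal_sin]
  apply Complex.ext <;> simp [-Complex.ofReal_exp, -Complex.ofReal_cos, -Complex.ofReal_sin]

lemma zz_norm (x y : ℝ) (hy : 0 < y) : ‖zz x y‖ < 1 := by
  unfold zz
  rw [Complex.norm_exp]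
  simpa using hy

lemma zz_eq (x y : ℝ) : zz x y = ⟨Real.exp (-y) * Real.cos x, Real.exp (-y) * Real.sin x⟩ := by
  have := zz_pow x y 0
  simpa using this

lemma normSq_lt (x y : ℝ) (hy : 0 < y) : (zz x y).re ^ 2 + (zz x y).im ^ 2 < 1 := by
  have h1 := zz_norm x y hy
  have h2 := Complex.sq_norm (zz x y)
  rw [Complex.normSq_apply] at h2
  have := norm_nonneg (zz x y)
  nlinarith

lemma M0 (x y : ℝ) (hx : x ∈ Icc 0 (π / 2)) (hy : 0 < y) :
    ∃ M : ℝ, 0 ≤ M ∧ HasSum (fun k : ℕ => 2 * Real.cos ((2 * k + 1) * x) * Real.exp (-((2 * k + 1) * y))) M := by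
  set z := zz x y with hz
  have hn : ‖z ^ 2‖ < 1 := by
    rw [norm_pow]; exact pow_lt_one₀ (norm_nonneg _) (zz_norm x y hy) (by norm_num)
  have h1 := (hasSum_geometric_of_norm_lt_one hn).mul_left (2 * z)
  have h2 := Complex.hasSum_re h1
  refine ⟨_, ?_, hasSum_of_eq h2 (fun k => ?_) rfl⟩
  · rw [← div_eq_mul_inv, Complex.div_re, ← add_div]
    apply div_nonneg _ (Complex.normSq_nonneg _)
    have hre : 0 ≤ z.re := by
      rw [hz, zz_eq]
      exact mul_nonneg (Real.exp_pos _).le (Real.cos_nonneg_of_mem_Icc ⟨by linarith [hx.1, Real.pi_pos], hx.2⟩)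
    have hs := normSq_lt x y hy
    rw [← hz] at hs
    simp [pow_two]
    have : 0 ≤ z.re * (1 - (z.re ^ 2 + z.im ^ 2)) := mul_nonneg hre (by linarith)
    nlinarith
  · have e : 2 * z * (z ^ 2) ^ k = 2 * z ^ (2 * k + 1) := by ring
    rw [e, hz, zz_pow]
    simp; ring

lemma arg_bound (z : ℂ) (h0 : 0 < z.im) (h1 : z.re ^ 2 + z.im ^ 2 < 1) :
    0 ≤ Complex.arg (1 + z) - Complex.arg (1 - z) ∧
      Complex.arg (1 + z) - Complex.arg (1 - z) ≤ π / 2 := by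
  have b1 : z.re < 1 := by nlinarith
  have b2 : -1 < z.re := by nlinarith
  have p1 : 0 < (1 + z).re := by simp; linarith
  have p2 : 0 < (1 - z).re := by simp; linarith
  have q1 : 0 < (1 + z).im := by simpa using h0
  have q2 : (1 - z).im < 0 := by simpa using h0
  have a1 : 0 ≤ Complex.arg (1 + z) := Complex.arg_nonneg_iff.2 q1.le
  have a2 : Complex.arg (1 - z) < 0 := Complex.arg_neg_iff.2 q2
  have a3 := (abs_lt.1 (Complex.abs_arg_lt_pi_div_two_iff.2 (Or.inl p1))).2
  have a4 := (abs_lt.1 (Complex.abs_arg_lt_pi_div_two_iff.2 (Or.inl p2))).1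
  refine ⟨by linarith, ?_⟩
  by_contra hcon
  push Not at hcon
  have hc : Real.cos (Complex.arg (1 + z) - Complex.arg (1 - z)) < 0 :=
    Real.cos_neg_of_pi_div_two_lt_of_lt hcon (by linarith)
  have n1 : (1 + z) ≠ 0 := fun h => by rw [h] at p1; simp at p1
  have n2 : (1 - z) ≠ 0 := fun h => by rw [h] at p2; simp at p2
  have m1 : 0 < ‖1 + z‖ := norm_pos_iff.2 n1
  have m2 : 0 < ‖1 - z‖ := norm_pos_iff.2 n2
  rw [Real.cos_sub, Complex.cos_arg n1, Complex.cos_arg n2, Complex.sin_arg, Complex.sin_arg] at hc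
  have e : (1 + z).re / ‖1 + z‖ * ((1 - z).re / ‖1 - z‖) + (1 + z).im / ‖1 + z‖ * ((1 - z).im / ‖1 - z‖)
     = (1 - (z.re ^ 2 + z.im ^ 2)) / (‖1 + z‖ * ‖1 - z‖) := by
    field_simp
    simp; ring
  rw [e] at hc
  have : 0 < (1 - (z.re ^ 2 + z.im ^ 2)) / (‖1 + z‖ * ‖1 - z‖) :=
    div_pos (by linarith) (by positivity)
  linarith

lemma M1 (x y : ℝ) (hx : x ∈ Ioo 0 (π / 2)) (hy : 0 < y) :
    ∃ M : ℝ, 0 ≤ M ∧ M ≤ π / 2 ∧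
      HasSum (fun k : ℕ => 2 * Real.sin ((2 * k + 1) * x) / (2 * k + 1) * Real.exp (-((2 * k + 1) * y))) M := by
  set z := zz x y with hz
  have hn : ‖z‖ < 1 := zz_norm x y hy
  have him : 0 < z.im := by
    rw [hz, zz_eq]
    exact mul_pos (Real.exp_pos _) (Real.sin_pos_of_pos_of_lt_pi hx.1 (by linarith [hx.2, Real.pi_pos]))
  have hab := arg_bound z him (normSq_lt x y hy)
  have h1 := Complex.hasSum_taylorSeries_neg_log hn
  have h2 := Complex.hasSum_taylorSeries_neg_log (z := -z) (by rwa [norm_neg])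
  have h3 := h1.sub h2
  have hinj : Function.Injective (fun k : ℕ => 2 * k + 1) := fun a b hab => by simpa using hab
  have h4 := (hinj.hasSum_iff (f := fun n : ℕ => z ^ n / n - (-z) ^ n / n) (fun n hn => ?_)).2 h3
  · refine ⟨_, hab.1, hab.2, hasSum_of_eq (Complex.hasSum_im h4) (fun k => ?_) ?_⟩
    · have : (2 * (k:ℝ) + 1) ≠ 0 := by positivity
      have hc : (2 * (k:ℂ) + 1) = ((2 * k + 1 : ℝ) : ℂ) := by push_cast; rfl
      simp only [Function.comp_apply]
      rw [Odd.neg_pow ⟨k, rfl⟩, hz, zz_pow]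
      push_cast
      rw [hc, Complex.sub_im, Complex.div_ofReal_im, Complex.div_ofReal_im]
      simp; ring
    · simp [Complex.log_im]
      ring
  · have he : Even n := by
      by_contra ho
      rw [Nat.not_even_iff_odd] at ho
      obtain ⟨m, hm⟩ := ho
      exact hn ⟨m, hm.symm⟩
    rw [he.neg_pow]; simp

lemma alpha_bound (x y : ℝ) (hx : x ∈ Ioo 0 (π / 2)) (hy : y ∈ Ioo 0 (π / 2)) :
    0 ≤ (D (π / 2) (-1) (x + Complex.I * ((π / 2 - y : ℝ) : ℂ))).re ∧
    (D (π / 2) (-1) (x + Complex.I * ((π / 2 - y : ℝ) : ℂ))).re ≤ π / 2 + 1 / 2 := by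
  have ha : 0 < π / 2 := by positivity
  have hs := hasSum_re_neg (π / 2) ha x (π / 2 - y)
    (abs_lt_of y ⟨hy.1, by linarith [hy.2, Real.pi_pos]⟩)
  obtain ⟨M, m1, m2, hM⟩ := M1 x y hx hy.1
  have hR : HasSum (fun k : ℕ => (2 * Real.sin ((2 * k + 1) * x) / (2 * k + 1)) * rr y k)
      ((D (π / 2) (-1) (x + Complex.I * ((π / 2 - y : ℝ) : ℂ))).re - M) := by
    refine hasSum_of_eq (hs.sub hM) (fun k => ?_) rfl
    rw [split]; ring
  have hsin : 0 ≤ Real.sin x :=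
    (Real.sin_pos_of_pos_of_lt_pi hx.1 (by linarith [hx.2, Real.pi_pos])).le
  have r1 := rem_nonneg y hy.1.le hy.2.le _ (by simpa using hsin) (fun k => ?_) _ hR
  have r2 := rem_le y hy.1.le hy.2.le _ (fun k => ?_) _ hR
  · constructor <;> linarith
  · have := Real.abs_sin_le_one ((2 * k + 1) * x)
    have hk : (0:ℝ) < 2 * k + 1 := by positivity
    rw [abs_div, abs_mul, abs_two, abs_of_pos hk, div_le_iff₀ hk]
    have : (0:ℝ) ≤ k := by positivity
    linarith
  · have := (abs_trig x k).2
    have hk : (0:ℝ) < 2 * k + 1 := by positivity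
    rw [abs_div, abs_mul, abs_two, abs_of_pos hk, div_le_iff₀ hk]
    rw [abs_of_nonneg hsin] at this
    simp only [Nat.cast_zero, mul_zero, zero_add, one_mul, div_one]
    have : (0:ℝ) ≤ k := by positivity
    have : 0 ≤ (2 * k + 1) * Real.sin x * k := by positivity
    nlinarith

lemma re_nonneg (x y : ℝ) (hx : x ∈ Icc 0 (π / 2)) (hy : y ∈ Ioc 0 (π / 2)) :
    0 ≤ (D (π / 2) 0 (x + Complex.I * ((π / 2 - y : ℝ) : ℂ))).re := by
  have ha : 0 < π / 2 := by positivity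
  have hs := hasSum_re_zero (π / 2) ha x (π / 2 - y)
    (abs_lt_of y ⟨hy.1, by linarith [hy.2, Real.pi_pos]⟩)
  obtain ⟨M, m1, hM⟩ := M0 x y hx hy.1
  have hR : HasSum (fun k : ℕ => (2 * Real.cos ((2 * k + 1) * x)) * rr y k)
      ((D (π / 2) 0 (x + Complex.I * ((π / 2 - y : ℝ) : ℂ))).re - M) := by
    refine hasSum_of_eq (hs.sub hM) (fun k => ?_) rfl
    rw [split]; ring
  have hcos : 0 ≤ Real.cos x :=
    Real.cos_nonneg_of_mem_Icc ⟨by linarith [hx.1, Real.pi_pos], hx.2⟩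
  have r1 := rem_nonneg y hy.1.le hy.2 _ (by simpa using hcos) (fun k => ?_) _ hR
  · linarith
  · have := (abs_trig x k).1
    rw [abs_mul, abs_two]
    rw [abs_of_nonneg hcos] at this
    simp only [Nat.cast_zero, mul_zero, zero_add, one_mul]
    linarith

lemma beta_nonneg (x t : ℝ) (hx : x ∈ Icc 0 (π / 2)) (ht : t ∈ Ico 0 (π / 2)) :
    0 ≤ (D (π / 2) (-1) (x + Complex.I * (t : ℂ))).im := by
  have ha : 0 < π / 2 := by positivity
  have hd : ∀ s ∈ Icc 0 t, HasDerivAt (fun t' : ℝ => (D (π / 2) (-1) (x + Complex.I * t')).im)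
      (D (π / 2) 0 (x + Complex.I * s)).re s := fun s hs =>
    deriv_im (π / 2) ha (-1) (by norm_num) x s
      (by rw [abs_of_nonneg hs.1]; exact lt_of_le_of_lt hs.2 ht.2)
  have hm : MonotoneOn (fun t' : ℝ => (D (π / 2) (-1) (x + Complex.I * t')).im) (Icc 0 t) := by
    apply monotoneOn_of_deriv_nonneg (convex_Icc 0 t)
    · exact fun s hs => (hd s hs).continuousAt.continuousWithinAt
    · exact fun s hs => (hd s (interior_subset hs)).differentiableAt.differentiableWithinAt
    · intro s hs
      have hs' := interior_subset hs
      rw [(hd s hs').deriv]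
      have := re_nonneg x (π / 2 - s) hx ⟨by linarith [hs'.2, ht.2], by linarith [hs'.1]⟩
      rwa [sub_sub_cancel] at this
  have h1 := hm (left_mem_Icc.2 ht.1) (right_mem_Icc.2 ht.1) ht.1
  have h0 := im_real (π / 2) ha x
  simp only at h1
  rw [h0] at h1
  exact h1

end SQ

theorem stmt5 :
    ∀ x y : ℝ, x ∈ Set.Ioo 0 (π / 2) → y ∈ Set.Ioo 0 (π / 2) →
      h x y * hxy x y - hx x y * hy x y ≥ 0 := by
  intro x y hx hy
  have hpi := Real.pi_pos
  have ha : 0 < π / 2 := by positivity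
  have hy' : y ∈ Ioo 0 π := ⟨hy.1, by linarith [hy.2]⟩
  rw [SQ.h_eq x y hy', SQ.hx_eq x y hy', SQ.hy_eq x y hy', SQ.hxy_eq x y hy']
  have hk := SQ.key_identity (π / 2) ha (x + Complex.I * ((π / 2 - y : ℝ) : ℂ))
    (by rw [SQ.W_im]; exact SQ.abs_lt_of y hy')
  have hal := SQ.alpha_bound x y hx hy
  have hb := SQ.beta_nonneg x (π / 2 - y) ⟨hx.1.le, hx.2.le⟩ ⟨by linarith [hy.2], by linarith [hy.1]⟩
  have hl := SQ.lam_nonneg (π / 2) ha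
  set w : ℂ := x + Complex.I * ((π / 2 - y : ℝ) : ℂ) with hw
  have hg := SQ.g_nonneg (2 * (SQ.D (π / 2) (-1) w).re) (by linarith [hal.1]) (by linarith [hal.2])
  have hsh : 0 ≤ Real.sinh (2 * (SQ.D (π / 2) (-1) w).im) := Real.sinh_nonneg_iff.2 (by linarith)
  have hpos := mul_nonneg (mul_nonneg hl (div_nonneg hsh (by norm_num : (0:ℝ) ≤ 2))) hg
  have e : (2 / π) * (SQ.D (π / 2) (-1) w).re * ((2 / π) * (SQ.D (π / 2) 1 w).im) -
      (2 / π) * (SQ.D (π / 2) 0 w).re * ((2 / π) * (SQ.D (π / 2) 0 w).im) =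
      (2 / π) ^ 2 * ((SQ.D (π / 2) (-1) w).re * (SQ.D (π / 2) 1 w).im -
        (SQ.D (π / 2) 0 w).re * (SQ.D (π / 2) 0 w).im) := by ring
  rw [ge_iff_le, e]
  apply mul_nonneg (by positivity)
  rw [hk]
  calc (0:ℝ) ≤ _ := hpos
    _ = _ := by ring
end
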